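/- arXiv:0807.2137 — 4 statements merged into one kernel-verified Lean document; each statement's English description precedes it below -/
import Mathlib

section
/- Let P be a 3-dimensional polytope in ℝ³. Then there exists ρ > 0 such that for every vertex v of P and every x ∈ (v + S_ρ(P,v)) \ {v} there is an edge I of P containing v with F⁻(P,x) ∩ F₂(v,P) ⊆ F₂(I,P); i.e. every facet of P that contains v and is visible from x contains the edge I. -/
open scoped RealInnerProductSpace Pointwise
open Metric Set

noncomputable section

/-- Euclidean space ℝ^d. -/
abbrev E (d : ℕ) : Type := EuclideanSpace ℝ (Fin d)

/-- Evaluation of a multivariate polynomial at a point of ℝ^d. -/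
def evalPoly {d : ℕ} (p : MvPolynomial (Fin d) ℝ) (x : E d) : ℝ :=
  MvPolynomial.eval (fun i => x i) p

/-- A polytope: the convex hull of a (nonempty) finite point set. -/
def IsPolytope {d : ℕ} (P : Set (E d)) : Prop :=
  ∃ V : Finset (E d), V.Nonempty ∧ P = convexHull ℝ (V : Set (E d))

/-- A polyhedron: a nonempty intersection of finitely many closed halfspaces. -/
def IsPolyhedron {d : ℕ} (P : Set (E d)) : Prop :=
  P.Nonempty ∧ ∃ (m : ℕ) (a : Fin m → E d) (b : Fin m → ℝ),
    P = {x : E d | ∀ i, ⟪a i, x⟫ ≤ b i}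

/-- Dimension of a set: the dimension of its affine hull. -/
def dimS {d : ℕ} (A : Set (E d)) : ℕ :=
  Module.finrank ℝ (affineSpan ℝ A).direction

/-- Faces of a polytope (= exposed subsets). -/
def IsFaceOf {d : ℕ} (P F : Set (E d)) : Prop := IsExposed ℝ P F

/-- A facet of an n-dimensional polytope: an (n−1)-dimensional face. -/
def IsFacetOf {d : ℕ} (P F : Set (E d)) : Prop :=
  IsExposed ℝ P F ∧ dimS F + 1 = dimS P

/-- A vertex: a 0-dimensional face. -/
def IsVertexOf {d : ℕ} (P : Set (E d)) (v : E d) : Prop := IsExposed ℝ P {v}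

/-- Support function h(P,u). -/
def suppF {d : ℕ} (P : Set (E d)) (u : E d) : ℝ := sSup ((fun x => ⟪u, x⟫) '' P)

/-- Exposed face F(P,u) of P in direction u. -/
def exposedSet {d : ℕ} (P : Set (E d)) (u : E d) : Set (E d) :=
  {x ∈ P | ⟪u, x⟫ = suppF P u}

/-- The unit outer normal u_F(P) of a facet G of P, parallel to aff P. -/
def outerNormal {d : ℕ} (P G : Set (E d)) : E d :=
  Classical.epsilon fun u : E d =>
    u ∈ (affineSpan ℝ P).direction ∧ ‖u‖ = 1 ∧ exposedSet P u = G

/-- q_G(P,x) := (h(P,u_G(P)) − ⟨u_G(P),x⟩)/diam(P). -/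
def qF {d : ℕ} (P G : Set (E d)) (x : E d) : ℝ :=
  (suppF P (outerNormal P G) - ⟪outerNormal P G, x⟫) / Metric.diam P

/-- Conical hull: all nonnegative combinations of points of A. -/
def coneHull {d : ℕ} (A : Set (E d)) : Set (E d) :=
  {x | ∃ (n : ℕ) (c : Fin n → ℝ) (p : Fin n → E d),
    (∀ i, 0 ≤ c i) ∧ (∀ i, p i ∈ A) ∧ x = ∑ i, c i • p i}

/-- Supporting cone S(P,v) := cone (P − v). -/
def suppCone {d : ℕ} (P : Set (E d)) (v : E d) : Set (E d) :=
  coneHull ((fun x => x - v) '' P)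

/-- F⁻(P,x): the facets of P visible from x. -/
def visFacets {d : ℕ} (P : Set (E d)) (x : E d) : Set (Set (E d)) :=
  {G | IsFacetOf P G ∧ qF P G x ≤ 0}

/-- The facets of P containing the set A. -/
def facetsCont {d : ℕ} (P A : Set (E d)) : Set (Set (E d)) :=
  {G | IsFacetOf P G ∧ A ⊆ G}

/-- u_G(P): the normalized sum of the outer facet normals over facets containing G. -/
def uface {d : ℕ} (P G : Set (E d)) : E d :=
  ‖∑ᶠ F ∈ facetsCont P G, outerNormal P F‖⁻¹ • ∑ᶠ F ∈ facetsCont P G, outerNormal P F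

/-- The hyperplane H_v(P) := {x : ⟨x, u_v(P)⟩ = −1}. -/
def Hv {d : ℕ} (P : Set (E d)) (v : E d) : Set (E d) :=
  {x : E d | ⟪x, uface P {v}⟫ = -1}

/-- P_v := S(P,v) ∩ H_v(P). -/
def vertFig {d : ℕ} (P : Set (E d)) (v : E d) : Set (E d) :=
  suppCone P v ∩ Hv P v

/-- S_ρ(P,v) := cone((P_v + B(o,ρ)) ∩ H_v(P)). -/
def Srho {d : ℕ} (P : Set (E d)) (v : E d) (ρ : ℝ) : Set (E d) :=
  coneHull ((vertFig P v + Metric.closedBall (0 : E d) ρ) ∩ Hv P v)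

/-- Condition 𝒜(P): Hausdorff distance between P and {x ∈ aff P : g_l(x) ≥ 0} tends to 0. -/
def condA {d : ℕ} (P : Set (E d)) (g : ℕ → MvPolynomial (Fin d) ℝ) : Prop :=
  Filter.Tendsto
    (fun l => Metric.hausdorffDist P
      {x ∈ (affineSpan ℝ P : Set (E d)) | 0 ≤ evalPoly (g l) x})
    Filter.atTop (nhds 0)

/-- Condition ℐ(P): each g_l vanishes on all vertices of P. -/
def condI {d : ℕ} (P : Set (E d)) (g : ℕ → MvPolynomial (Fin d) ℝ) : Prop :=
  ∀ (l : ℕ) (v : E d), IsVertexOf P v → evalPoly (g l) v = 0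

/-- Condition 𝒞(P): each g_l is strictly concave on aff P. -/
def condC {d : ℕ} (P : Set (E d)) (g : ℕ → MvPolynomial (Fin d) ℝ) : Prop :=
  ∀ l : ℕ, StrictConcaveOn ℝ (affineSpan ℝ P : Set (E d)) (evalPoly (g l))

lemma hx_delta (V : Finset (E 3)) (v N : E 3) (h : ∀ w ∈ V, w ≠ v → ⟪N, w - v⟫ < 0) :
    ∃ δ : ℝ, 0 < δ ∧ ∀ w ∈ V, ⟪N, w - v⟫ ≤ -(δ * ‖w - v‖) := by
  have H : ∀ᶠ δ : ℝ in nhdsWithin 0 (Set.Ioi 0), ∀ w ∈ V, ⟪N, w - v⟫ ≤ -(δ * ‖w - v‖) := by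
    rw [Filter.eventually_all_finset]
    intro w hw
    by_cases hwv : w = v
    · subst hwv; simp
    · have h1 : Filter.Tendsto (fun δ : ℝ => -(δ * ‖w - v‖)) (nhdsWithin 0 (Set.Ioi 0))
          (nhds (-(0 * ‖w - v‖))) := by
        apply Filter.Tendsto.mono_left _ nhdsWithin_le_nhds
        exact Continuous.tendsto (by fun_prop) 0
      have h2 := h1.eventually_const_lt (u := ⟪N, w - v⟫) (by simpa using h w hw hwv)
      exact h2.mono fun _ h => h.le
  obtain ⟨δ, h1, h2⟩ := (H.and self_mem_nhdsWithin).exists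
  exact ⟨δ, h2, h1⟩

lemma hx_cone (V : Finset (E 3)) (v N : E 3) (δ : ℝ) (hδ : 0 < δ)
    (h : ∀ w ∈ V, ⟪N, w - v⟫ ≤ -(δ * ‖w - v‖)) (p : E 3)
    (hp : p ∈ suppCone (convexHull ℝ (V : Set (E 3))) v) : ⟪N, p⟫ ≤ -(δ * ‖p‖) := by
  have hc : ∀ x ∈ convexHull ℝ (V : Set (E 3)), ⟪N, x - v⟫ ≤ -(δ * ‖x - v‖) := by
    have : convexHull ℝ (V : Set (E 3)) ⊆ {x | ⟪N, x - v⟫ ≤ -(δ * ‖x - v‖)} := by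
      apply convexHull_min
      · intro w hw; exact h w hw
      · intro x hx y hy a b ha hb hab
        simp only [Set.mem_ofPred_eq] at hx hy ⊢
        have e : a • x + b • y - v = a • (x - v) + b • (y - v) := by
          have : v = (a + b) • v := by rw [hab, one_smul]
          conv_lhs => rw [this]
          module
        rw [e, inner_add_right, inner_smul_right, inner_smul_right]
        have n1 : ‖a • (x - v) + b • (y - v)‖ ≤ a * ‖x - v‖ + b * ‖y - v‖ := by
          refine (norm_add_le _ _).trans ?_
          rw [norm_smul, norm_smul, Real.norm_of_nonneg ha, Real.norm_of_nonneg hb]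
        have n2 := mul_le_mul_of_nonneg_left n1 hδ.le
        have n3 := mul_le_mul_of_nonneg_left hx ha
        have n4 := mul_le_mul_of_nonneg_left hy hb
        nlinarith
    exact this
  obtain ⟨n, c, q, hc0, hq, rfl⟩ := hp
  rw [inner_sum]
  have n1 : ‖∑ i, c i • q i‖ ≤ ∑ i, c i * ‖q i‖ := by
    refine (norm_sum_le _ _).trans (Finset.sum_le_sum fun i _ => ?_)
    rw [norm_smul, Real.norm_of_nonneg (hc0 i)]
  have n2 : ∑ i, ⟪N, c i • q i⟫ ≤ ∑ i, -(δ * (c i * ‖q i‖)) := by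
    refine Finset.sum_le_sum fun i _ => ?_
    obtain ⟨x, hx, hxe⟩ := hq i
    have := mul_le_mul_of_nonneg_left (hc x hx) (hc0 i)
    simp only at hxe
    rw [hxe] at this
    rw [inner_smul_right]; nlinarith
  rw [Finset.sum_neg_distrib, ← Finset.mul_sum] at n2
  have := mul_le_mul_of_nonneg_left n1 hδ.le
  linarith

lemma hx_uface (P G : Set (E 3)) : ‖uface P G‖ ≤ 1 := by
  unfold uface
  rw [norm_smul, norm_inv, norm_norm]
  exact inv_mul_le_one

/-- smallness of ρ -/
lemma hx_key (V : Finset (E 3)) (v N : E 3) (h : ∀ w ∈ V, w ≠ v → ⟪N, w - v⟫ < 0) :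
    ∀ᶠ ρ : ℝ in nhdsWithin 0 (Set.Ioi 0),
      ∀ s ∈ Srho (convexHull ℝ (V : Set (E 3))) v ρ, s ≠ 0 → ⟪N, s⟫ < 0 := by
  obtain ⟨δ, hδ, hd⟩ := hx_delta V v N h
  have h1 : Filter.Tendsto (fun ρ : ℝ => -(δ * (1 - ρ)) + ‖N‖ * ρ) (nhdsWithin 0 (Set.Ioi 0))
      (nhds (-(δ * (1 - 0)) + ‖N‖ * 0)) := by
    apply Filter.Tendsto.mono_left _ nhdsWithin_le_nhds
    exact Continuous.tendsto (by fun_prop) 0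
  have h2 := h1.eventually_lt_const (u := 0) (by simpa using hδ)
  filter_upwards [h2] with ρ hρ s hs hs0
  obtain ⟨n, c, y, hc0, hy, rfl⟩ := hs
  have hy' : ∀ i, ⟪N, y i⟫ < 0 := by
    intro i
    obtain ⟨⟨p, hp, e, he, hpe⟩, hH⟩ := hy i
    have hp1 := hx_cone V v N δ hδ hd p hp.1
    have he' : ‖e‖ ≤ ρ := by simpa using he
    have hH' : ⟪y i, uface (convexHull ℝ (V : Set (E 3))) {v}⟫ = -1 := hH
    have hn := abs_real_inner_le_norm (y i) (uface (convexHull ℝ (V : Set (E 3))) {v})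
    rw [hH'] at hn
    have hu := hx_uface (convexHull ℝ (V : Set (E 3))) {v}
    have hy1 : 1 ≤ ‖y i‖ := by
      have := mul_le_mul_of_nonneg_left hu (norm_nonneg (y i))
      norm_num at hn
      linarith
    simp only at hpe
    rw [← hpe] at hy1 ⊢
    have n1 := norm_add_le p e
    have n2 := real_inner_le_norm N e
    have n3 := mul_le_mul_of_nonneg_left he' (norm_nonneg N)
    rw [inner_add_right]
    have n4 := mul_le_mul_of_nonneg_left (show 1 - ρ ≤ ‖p‖ by linarith) hδ.le
    linarith
  rw [inner_sum]
  simp only [inner_smul_right]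
  have : ∃ i, c i ≠ 0 := by
    by_contra! hcon
    exact hs0 (by simp [hcon])
  obtain ⟨i, hi⟩ := this
  apply Finset.sum_neg'
  · intro j _; exact mul_nonpos_of_nonneg_of_nonpos (hc0 j) (hy' j).le
  · exact ⟨i, Finset.mem_univ _, mul_neg_of_pos_of_neg (lt_of_le_of_ne (hc0 i) hi.symm) (hy' i)⟩

lemma hx_eps (V : Finset (E 3)) (v g f : E 3) (hg : ∀ w ∈ V, ⟪g, w - v⟫ ≤ 0)  :
    ∃ ε : ℝ, 0 < ε ∧ ∀ w ∈ V, ⟪g, w - v⟫ < 0 → ⟪g + ε • f, w - v⟫ < 0 := by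
  have H : ∀ᶠ ε : ℝ in nhdsWithin 0 (Set.Ioi 0), ∀ w ∈ V, ⟪g, w - v⟫ < 0 →
      ⟪g + ε • f, w - v⟫ < 0 := by
    rw [Filter.eventually_all_finset]
    intro w hw
    by_cases hwv : ⟪g, w - v⟫ < 0
    · have h1 : Filter.Tendsto (fun ε : ℝ => ⟪g + ε • f, w - v⟫) (nhdsWithin 0 (Set.Ioi 0))
          (nhds (⟪g + (0:ℝ) • f, w - v⟫)) := by
        apply Filter.Tendsto.mono_left _ nhdsWithin_le_nhds
        exact Continuous.tendsto (by fun_prop) 0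
      have h2 := h1.eventually_lt_const (u := 0) (by simpa using hwv)
      exact h2.mono fun _ h _ => h
    · simp [hwv]
  obtain ⟨δ, h1, h2⟩ := (H.and self_mem_nhdsWithin).exists
  exact ⟨δ, h2, h1⟩

lemma hx_edge (V : Finset (E 3)) (v a : E 3) (ha : ∀ w ∈ V, w ≠ v → ⟪a, w - v⟫ < 0) :
    ∀ (n : ℕ) (g : E 3), (V.filter (fun w => ⟪g, w - v⟫ = 0)).card ≤ n →
      (∀ w ∈ V, ⟪g, w - v⟫ ≤ 0) → (∃ w ∈ V, w ≠ v ∧ ⟪g, w - v⟫ = 0) →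
      ∃ g' : E 3, (∀ w ∈ V, ⟪g', w - v⟫ ≤ 0) ∧
        (∀ w ∈ V, ⟪g', w - v⟫ = 0 → ⟪g, w - v⟫ = 0) ∧
        ∃ w' ∈ V, w' ≠ v ∧ ⟪g', w' - v⟫ = 0 ∧
          ∀ w ∈ V, ⟪g', w - v⟫ = 0 → ∃ t : ℝ, w - v = t • (w' - v) := by
  intro n
  induction n with
  | zero =>
    rintro g hn hg ⟨w, hw, hwv, hw0⟩
    have : w ∈ V.filter (fun w => ⟪g, w - v⟫ = 0) := by simp [hw, hw0]
    have := Finset.card_pos.2 ⟨w, this⟩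
    omega
  | succ n ih =>
    rintro g hn hg ⟨w₁, hw₁, hw₁v, hw₁0⟩
    by_cases hcol : ∀ w ∈ V, ⟪g, w - v⟫ = 0 → ∃ t : ℝ, w - v = t • (w₁ - v)
    · exact ⟨g, hg, fun _ _ h => h, w₁, hw₁, hw₁v, hw₁0, hcol⟩
    push Not at hcol
    obtain ⟨w₂, hw₂, hw₂0, hw₂t⟩ := hcol
    obtain ⟨b, hb1, hb2⟩ : ∃ b : E 3, ⟪b, w₁ - v⟫ = 0 ∧ 0 < ⟪b, w₂ - v⟫ := by
      have hne : ⟪w₁ - v, w₁ - v⟫ ≠ 0 := by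
        rw [Ne, inner_self_eq_zero, sub_eq_zero]; exact hw₁v
      set t := ⟪w₂ - v, w₁ - v⟫ / ⟪w₁ - v, w₁ - v⟫ with ht
      have e1 : ⟪(w₂ - v) - t • (w₁ - v), w₁ - v⟫ = 0 := by
        rw [inner_sub_left, real_inner_smul_left, ht]; field_simp; ring
      refine ⟨(w₂ - v) - t • (w₁ - v), e1, ?_⟩
      have e3 : ⟪(w₂ - v) - t • (w₁ - v), w₂ - v⟫ =
          ⟪(w₂ - v) - t • (w₁ - v), (w₂ - v) - t • (w₁ - v)⟫ := by
        rw [inner_sub_right (𝕜 := ℝ) _ (w₂ - v) (t • (w₁ - v)), inner_smul_right, e1]; simp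
      rw [e3]
      apply real_inner_self_pos.2
      rw [sub_ne_zero]; exact hw₂t t
    obtain ⟨ws, hws, hmin⟩ := Finset.exists_min_image
      (V.filter (fun w => ⟪g, w - v⟫ = 0 ∧ 0 < ⟪b, w - v⟫))
      (fun w => -⟪a, w - v⟫ / ⟪b, w - v⟫) ⟨w₂, by simp [hw₂, hw₂0, hb2]⟩
    simp only [Finset.mem_filter] at hws hmin
    obtain ⟨hwsV, hws0, hwsb⟩ := hws
    have hwsv : ws ≠ v := by rintro rfl; simp at hwsb
    set t := -⟪a, ws - v⟫ / ⟪b, ws - v⟫ with ht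
    have htpos : 0 < t := div_pos (by linarith [ha ws hwsV hwsv]) hwsb
    have hale : ∀ w ∈ V, ⟪a, w - v⟫ ≤ 0 := by
      intro w hw
      by_cases hwv : w = v
      · simp [hwv]
      · exact (ha w hw hwv).le
    set f := a + t • b with hf
    have hfe : ∀ x : E 3, ⟪f, x⟫ = ⟪a, x⟫ + t * ⟪b, x⟫ := by
      intro x; rw [hf, inner_add_left, real_inner_smul_left]
    have hfle : ∀ w ∈ V, ⟪g, w - v⟫ = 0 → ⟪f, w - v⟫ ≤ 0 := by
      intro w hw hw0
      rw [hfe]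
      by_cases hbw : 0 < ⟪b, w - v⟫
      · have := hmin w ⟨hw, hw0, hbw⟩
        rw [le_div_iff₀ hbw] at this
        linarith
      · have := hale w hw
        nlinarith
    have hfs : ⟪f, ws - v⟫ = 0 := by
      rw [hfe, ht]; field_simp; ring
    have hf1 : ⟪f, w₁ - v⟫ < 0 := by
      rw [hfe, hb1]; linarith [ha w₁ hw₁ hw₁v]
    obtain ⟨ε, hε, hεw⟩ := hx_eps V v g f hg
    have hge : ∀ x : E 3, ⟪g + ε • f, x⟫ = ⟪g, x⟫ + ε * ⟪f, x⟫ := by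
      intro x; rw [inner_add_left, real_inner_smul_left]
    have hsub : ∀ w ∈ V, ⟪g + ε • f, w - v⟫ = 0 → ⟪g, w - v⟫ = 0 := by
      intro w hw h0
      by_contra hne
      exact (hεw w hw (lt_of_le_of_ne (hg w hw) hne)).ne h0
    obtain ⟨g', h1, h2, h3⟩ := ih (g + ε • f) (by
        have : V.filter (fun w => ⟪g + ε • f, w - v⟫ = 0) ⊂ V.filter (fun w => ⟪g, w - v⟫ = 0) := by
          rw [Finset.ssubset_iff_of_subset]
          · refine ⟨w₁, by simp [hw₁, hw₁0], ?_⟩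
            simp only [Finset.mem_filter, not_and]
            intro _
            rw [hge, hw₁0]
            have := mul_neg_of_pos_of_neg hε hf1
            linarith
          · intro w hw
            simp only [Finset.mem_filter] at hw ⊢
            exact ⟨hw.1, hsub w hw.1 hw.2⟩
        have := Finset.card_lt_card this
        omega) (by
        intro w hw
        by_cases h0 : ⟪g, w - v⟫ = 0
        · rw [hge, h0]
          have := mul_nonpos_of_nonneg_of_nonpos hε.le (hfle w hw h0)
          linarith
        · exact (hεw w hw (lt_of_le_of_ne (hg w hw) h0)).le)
        ⟨ws, hwsV, hwsv, by rw [hge, hws0, hfs]; simp⟩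
    exact ⟨g', h1, fun w hw h => hsub w hw (h2 w hw h), h3⟩

lemma hx_face (V : Finset (E 3)) (F : Set (E 3))
    (hF : IsExposed ℝ (convexHull ℝ (V : Set (E 3))) F) :
    F = convexHull ℝ (F ∩ (V : Set (E 3))) := by
  have hPc : IsCompact (convexHull ℝ (V : Set (E 3))) := V.finite_toSet.isCompact_convexHull ℝ
  have hFc : IsCompact F := hF.isCompact hPc
  have hFv : Convex ℝ F := hF.convex (convex_convexHull ℝ _)
  apply Set.Subset.antisymm
  · have h1 : F.extremePoints ℝ ⊆ F ∩ (V : Set (E 3)) := fun x hx =>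
      ⟨hx.1, extremePoints_convexHull_subset (hF.isExtreme.extremePoints_subset_extremePoints hx)⟩
    rw [← closure_convexHull_extremePoints hFc hFv]
    have hc : IsClosed (convexHull ℝ (F ∩ (V : Set (E 3)))) :=
      ((V.finite_toSet.inter_of_right F).isCompact_convexHull ℝ).isClosed
    rw [closure_convexHull_extremePoints hFc hFv]
    conv_lhs => rw [← closure_convexHull_extremePoints hFc hFv]
    exact closure_minimal (convexHull_mono h1) hc
  · exact convexHull_min Set.inter_subset_left hFv

lemma hx_finite (V : Finset (E 3)) :
    {F | IsFacetOf (convexHull ℝ (V : Set (E 3))) F}.Finite := by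
  refine Set.Finite.of_finite_image (f := fun F => F ∩ (V : Set (E 3))) ?_ ?_
  · refine (V.finite_toSet.finite_subsets).subset ?_
    rintro _ ⟨F, _, rfl⟩
    exact Set.inter_subset_right
  · intro F hF G hG h
    simp only at h
    rw [hx_face V F hF.1, hx_face V G hG.1, h]

lemma hx_normal (P F : Set (E 3)) (hPc : IsCompact P) (hdim : dimS P = 3) (v : E 3)
    (hF : IsFacetOf P F) (hv : v ∈ F) :
    (∀ y ∈ P, ⟪outerNormal P F, y - v⟫ ≤ 0) ∧
    (∀ y ∈ P, ⟪outerNormal P F, y - v⟫ = 0 → y ∈ F) ∧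
    suppF P (outerNormal P F) = ⟪outerNormal P F, v⟫ := by
  have hsup : ∀ u : E 3, ∀ y ∈ P, ⟪u, y⟫ ≤ suppF P u := by
    intro u y hy
    refine le_csSup ?_ ⟨y, hy, rfl⟩
    exact (hPc.image (by fun_prop)).bddAbove
  have hex : ∃ u : E 3, u ∈ (affineSpan ℝ P).direction ∧ ‖u‖ = 1 ∧ exposedSet P u = F := by
    obtain ⟨l, hl⟩ := hF.1 ⟨v, hv⟩
    obtain ⟨a, rfl⟩ := (InnerProductSpace.toDual ℝ (E 3)).surjective l
    simp only [InnerProductSpace.toDual_apply_apply] at hl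
    have ha : a ≠ 0 := by
      rintro rfl
      have : F = P := by rw [hl]; simp
      have h2 := hF.2
      rw [this] at h2
      omega
    have htop : (affineSpan ℝ P).direction = ⊤ := by
      apply Submodule.eq_top_of_finrank_eq
      have : Module.finrank ℝ (affineSpan ℝ P).direction = 3 := hdim
      rw [this]; simp
    have hna : 0 < ‖a‖⁻¹ := inv_pos.2 (norm_pos_iff.2 ha)
    have hvP : v ∈ P := by rw [hl] at hv; exact hv.1
    have hvm : ∀ y ∈ P, ⟪a, y⟫ ≤ ⟪a, v⟫ := by rw [hl] at hv; exact hv.2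
    have hs : suppF P (‖a‖⁻¹ • a) = ⟪‖a‖⁻¹ • a, v⟫ := by
      apply le_antisymm _ (hsup _ v hvP)
      apply csSup_le (Set.Nonempty.image _ ⟨v, hvP⟩)
      rintro _ ⟨y, hy, rfl⟩
      simp only [real_inner_smul_left]
      exact mul_le_mul_of_nonneg_left (hvm y hy) hna.le
    refine ⟨‖a‖⁻¹ • a, by rw [htop]; trivial, norm_smul_inv_norm ha, ?_⟩
    rw [hl]
    ext x
    simp only [exposedSet, Set.mem_ofPred_eq, hs, real_inner_smul_left]
    constructor
    · rintro ⟨h1, h2⟩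
      refine ⟨h1, ?_⟩
      have := mul_left_cancel₀ hna.ne' h2
      rw [this]; exact hvm
    · rintro ⟨h1, h2⟩
      refine ⟨h1, ?_⟩
      rw [le_antisymm (hvm x h1) (h2 v hvP)]
  have hsp := Classical.epsilon_spec hex
  change _ ∧ ‖outerNormal P F‖ = 1 ∧ exposedSet P (outerNormal P F) = F at hsp
  have h3 : suppF P (outerNormal P F) = ⟪outerNormal P F, v⟫ := by
    have : v ∈ exposedSet P (outerNormal P F) := by rw [hsp.2.2]; exact hv
    exact this.2.symm
  refine ⟨?_, ?_, h3⟩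
  · intro y hy
    rw [inner_sub_right, ← h3]
    linarith [hsup (outerNormal P F) y hy]
  · intro y hy h
    rw [← hsp.2.2]
    refine ⟨hy, ?_⟩
    rw [inner_sub_right] at h
    linarith

theorem visible_facets_at_cone_near_vertex (P : Set (E 3))
    (hP : IsPolytope P) (hdim : dimS P = 3) :
    ∃ ρ : ℝ, 0 < ρ ∧ ∀ v : E 3, IsVertexOf P v →
      ∀ x ∈ ((fun s => v + s) '' Srho P v ρ) \ {v},
        ∃ I : Set (E 3), IsFaceOf P I ∧ dimS I = 1 ∧ v ∈ I ∧
          visFacets P x ∩ facetsCont P {v} ⊆ facetsCont P I := by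
  classical
  obtain ⟨V, hVne, rfl⟩ := hP
  have hPc : IsCompact (convexHull ℝ (V : Set (E 3))) := V.finite_toSet.isCompact_convexHull ℝ
  have hVP : (V : Set (E 3)) ⊆ convexHull ℝ (V : Set (E 3)) := subset_convexHull ℝ _
  set P := convexHull ℝ (V : Set (E 3)) with hPdef
  have hfin := hx_finite V
  have hdiam : 0 < Metric.diam P := by
    have hnt : P.Nontrivial := by
      by_contra hcon
      rw [Set.not_nontrivial_iff] at hcon
      unfold dimS at hdim
      rw [direction_affineSpan, vectorSpan_of_subsingleton ℝ hcon] at hdim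
      simp at hdim
    obtain ⟨y, hy, z, hz, hyz⟩ := hnt
    exact (dist_pos.2 hyz).trans_le (Metric.dist_le_diam_of_mem hPc.isBounded hy hz)
  have H : ∀ᶠ ρ : ℝ in nhdsWithin 0 (Set.Ioi 0), ∀ v ∈ V, ∀ 𝓕 ∈ hfin.toFinset.powerset,
      (∀ w ∈ V, w ≠ v → ⟪∑ F ∈ 𝓕, outerNormal P F, w - v⟫ < 0) →
      ∀ s ∈ Srho P v ρ, s ≠ 0 → ⟪∑ F ∈ 𝓕, outerNormal P F, s⟫ < 0 := by
    rw [Filter.eventually_all_finset]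
    intro v _
    rw [Filter.eventually_all_finset]
    intro 𝓕 _
    by_cases h : ∀ w ∈ V, w ≠ v → ⟪∑ F ∈ 𝓕, outerNormal P F, w - v⟫ < 0
    · exact (hx_key V v _ h).mono fun _ h _ => h
    · exact Filter.Eventually.of_forall fun _ h' => absurd h' h
  obtain ⟨ρ, hρ, hρ0⟩ := (H.and self_mem_nhdsWithin).exists
  refine ⟨ρ, hρ0, ?_⟩
  rintro v hv x ⟨⟨s, hs, rfl⟩, hxv⟩
  have hs0 : s ≠ 0 := by
    rintro rfl; simp at hxv
  have hvV : v ∈ V := by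
    have h1 : v ∈ P.extremePoints ℝ := by
      have := (IsExposed.isExtreme hv)
      exact isExtreme_singleton.1 this
    exact extremePoints_convexHull_subset h1
  have hvP : v ∈ P := hVP hvV
  obtain ⟨l, hl⟩ := hv ⟨v, rfl⟩
  obtain ⟨a, rfl⟩ := (InnerProductSpace.toDual ℝ (E 3)).surjective l
  simp only [InnerProductSpace.toDual_apply_apply] at hl
  have ha : ∀ w ∈ V, w ≠ v → ⟪a, w - v⟫ < 0 := by
    intro w hw hwv
    have hv1 : ∀ y ∈ P, ⟪a, y⟫ ≤ ⟪a, v⟫ := by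
      have : v ∈ ({v} : Set (E 3)) := rfl
      rw [hl] at this; exact this.2
    rw [inner_sub_right, sub_neg]
    apply lt_of_le_of_ne (hv1 w (hVP hw))
    intro he
    apply hwv
    have : w ∈ ({v} : Set (E 3)) := by
      rw [hl]; exact ⟨hVP hw, by rw [he]; exact hv1⟩
    exact this
  -- visible facets
  set S := visFacets P (v + s) ∩ facetsCont P {v} with hS
  have hSfin : S.Finite := hfin.subset fun F hF => hF.1.1
  have hnor : ∀ F ∈ S, (∀ y ∈ P, ⟪outerNormal P F, y - v⟫ ≤ 0) ∧
    (∀ y ∈ P, ⟪outerNormal P F, y - v⟫ = 0 → y ∈ F) ∧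
    suppF P (outerNormal P F) = ⟪outerNormal P F, v⟫ := fun F hF =>
      hx_normal P F hPc hdim v hF.1.1 (hF.2.2 rfl)
  set N := ∑ F ∈ hSfin.toFinset, outerNormal P F with hN
  have hNs : 0 ≤ ⟪N, s⟫ := by
    rw [hN, sum_inner]
    apply Finset.sum_nonneg
    intro F hF
    have hF' : F ∈ S := by simpa using hF
    have hq := hF'.1.2
    unfold qF at hq
    rw [(hnor F hF').2.2, inner_add_right] at hq
    by_contra hcon
    push Not at hcon
    have : 0 < (⟪outerNormal P F, v⟫ - (⟪outerNormal P F, v⟫ + ⟪outerNormal P F, s⟫)) /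
        Metric.diam P := div_pos (by linarith) hdiam
    linarith
  have hNle : ∀ w ∈ V, ⟪N, w - v⟫ ≤ 0 := by
    intro w hw
    rw [hN, sum_inner]
    apply Finset.sum_nonpos
    intro F hF
    exact (hnor F (by simpa using hF)).1 w (hVP hw)
  have hex : ∃ w ∈ V, w ≠ v ∧ ⟪N, w - v⟫ = 0 := by
    by_contra! hcon
    have := hρ v hvV hSfin.toFinset (by
      rw [Finset.mem_powerset]
      intro F hF
      have hF' : F ∈ S := by simpa using hF
      simpa using hF'.1.1)
      (fun w hw hwv => lt_of_le_of_ne (hNle w hw) (hcon w hw hwv)) s hs hs0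
    linarith
  obtain ⟨g, hg, hgN, w', hw', hw'v, hw'0, hcol⟩ := hx_edge V v a ha _ N le_rfl hNle hex
  have hgP : ∀ y ∈ P, ⟪g, y⟫ ≤ ⟪g, v⟫ := by
    have : P ⊆ {y | ⟪g, y⟫ ≤ ⟪g, v⟫} := by
      apply convexHull_min
      · intro w hw
        have := hg w hw
        rw [inner_sub_right] at this
        simp only [Set.mem_ofPred_eq]; linarith
      · exact convex_halfSpace_le (innerSL ℝ g).isLinear _
    exact this
  set I : Set (E 3) := {x ∈ P | ∀ y ∈ P, ⟪g, y⟫ ≤ ⟪g, x⟫} with hI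
  have hIexp : IsExposed ℝ P I := fun _ => ⟨innerSL ℝ g, by simp [hI]⟩
  have hvI : v ∈ I := ⟨hvP, hgP⟩
  have hw'I : w' ∈ I := by
    refine ⟨hVP hw', ?_⟩
    rw [inner_sub_right, sub_eq_zero] at hw'0
    rw [hw'0]; exact hgP
  have hIg : ∀ y ∈ I, ⟪g, y - v⟫ = 0 := by
    intro y hy
    rw [inner_sub_right, sub_eq_zero]
    exact le_antisymm (hgP y hy.1) (hy.2 v hvP)
  have hIhull := hx_face V I hIexp
  refine ⟨I, hIexp, ?_, hvI, ?_⟩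
  · have haff : affineSpan ℝ I = affineSpan ℝ {v, w'} := by
      apply le_antisymm
      · rw [affineSpan_le, hIhull]
        apply convexHull_min _ (AffineSubspace.convex _)
        rintro w ⟨hwI, hwV⟩
        obtain ⟨t, ht⟩ := hcol w hwV (hIg w hwI)
        have : w = AffineMap.lineMap v w' t := by
          rw [AffineMap.lineMap_apply, vsub_eq_sub, vadd_eq_add, ← ht]; abel
        rw [this]
        exact AffineMap.lineMap_mem_affineSpan_pair t v w'
      · apply affineSpan_mono
        rintro y (rfl | rfl)
        · exact hvI
        · exact hw'I
    unfold dimS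
    rw [haff, direction_affineSpan, vectorSpan_pair_rev]
    apply finrank_span_singleton
    simpa [sub_eq_zero] using hw'v
  · intro F hF
    refine ⟨hF.1.1, ?_⟩
    rw [hIhull]
    apply convexHull_min _ (hF.1.1.1.convex (convex_convexHull ℝ _))
    rintro w ⟨hwI, hwV⟩
    have h0 := hgN w hwV (hIg w hwI)
    rw [hN, sum_inner] at h0
    rw [Finset.sum_eq_zero_iff_of_nonpos] at h0
    · exact (hnor F hF).2.1 w (hVP hwV) (h0 F (by simpa using hF))
    · intro G hG
      exact (hnor G (by simpa using hG)).1 w (hVP hwV)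
end
end

section
/- Let P be a 3-dimensional polytope in ℝ³, let v be a vertex of P, and let ρ > 0. Then there exists a polynomial b ∈ ℝ[x₁,x₂,x₃] such that: (i) b has even degree and x ↦ b(x + v) is a homogeneous polynomial; (ii) b(v + x) = b(v − x) for all x ∈ ℝ³; (iii) the set B := {x ∈ ℝ³ : ⟨x − v, u_v(P)⟩ ≤ 0 and b(x) ≥ 0} is a convex cone with apex v and P ⊆ B; (iv) (v + S(P,v)) ∪ (v − S(P,v)) ⊆ {x : b(x) ≥ 0} ⊆ {v} ∪ (v + int S_ρ(P,v)) ∪ (v − int S_ρ(P,v)); and (v) for every edge I of P containing v and every x ∈ v + S_ρ(P,v) with F⁻(P,x) = F₂(I,P), one has b(x) ≤ 0 with equality if and only if x ∈ v + cone(I − v). -/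
open scoped RealInnerProductSpace Pointwise
open Metric Set

noncomputable section

/-- Finitely generated cone. -/
def Cn (G : Finset (E 3)) : Set (E 3) :=
  {x | ∃ c : E 3 → ℝ, (∀ g, 0 ≤ c g) ∧ x = ∑ g ∈ G, c g • g}

lemma Cn_zero (G : Finset (E 3)) : (0 : E 3) ∈ Cn G := ⟨0, by simp, by simp⟩

lemma Cn_add {G : Finset (E 3)} {x y : E 3} (hx : x ∈ Cn G) (hy : y ∈ Cn G) : x + y ∈ Cn G := by
  obtain ⟨c, hc, rfl⟩ := hx
  obtain ⟨d, hd, rfl⟩ := hy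
  exact ⟨c + d, fun g => add_nonneg (hc g) (hd g), by simp [add_smul, Finset.sum_add_distrib]⟩

lemma Cn_smul {G : Finset (E 3)} {x : E 3} (hx : x ∈ Cn G) {r : ℝ} (hr : 0 ≤ r) :
    r • x ∈ Cn G := by
  obtain ⟨c, hc, rfl⟩ := hx
  exact ⟨fun g => r * c g, fun g => mul_nonneg hr (hc g), by simp [Finset.smul_sum, mul_smul]⟩

lemma Cn_sum {G : Finset (E 3)} {ι : Type*} (s : Finset ι) (f : ι → E 3)
    (h : ∀ i ∈ s, f i ∈ Cn G) : ∑ i ∈ s, f i ∈ Cn G := by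
  classical
  induction s using Finset.induction_on with
  | empty => simpa using Cn_zero G
  | insert a s ha ih =>
    rw [Finset.sum_insert ha]
    exact Cn_add (h a (by simp)) (ih fun i hi => h i (by simp [hi]))

lemma Cn_gen {G : Finset (E 3)} {g : E 3} (hg : g ∈ G) : g ∈ Cn G := by
  classical
  refine ⟨fun x => if x = g then 1 else 0, fun x => by dsimp only; split_ifs <;> simp, ?_⟩
  simp [hg]

lemma Cn_sub {G K : Finset (E 3)} (h : ∀ g ∈ G, g ∈ Cn K) : Cn G ⊆ Cn K := by
  rintro x ⟨c, hc, rfl⟩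
  exact Cn_sum _ _ fun g hg => Cn_smul (h g hg) (hc g)

lemma Cn_inner_nonpos {G : Finset (E 3)} {a x : E 3} (h : ∀ g ∈ G, ⟪a, g⟫ ≤ 0) (hx : x ∈ Cn G) :
    ⟪a, x⟫ ≤ 0 := by
  obtain ⟨c, hc, rfl⟩ := hx
  rw [inner_sum]
  refine Finset.sum_nonpos fun g hg => ?_
  rw [real_inner_smul_right]
  exact mul_nonpos_of_nonneg_of_nonpos (hc g) (h g hg)

lemma Cn_inner_pos {G : Finset (E 3)} {t x : E 3} (h : ∀ g ∈ G, 0 < ⟪t, g⟫) (hx : x ∈ Cn G)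
    (h0 : x ≠ 0) : 0 < ⟪t, x⟫ := by
  obtain ⟨c, hc, rfl⟩ := hx
  rw [inner_sum]
  refine Finset.sum_pos' (fun g hg => ?_) ?_
  · rw [real_inner_smul_right]
    exact mul_nonneg (hc g) (h g hg).le
  · by_contra hcon
    push Not at hcon
    apply h0
    refine Finset.sum_eq_zero fun g hg => ?_
    have := hcon g hg
    rw [real_inner_smul_right] at this
    have h1 : c g = 0 := by
      by_contra hne
      have : 0 < c g := lt_of_le_of_ne (hc g) (Ne.symm hne)
      have := mul_pos this (h g hg)
      linarith
    simp [h1]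

/-- bound on finitely many ratios: small parameter -/
lemma exists_small {α : Type*} (G : Finset α) (f g : α → ℝ) (h : ∀ x ∈ G, 0 < f x) :
    ∃ ε : ℝ, 0 < ε ∧ ∀ x ∈ G, ε * g x < f x := by
  have hev : ∀ᶠ ε in nhdsWithin (0:ℝ) (Set.Ioi 0), ∀ x ∈ G, ε * g x < f x := by
    rw [Filter.eventually_all_finset]
    intro x hx
    have : Filter.Tendsto (fun ε : ℝ => ε * g x) (nhdsWithin (0:ℝ) (Set.Ioi 0)) (nhds (0 * g x)) :=
      (Filter.Tendsto.mul_const _ (tendsto_nhdsWithin_of_tendsto_nhds Filter.tendsto_id))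
    rw [zero_mul] at this
    exact this.eventually (gt_mem_nhds (h x hx))
  obtain ⟨ε, h1, h2⟩ := (hev.and self_mem_nhdsWithin).exists
  exact ⟨ε, h2, h1⟩

lemma sep (G : Finset (E 3)) (t : E 3) (ht : ∀ g ∈ G, 0 < ⟪t, g⟫) (s : E 3) (hs : s ∉ Cn G) :
    ∃ A : E 3, (∀ g ∈ G, ⟪A, g⟫ < 0) ∧ 0 < ⟪A, s⟫ := by
  classical
  have hs0 : s ≠ 0 := by rintro rfl; exact hs (Cn_zero G)
  have hss : 0 < ⟪s, s⟫ := real_inner_self_pos.2 hs0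
  rcases lt_trichotomy ⟪t, s⟫ 0 with h | h | h
  · exact ⟨-t, fun g hg => by simpa using ht g hg, by simpa using h⟩
  · obtain ⟨ε, hε, hG⟩ := exists_small G (fun g => ⟪t, g⟫) (fun g => ⟪s, g⟫) ht
    refine ⟨ε • s - t, fun g hg => ?_, ?_⟩
    · have := hG g hg
      rw [inner_sub_left, real_inner_smul_left]; linarith
    · rw [inner_sub_left, real_inner_smul_left, h]; have := mul_pos hε hss; linarith
  · set N : Finset (E 3) := G.image (fun g => (⟪t, g⟫)⁻¹ • g) with hN
    have hnot : (⟪t, s⟫)⁻¹ • s ∉ convexHull ℝ (N : Set (E 3)) := by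
      intro hmem
      rw [Finset.mem_convexHull'] at hmem
      obtain ⟨w, hw, -, hw2⟩ := hmem
      apply hs
      have : s = ⟪t, s⟫ • ∑ y ∈ N, w y • y := by
        rw [hw2, smul_smul, mul_inv_cancel₀ h.ne', one_smul]
      rw [this]
      refine Cn_smul (Cn_sum _ _ fun y hy => Cn_smul ?_ (hw y hy)) h.le
      obtain ⟨g, hg, rfl⟩ := Finset.mem_image.1 hy
      exact Cn_smul (Cn_gen hg) (inv_nonneg.2 (ht g hg).le)
    have hcl : IsClosed (convexHull ℝ (N : Set (E 3))) :=
      (N.finite_toSet.isCompact_convexHull ℝ).isClosed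
    obtain ⟨f, u, hf, hu⟩ := geometric_hahn_banach_closed_point (convex_convexHull ℝ _) hcl hnot
    set a : E 3 := (InnerProductSpace.toDual ℝ (E 3)).symm f with ha
    have haf : ∀ x, ⟪a, x⟫ = f x := fun x => InnerProductSpace.toDual_symm_apply
    refine ⟨a - u • t, fun g hg => ?_, ?_⟩
    · have h1 := hf ((⟪t, g⟫)⁻¹ • g) (subset_convexHull ℝ _ (by
        rw [hN]; exact Finset.mem_coe.2 (Finset.mem_image_of_mem _ hg)))
      rw [map_smul, smul_eq_mul, inv_mul_lt_iff₀ (ht g hg)] at h1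
      rw [inner_sub_left, real_inner_smul_left, haf]; linarith
    · rw [map_smul, smul_eq_mul, lt_inv_mul_iff₀ h] at hu
      rw [inner_sub_left, real_inner_smul_left, haf]; linarith

lemma exists_min (G : Finset (E 3)) : ∃ W ⊆ G, Cn W = Cn G ∧
    ∀ w ∈ W, w ∉ Cn (W.erase w) := by
  classical
  induction hn : G.card using Nat.strong_induction_on generalizing G with
  | _ n ih =>
    by_cases h : ∀ w ∈ G, w ∉ Cn (G.erase w)
    · exact ⟨G, subset_rfl, rfl, h⟩
    · push Not at h
      obtain ⟨w, hw, hwc⟩ := h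
      obtain ⟨W, h1, h2, h3⟩ := ih (G.erase w).card
        (by rw [← hn]; exact Finset.card_erase_lt_of_mem hw) (G.erase w) rfl
      refine ⟨W, h1.trans (Finset.erase_subset _ _), ?_, h3⟩
      rw [h2]
      apply Set.Subset.antisymm
      · exact Cn_sub fun g hg => Cn_gen (Finset.mem_of_mem_erase hg)
      · refine Cn_sub fun g hg => ?_
        by_cases hgw : g = w
        · rw [hgw]; exact hwc
        · exact Cn_gen (Finset.mem_erase.2 ⟨hgw, hg⟩)

lemma matrix_lemma {W J : Type} [Fintype W] [DecidableEq W] [Fintype J]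
    (a : W → W → ℝ) (m : J → W → ℝ) (h1 : ∀ w, a w w = 1)
    (h2 : ∀ w w', w ≠ w' → |a w w'| < 1) (h3 : ∀ j w, |m j w| < 1) :
    ∃ (k : ℕ) (c : W → ℝ), k ≠ 0 ∧ (∀ w, 0 < c w) ∧
      ∀ w, ∑ w', c w' * a w w' ^ (2 * k) + ∑ j, m j w ^ (2 * k) = 1 := by
  have h2k : Filter.Tendsto (fun k : ℕ => 2 * k) Filter.atTop Filter.atTop :=
    Filter.tendsto_id.const_mul_atTop' (by norm_num)
  let M : ℕ → Matrix W W ℝ := fun k => Matrix.of fun w w' => a w w' ^ (2 * k)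
  let r : ℕ → W → ℝ := fun k w => 1 - ∑ j, m j w ^ (2 * k)
  have hM : Filter.Tendsto M Filter.atTop (nhds (1 : Matrix W W ℝ)) := by
    refine tendsto_pi_nhds.2 fun w => tendsto_pi_nhds.2 fun w' => ?_
    by_cases h : w = w'
    · subst h
      simp [M, h1]
    · have := (tendsto_pow_atTop_nhds_zero_of_abs_lt_one (h2 w w' h)).comp h2k
      simpa [M, Matrix.one_apply_ne h, Function.comp_def] using this
  have hr : Filter.Tendsto r Filter.atTop (nhds (fun _ => 1)) := by
    refine tendsto_pi_nhds.2 fun w => ?_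
    have : Filter.Tendsto (fun k : ℕ => 1 - ∑ j, m j w ^ (2 * k)) Filter.atTop
        (nhds (1 - ∑ j : J, (0 : ℝ))) :=
      tendsto_const_nhds.sub (tendsto_finsetSum _ fun j _ =>
        (tendsto_pow_atTop_nhds_zero_of_abs_lt_one (h3 j w)).comp h2k)
    simpa [r] using this
  have hdet : Filter.Tendsto (fun k => (M k).det) Filter.atTop (nhds 1) := by
    have := ((continuous_id.matrix_det).tendsto (1 : Matrix W W ℝ)).comp hM
    simpa [Function.comp_def] using this
  have hadj : Filter.Tendsto (fun k => (M k).adjugate.mulVec (r k)) Filter.atTop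
      (nhds (fun _ => 1)) := by
    have hc : Continuous fun p : Matrix W W ℝ × (W → ℝ) => p.1.adjugate.mulVec p.2 :=
      (continuous_fst.matrix_adjugate).matrix_mulVec continuous_snd
    have := (hc.tendsto ((1 : Matrix W W ℝ), fun _ : W => (1:ℝ))).comp (hM.prodMk_nhds hr)
    simpa [Function.comp_def] using this
  have hc : ∀ w, ∀ᶠ k in Filter.atTop, 0 < (M k).adjugate.mulVec (r k) w := fun w =>
    (tendsto_pi_nhds.1 hadj w).eventually (lt_mem_nhds (by norm_num))
  obtain ⟨k, hk1, hk2, hk3⟩ := ((Filter.eventually_all.2 hc).and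
    ((hdet.eventually (lt_mem_nhds (show (0:ℝ) < 1 by norm_num))).and
      (Filter.eventually_ne_atTop 0))).exists
  refine ⟨k, fun w => ((M k).det)⁻¹ * (M k).adjugate.mulVec (r k) w, hk3,
    fun w => mul_pos (inv_pos.2 hk2) (hk1 w), fun w => ?_⟩
  have key : (M k).mulVec ((M k).adjugate.mulVec (r k)) = (M k).det • r k := by
    rw [Matrix.mulVec_mulVec, Matrix.mul_adjugate, Matrix.smul_mulVec, Matrix.one_mulVec]
  have key2 := congrFun key w
  simp only [Matrix.mulVec, dotProduct, Pi.smul_apply, smul_eq_mul] at key2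
  have : ∑ w', ((M k).det)⁻¹ * (M k).adjugate.mulVec (r k) w' * a w w' ^ (2 * k) = r k w := by
    calc _ = ((M k).det)⁻¹ * ∑ w', M k w w' * (M k).adjugate.mulVec (r k) w' := by
          rw [Finset.mul_sum]
          refine Finset.sum_congr rfl fun w' _ => ?_
          simp only [M, Matrix.of_apply]; ring
      _ = _ := by
          simp only [Matrix.mulVec, dotProduct]
          rw [key2, inv_mul_cancel_left₀ hk2.ne']
  rw [this]
  simp [r]

lemma pow_jensen (k : ℕ) (hk : k ≠ 0) {s r : ℝ} (hs : 0 < s) (hr : 0 < r) (p q : ℝ) :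
    ((p + q) / (s + r)) ^ (2 * k) ≤ s / (s + r) * (p / s) ^ (2 * k) + r / (s + r) * (q / r) ^ (2 * k)
    ∧ (r * p ≠ s * q → ((p + q) / (s + r)) ^ (2 * k) <
      s / (s + r) * (p / s) ^ (2 * k) + r / (s + r) * (q / r) ^ (2 * k)) := by
  have hsc := (even_two_mul k).strictConvexOn_pow (by omega)
  have hsr : 0 < s + r := by positivity
  have e : (p + q) / (s + r) = (s / (s + r)) • (p / s) + (r / (s + r)) • (q / r) := by
    simp only [smul_eq_mul]; field_simp
  have h1 : s / (s + r) + r / (s + r) = 1 := by field_simp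
  rw [e]
  constructor
  · exact hsc.convexOn.2 (Set.mem_univ _) (Set.mem_univ _) (by positivity) (by positivity) h1
  · intro hne
    refine hsc.2 (Set.mem_univ _) (Set.mem_univ _) ?_ (by positivity) (by positivity) h1
    intro h
    apply hne
    rw [div_eq_div_iff hs.ne' hr.ne'] at h
    linarith

lemma strict_lemma {ι : Type} [Fintype ι] (a : ι → E 3) (c : ι → ℝ) (hc : ∀ i, 0 < c i)
    (t : E 3) (k : ℕ) (hk : k ≠ 0)
    (hnd : ∀ z : E 3, z ≠ 0 → ⟪t, z⟫ = 0 → ∃ i, ⟪a i, z⟫ ≠ 0)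
    (x y : E 3) (hx : 0 ≤ ⟪t, x⟫) (hy : 0 ≤ ⟪t, y⟫)
    (hx' : ∑ i, c i * ⟪a i, x⟫ ^ (2 * k) ≤ ⟪t, x⟫ ^ (2 * k))
    (hy' : ∑ i, c i * ⟪a i, y⟫ ^ (2 * k) ≤ ⟪t, y⟫ ^ (2 * k)) :
    ∑ i, c i * ⟪a i, x + y⟫ ^ (2 * k) ≤ ⟪t, x + y⟫ ^ (2 * k) ∧
    (⟪t, y⟫ • x ≠ ⟪t, x⟫ • y →
      ∑ i, c i * ⟪a i, x + y⟫ ^ (2 * k) < ⟪t, x + y⟫ ^ (2 * k)) := by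
  have h2k : 2 * k ≠ 0 := by omega
  have hz : ∀ z : E 3, ⟪t, z⟫ = 0 → ∑ i, c i * ⟪a i, z⟫ ^ (2 * k) ≤ ⟪t, z⟫ ^ (2 * k) → z = 0 := by
    intro z h1 h2
    by_contra h0
    obtain ⟨i, hi⟩ := hnd z h0 h1
    rw [h1, zero_pow h2k] at h2
    have : 0 < ∑ i, c i * ⟪a i, z⟫ ^ (2 * k) := by
      refine Finset.sum_pos' (fun j _ => mul_nonneg (hc j).le ((even_two_mul k).pow_nonneg _))
        ⟨i, Finset.mem_univ _, mul_pos (hc i) ((even_two_mul k).pow_pos hi)⟩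
    linarith
  rcases hx.eq_or_lt with h | hs
  · obtain rfl := hz x h.symm hx'
    simpa using hy'
  rcases hy.eq_or_lt with h | hr
  · obtain rfl := hz y h.symm hy'
    simpa using hx'
  set s := ⟪t, x⟫
  set r := ⟪t, y⟫
  have hsr : 0 < s + r := by positivity
  have hpow : 0 < (s + r) ^ (2 * k) := by positivity
  have hxs : ∑ i, c i * (⟪a i, x⟫ / s) ^ (2 * k) ≤ 1 := by
    have : ∑ i, c i * (⟪a i, x⟫ / s) ^ (2 * k) = (∑ i, c i * ⟪a i, x⟫ ^ (2 * k)) / s ^ (2 * k) := by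
      rw [Finset.sum_div]; exact Finset.sum_congr rfl fun i _ => by rw [div_pow, mul_div_assoc]
    rw [this, div_le_one (by positivity)]; exact hx'
  have hyr : ∑ i, c i * (⟪a i, y⟫ / r) ^ (2 * k) ≤ 1 := by
    have : ∑ i, c i * (⟪a i, y⟫ / r) ^ (2 * k) = (∑ i, c i * ⟪a i, y⟫ ^ (2 * k)) / r ^ (2 * k) := by
      rw [Finset.sum_div]; exact Finset.sum_congr rfl fun i _ => by rw [div_pow, mul_div_assoc]
    rw [this, div_le_one (by positivity)]; exact hy'
  have hlhs : ∑ i, c i * ⟪a i, x + y⟫ ^ (2 * k) =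
      (s + r) ^ (2 * k) * ∑ i, c i * ((⟪a i, x⟫ + ⟪a i, y⟫) / (s + r)) ^ (2 * k) := by
    rw [Finset.mul_sum]
    refine Finset.sum_congr rfl fun i _ => ?_
    rw [inner_add_right, div_pow]; field_simp
  have hrhs : ∑ i, c i * (s / (s + r) * (⟪a i, x⟫ / s) ^ (2 * k)
      + r / (s + r) * (⟪a i, y⟫ / r) ^ (2 * k)) ≤ 1 := by
    calc _ = s / (s + r) * ∑ i, c i * (⟪a i, x⟫ / s) ^ (2 * k)
        + r / (s + r) * ∑ i, c i * (⟪a i, y⟫ / r) ^ (2 * k) := by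
          rw [Finset.mul_sum, Finset.mul_sum, ← Finset.sum_add_distrib]
          exact Finset.sum_congr rfl fun i _ => by ring
      _ ≤ s / (s + r) * 1 + r / (s + r) * 1 := by gcongr
      _ = 1 := by field_simp
  rw [inner_add_right, hlhs]
  constructor
  · have := (Finset.sum_le_sum fun i (_ : i ∈ Finset.univ) => mul_le_mul_of_nonneg_left
      (pow_jensen k hk hs hr ⟪a i, x⟫ ⟪a i, y⟫).1 (hc i).le).trans hrhs
    exact mul_le_of_le_one_right hpow.le this
  · intro hne
    obtain ⟨i, hi⟩ := hnd (r • x - s • y) (sub_ne_zero.2 hne) (by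
      rw [inner_sub_right, real_inner_smul_right, real_inner_smul_right]; simp only [s, r]; ring)
    have hi' : r * ⟪a i, x⟫ ≠ s * ⟪a i, y⟫ := by
      rw [inner_sub_right, real_inner_smul_right, real_inner_smul_right] at hi
      exact sub_ne_zero.1 hi
    have := (Finset.sum_lt_sum (fun i (_ : i ∈ Finset.univ) => mul_le_mul_of_nonneg_left
      (pow_jensen k hk hs hr ⟪a i, x⟫ ⟪a i, y⟫).1 (hc i).le) ⟨i, Finset.mem_univ _,
        mul_lt_mul_of_pos_left ((pow_jensen k hk hs hr ⟪a i, x⟫ ⟪a i, y⟫).2 hi') (hc i)⟩).trans_le hrhs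
    exact mul_lt_of_lt_one_right hpow this

lemma exists_form (G : Finset (E 3)) (t B : E 3) (ht : ∀ g ∈ G, 0 < ⟪t, g⟫)
    (hB : ∀ g ∈ G, ⟪B, g⟫ < 0) :
    ∃ σ : ℝ, 0 < σ ∧ ∀ g ∈ G, |⟪t + σ • B, g⟫| < ⟪t, g⟫ := by
  obtain ⟨σ, hσ, h⟩ := exists_small G (fun g => ⟪t, g⟫) (fun g => -⟪B, g⟫) ht
  refine ⟨σ, hσ, fun g hg => ?_⟩
  rw [inner_add_left, real_inner_smul_left, abs_lt]
  have h1 := h g hg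
  have h2 := mul_neg_of_pos_of_neg hσ (hB g hg)
  have h3 := ht g hg
  constructor <;> linarith

lemma exists_M (G : Finset (E 3)) (t : E 3) (ht : ∀ g ∈ G, 0 < ⟪t, g⟫) (p : E 3)
    (h1 : p ∉ Cn G) (h2 : -p ∉ Cn G) :
    ∃ M : E 3, |⟪t, p⟫| < |⟪M, p⟫| ∧ ∀ g ∈ G, |⟪M, g⟫| < ⟪t, g⟫ := by
  have key : ∀ p : E 3, p ∉ Cn G → 0 ≤ ⟪t, p⟫ →
      ∃ M : E 3, |⟪t, p⟫| < |⟪M, p⟫| ∧ ∀ g ∈ G, |⟪M, g⟫| < ⟪t, g⟫ := by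
    intro p hp h0
    obtain ⟨A, hA, hAp⟩ := sep G t ht p hp
    obtain ⟨σ, hσ, h⟩ := exists_form G t A ht hA
    refine ⟨t + σ • A, ?_, h⟩
    rw [inner_add_left, real_inner_smul_left, abs_of_nonneg h0]
    have := mul_pos hσ hAp
    exact lt_of_lt_of_le (by linarith) (le_abs_self _)
  rcases le_total 0 ⟪t, p⟫ with h | h
  · exact key p h1 h
  · obtain ⟨M, hM, h3⟩ := key (-p) h2 (by rw [inner_neg_right]; linarith)
    refine ⟨M, ?_, h3⟩
    simpa using hM

lemma core (G : Finset (E 3)) (t : E 3) (ht : ∀ g ∈ G, 0 < ⟪t, g⟫) (U : Set (E 3))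
    (hU : IsOpen U) (hUpos : ∀ x ∈ U, 0 < ⟪t, x⟫) (hUsc : ∀ x ∈ U, ∀ r : ℝ, 0 < r → r • x ∈ U)
    (hSU : ∀ x ∈ Cn G, x ≠ 0 → x ∈ U) :
    ∃ W ⊆ G, Cn W = Cn G ∧ ∃ (ι : Type) (_ : Fintype ι) (a : ι → E 3) (c : ι → ℝ) (k : ℕ),
      k ≠ 0 ∧ (∀ i, 0 < c i) ∧
      (∀ w ∈ W, ∑ i, c i * ⟪a i, w⟫ ^ (2 * k) = ⟪t, w⟫ ^ (2 * k)) ∧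
      (∀ x, ∑ i, c i * ⟪a i, x⟫ ^ (2 * k) ≤ ⟪t, x⟫ ^ (2 * k) → x = 0 ∨ x ∈ U ∨ -x ∈ U) ∧
      (∀ z : E 3, z ≠ 0 → ⟪t, z⟫ = 0 → ∃ i, ⟪a i, z⟫ ≠ 0) := by
  classical
  obtain ⟨W, hWG, hWC, hW⟩ := exists_min G
  refine ⟨W, hWG, hWC, ?_⟩
  -- the forms L
  have hL : ∀ w : W, ∃ L : E 3, ⟪L, (w : E 3)⟫ = ⟪t, (w : E 3)⟫ ∧
      ∀ g ∈ W.erase w, |⟪L, g⟫| < ⟪t, g⟫ := by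
    rintro ⟨w, hw⟩
    have ht' : ∀ g ∈ W.erase w, 0 < ⟪t, g⟫ := fun g hg => ht g (hWG (Finset.mem_of_mem_erase hg))
    obtain ⟨A, hA, hAw⟩ := sep (W.erase w) t ht' w (hW w hw)
    have htw := ht w (hWG hw)
    obtain ⟨σ, hσ, h⟩ := exists_form (W.erase w) t (A - (⟪A, w⟫ / ⟪t, w⟫) • t) ht' (by
      intro g hg
      rw [inner_sub_left, real_inner_smul_left]
      have := hA g hg
      have : 0 < ⟪A, w⟫ / ⟪t, w⟫ * ⟪t, g⟫ := mul_pos (div_pos hAw htw) (ht' g hg)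
      linarith)
    refine ⟨_, ?_, h⟩
    rw [inner_add_left, real_inner_smul_left, inner_sub_left, real_inner_smul_left,
      div_mul_cancel₀ _ htw.ne']
    simp
  choose L hLw hLg using hL
  -- the forms M
  set C : Set (E 3) := sphere 0 1 ∩ (Uᶜ ∩ (fun x => -x) ⁻¹' Uᶜ) with hC
  have hCc : IsCompact C :=
    (isCompact_sphere _ _).inter_right (hU.isClosed_compl.inter
      (hU.isClosed_compl.preimage continuous_neg))
  have hM : ∀ p : E 3, ∃ M : E 3, (p ∈ C → |⟪t, p⟫| < |⟪M, p⟫|) ∧ ∀ g ∈ G, |⟪M, g⟫| < ⟪t, g⟫ := by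
    intro p
    by_cases hp : p ∈ C
    · have hp0 : p ≠ 0 := by
        rintro rfl
        have := hp.1
        simp at this
      obtain ⟨M, h1, h2⟩ := exists_M G t ht p (fun h => hp.2.1 (hSU p h hp0))
        (fun h => hp.2.2 (hSU _ h (neg_ne_zero.2 hp0)))
      exact ⟨M, fun _ => h1, h2⟩
    · exact ⟨0, fun h => absurd h hp, fun g hg => by simpa using ht g hg⟩
  choose M hMp hMg using hM
  obtain ⟨J, hJC, hJ⟩ := hCc.elim_nhds_subcover (fun p => {x | |⟪t, x⟫| < |⟪M p, x⟫|}) (by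
    intro p hp
    refine (isOpen_lt ?_ ?_).mem_nhds (hMp p hp) <;> fun_prop)
  have hJ' : ∀ x : E 3, x ≠ 0 → x ∉ U → -x ∉ U → ∃ j ∈ J, |⟪t, x⟫| < |⟪M j, x⟫| := by
    intro x hx h1 h2
    have hn : 0 < ‖x‖ := norm_pos_iff.2 hx
    have hxC : ‖x‖⁻¹ • x ∈ C := by
      refine ⟨by simp [norm_smul, hn.ne'], fun h => h1 ?_, fun h => h2 ?_⟩
      · have := hUsc _ h _ hn
        rwa [smul_smul, mul_inv_cancel₀ hn.ne', one_smul] at this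
      · have := hUsc _ h _ hn
        rwa [smul_neg, smul_smul, mul_inv_cancel₀ hn.ne', one_smul] at this
    have := hJ hxC
    simp only [Set.mem_iUnion, Set.mem_ofPred_eq, real_inner_smul_right, abs_mul] at this
    obtain ⟨j, hj, h⟩ := this
    exact ⟨j, hj, lt_of_mul_lt_mul_left h (abs_nonneg _)⟩
  have htW : ∀ w : W, 0 < ⟪t, (w : E 3)⟫ := fun w => ht _ (hWG w.2)
  obtain ⟨k, c, hk, hc, hck⟩ := matrix_lemma (W := W) (J := J)
    (fun w w' => ⟪L w', (w : E 3)⟫ / ⟪t, (w : E 3)⟫) (fun j w => ⟪M j, (w : E 3)⟫ / ⟪t, (w : E 3)⟫)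
    (fun w => by rw [hLw, div_self (htW w).ne'])
    (fun w w' h => by
      rw [abs_div, abs_of_pos (htW w), div_lt_one (htW w)]
      exact hLg w' w (Finset.mem_erase.2 ⟨fun h' => h (Subtype.ext h'), w.2⟩))
    (fun j w => by
      rw [abs_div, abs_of_pos (htW w), div_lt_one (htW w)]
      exact hMg j w (hWG w.2))
  have h2k : 2 * k ≠ 0 := by omega
  refine ⟨W ⊕ J, inferInstance, Sum.elim L (fun j => M j), Sum.elim c (fun _ => 1), k, hk, ?_, ?_,
    ?_, ?_⟩
  · rintro (i | i)
    · exact hc i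
    · simp
  · intro w hw
    have h := hck ⟨w, hw⟩
    have hp : 0 < ⟪t, w⟫ ^ (2 * k) := pow_pos (htW ⟨w, hw⟩) _
    simp only [div_pow] at h
    simp only [Fintype.sum_sum_type, Sum.elim_inl, Sum.elim_inr, one_mul]
    rw [← mul_right_inj' hp.ne', mul_one, mul_add, Finset.mul_sum, Finset.mul_sum] at h
    rw [← h]
    congr 1
    · refine Finset.sum_congr rfl fun i _ => ?_
      field_simp
    · refine Finset.sum_congr rfl fun i _ => ?_
      field_simp
  · intro x hx
    by_contra hcon
    push Not at hcon
    obtain ⟨j, hj, hlt⟩ := hJ' x hcon.1 hcon.2.1 hcon.2.2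
    have h1 : ⟪t, x⟫ ^ (2 * k) < ⟪M j, x⟫ ^ (2 * k) := by
      rw [← (even_two_mul k).pow_abs, ← (even_two_mul k).pow_abs ⟪M j, x⟫]
      exact pow_lt_pow_left₀ hlt (abs_nonneg _) h2k
    have h2 : ⟪M j, x⟫ ^ (2 * k) ≤ ∑ i : W ⊕ J, (Sum.elim c (fun _ => 1) i : ℝ) *
        ⟪(Sum.elim L (fun j : J => M j) i : E 3), x⟫ ^ (2 * k) := by
      have := Finset.single_le_sum (s := Finset.univ) (f := fun i : W ⊕ J =>
        (Sum.elim c (fun _ => 1) i : ℝ) * ⟪(Sum.elim L (fun j : J => M j) i : E 3), x⟫ ^ (2 * k))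
        (fun i _ => mul_nonneg (by
          rcases i with i | i
          · exact (hc i).le
          · simp) ((even_two_mul k).pow_nonneg _)) (Finset.mem_univ (Sum.inr ⟨j, hj⟩))
      simpa using this
    linarith
  · intro z hz hz0
    obtain ⟨j, hj, hlt⟩ := hJ' z hz (fun h => by have := hUpos z h; linarith)
      (fun h => by have := hUpos _ h; rw [inner_neg_right] at this; linarith)
    refine ⟨Sum.inr ⟨j, hj⟩, fun h => ?_⟩
    simp only [Sum.elim_inr] at h
    rw [h, abs_zero] at hlt
    exact absurd hlt (abs_nonneg _).not_gt

open MvPolynomial in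
lemma totalDegree_shift_le (d : Fin 3 → ℝ) (p : MvPolynomial (Fin 3) ℝ) :
    (bind₁ (fun i => X i + C (d i)) p).totalDegree ≤ p.totalDegree := by
  conv_lhs => rw [p.as_sum, map_sum]
  refine totalDegree_finsetSum_le fun m hm => ?_
  rw [bind₁_monomial]
  refine (totalDegree_mul _ _).trans ?_
  rw [totalDegree_C, zero_add]
  refine le_trans ?_ (le_totalDegree hm)
  refine (totalDegree_finsetProd _ _).trans ?_
  refine Finset.sum_le_sum fun i _ => ?_
  refine (totalDegree_pow _ _).trans ?_
  have : (X i + C (d i) : MvPolynomial (Fin 3) ℝ).totalDegree ≤ 1 := by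
    refine (totalDegree_add _ _).trans ?_
    simp [totalDegree_X]
  calc m i * _ ≤ m i * 1 := Nat.mul_le_mul_left _ this
    _ = _ := mul_one _

open MvPolynomial in
lemma totalDegree_shift (d : Fin 3 → ℝ) (p : MvPolynomial (Fin 3) ℝ) :
    (bind₁ (fun i => X i + C (d i)) p).totalDegree = p.totalDegree := by
  refine le_antisymm (totalDegree_shift_le d p) ?_
  have h := totalDegree_shift_le (-d) (bind₁ (fun i => X i + C (d i)) p)
  rw [bind₁_bind₁] at h
  simpa using h

open MvPolynomial in
def linPoly (a : E 3) : MvPolynomial (Fin 3) ℝ := ∑ i, C (a i) * X i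

open MvPolynomial in
lemma linPoly_hom (a : E 3) : (linPoly a).IsHomogeneous 1 :=
  IsHomogeneous.sum _ _ _ fun i _ => by
    simpa using (isHomogeneous_C (Fin 3) (a i)).mul (isHomogeneous_X ℝ i)

lemma linPoly_eval (a x : E 3) : evalPoly (linPoly a) x = ⟪a, x⟫ := by
  simp [evalPoly, linPoly, PiLp.inner_apply, mul_comm]

open MvPolynomial in
lemma poly_exists {ι : Type} [Fintype ι] (a : ι → E 3) (c : ι → ℝ) (t v : E 3) (k : ℕ) :
    ∃ b : MvPolynomial (Fin 3) ℝ, Even b.totalDegree ∧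
      (∃ (n : ℕ) (q : MvPolynomial (Fin 3) ℝ), q.IsHomogeneous n ∧
          ∀ x : E 3, evalPoly q x = evalPoly b (x + v)) ∧
      ∀ x : E 3, evalPoly b x = ⟪t, x - v⟫ ^ (2 * k) - ∑ i, c i * ⟪a i, x - v⟫ ^ (2 * k) := by
  set q : MvPolynomial (Fin 3) ℝ := linPoly t ^ (2 * k) - ∑ i, C (c i) * linPoly (a i) ^ (2 * k)
    with hq
  have hhom : q.IsHomogeneous (2 * k) := by
    refine IsHomogeneous.sub ?_ (IsHomogeneous.sum _ _ _ fun i _ => ?_)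
    · simpa using (linPoly_hom t).pow (2 * k)
    · simpa using (isHomogeneous_C (Fin 3) (c i)).mul ((linPoly_hom (a i)).pow (2 * k))
  have hqe : ∀ x, evalPoly q x = ⟪t, x⟫ ^ (2 * k) - ∑ i, c i * ⟪a i, x⟫ ^ (2 * k) := by
    intro x
    simp only [← linPoly_eval]
    simp [hq, evalPoly]
  have hb : ∀ x, evalPoly (bind₁ (fun i => X i + C (-(v i))) q) x = evalPoly q (x - v) := by
    intro x
    simp only [evalPoly]
    rw [← MvPolynomial.aeval_eq_eval, ← MvPolynomial.aeval_eq_eval, aeval_bind₁]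
    congr 1
    simp [sub_eq_add_neg]
  refine ⟨bind₁ (fun i => X i + C (-(v i))) q, ?_, ⟨2 * k, q, hhom, fun x => ?_⟩, fun x => ?_⟩
  · rw [totalDegree_shift (fun i => -(v i)) q]
    by_cases h0 : q = 0
    · simp [h0]
    · rw [hhom.totalDegree h0]; exact even_two_mul k
  · rw [hb, add_sub_cancel_right]
  · rw [hb, hqe]

lemma dir_top {P : Set (E 3)} (hdim : dimS P = 3) : (affineSpan ℝ P).direction = ⊤ :=
  Submodule.eq_top_of_finrank_eq (by simpa [dimS] using hdim)

lemma polytope_compact {P : Set (E 3)} (hP : IsPolytope P) : IsCompact P := by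
  obtain ⟨V, -, rfl⟩ := hP
  exact V.finite_toSet.isCompact_convexHull ℝ

/-- representing vector -/
lemma exposed_vec {P F : Set (E 3)} (h : IsExposed ℝ P F) {v : E 3} (hv : v ∈ F) :
    ∃ a : E 3, (∀ p ∈ P, ⟪a, p - v⟫ ≤ 0) ∧ F = {p | p ∈ P ∧ ⟪a, p - v⟫ = 0} := by
  obtain ⟨l, hl⟩ := h ⟨v, hv⟩
  set a : E 3 := (InnerProductSpace.toDual ℝ (E 3)).symm l with ha
  have haf : ∀ x, ⟪a, x⟫ = l x := fun x => InnerProductSpace.toDual_symm_apply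
  have hv' : v ∈ {x ∈ P | ∀ y ∈ P, l y ≤ l x} := hl ▸ hv
  have h1 : ∀ p ∈ P, ⟪a, p - v⟫ ≤ 0 := fun p hp => by
    rw [inner_sub_right, haf, haf]; linarith [hv'.2 p hp]
  refine ⟨a, h1, ?_⟩
  rw [hl]
  ext p
  constructor
  · rintro ⟨hp, h⟩
    refine ⟨hp, le_antisymm (h1 p hp) ?_⟩
    rw [inner_sub_right, haf, haf]; linarith [h v hv'.1]
  · rintro ⟨hp, h⟩
    refine ⟨hp, fun y hy => ?_⟩
    rw [inner_sub_right, haf, haf] at h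
    linarith [hv'.2 y hy]

lemma vertex_vec {P : Set (E 3)} {v : E 3} (hv : IsVertexOf P v) :
    v ∈ P ∧ ∃ t : E 3, ∀ p ∈ P, p ≠ v → 0 < ⟪t, p - v⟫ := by
  obtain ⟨a, h1, h2⟩ := exposed_vec hv (Set.mem_singleton v)
  have hvP : v ∈ P := by
    have : v ∈ ({v} : Set (E 3)) := rfl
    rw [h2] at this
    exact this.1
  refine ⟨hvP, -a, fun p hp hne => ?_⟩
  rw [inner_neg_left]
  rcases (h1 p hp).eq_or_lt with h | h
  · exfalso
    apply hne
    have : p ∈ ({v} : Set (E 3)) := by rw [h2]; exact ⟨hp, h⟩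
    exact this
  · linarith

lemma facet_normal {P F : Set (E 3)} (hP : IsPolytope P) (hdim : dimS P = 3)
    (hF : IsFacetOf P F) {v : E 3} (hv : v ∈ F) :
    ‖outerNormal P F‖ = 1 ∧ suppF P (outerNormal P F) = ⟪outerNormal P F, v⟫ ∧
    (∀ p ∈ P, ⟪outerNormal P F, p - v⟫ ≤ 0) ∧
    F = {p | p ∈ P ∧ ⟪outerNormal P F, p - v⟫ = 0} := by
  have hvP : v ∈ P := hF.1.subset hv
  obtain ⟨a, h1, h2⟩ := exposed_vec hF.1 hv
  have ha : a ≠ 0 := by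
    rintro rfl
    have hFP : F = P := by rw [h2]; simp
    have := hF.2
    rw [hFP] at this
    omega
  have hn : 0 < ‖a‖ := norm_pos_iff.2 ha
  have hbdd : ∀ u : E 3, BddAbove ((fun x => ⟪u, x⟫) '' P) := fun u =>
    ((polytope_compact hP).image (by fun_prop)).bddAbove
  have hex : ∃ u : E 3, u ∈ (affineSpan ℝ P).direction ∧ ‖u‖ = 1 ∧ exposedSet P u = F := by
    refine ⟨‖a‖⁻¹ • a, by rw [dir_top hdim]; trivial, by simp [norm_smul, hn.ne'], ?_⟩
    have hs : suppF P (‖a‖⁻¹ • a) = ⟪‖a‖⁻¹ • a, v⟫ := by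
      refine IsGreatest.csSup_eq ⟨⟨v, hvP, rfl⟩, ?_⟩
      rintro _ ⟨p, hp, rfl⟩
      have := h1 p hp
      rw [inner_sub_right] at this
      simp only [real_inner_smul_left]
      gcongr
      linarith
    rw [exposedSet, hs]
    conv_rhs => rw [h2]
    ext p
    simp only [real_inner_smul_left, inner_sub_right, Set.mem_ofPred_eq]
    refine and_congr_right fun _ => ?_
    rw [mul_right_inj' (inv_ne_zero hn.ne'), sub_eq_zero]
  obtain ⟨-, hu1, hu2⟩ := Classical.epsilon_spec hex
  change ‖outerNormal P F‖ = 1 at hu1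
  change exposedSet P (outerNormal P F) = F at hu2
  set u := outerNormal P F
  have hsup : suppF P u = ⟪u, v⟫ := by
    have : v ∈ exposedSet P u := by rw [hu2]; exact hv
    exact this.2.symm
  refine ⟨hu1, hsup, fun p hp => ?_, ?_⟩
  · rw [inner_sub_right, ← hsup]
    have := le_csSup (hbdd u) ⟨p, hp, rfl⟩
    simp only [suppF]
    linarith
  · conv_lhs => rw [← hu2]
    ext p
    simp only [exposedSet, Set.mem_ofPred_eq, inner_sub_right, hsup, sub_eq_zero]

/-- edge generators -/
def gens (V : Finset (E 3)) (v : E 3) : Finset (E 3) := by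
  classical exact (V.image (fun p => p - v)).erase 0

lemma mem_gens {V : Finset (E 3)} {v g : E 3} : g ∈ gens V v ↔ g ≠ 0 ∧ ∃ p ∈ V, p - v = g := by
  simp [gens]

lemma sub_mem_Cn {V : Finset (E 3)} {v p : E 3} (hp : p ∈ convexHull ℝ (V : Set (E 3))) :
    p - v ∈ Cn (gens V v) := by
  rw [Finset.mem_convexHull'] at hp
  obtain ⟨w, hw, hw1, rfl⟩ := hp
  have : ∑ y ∈ V, w y • y - v = ∑ y ∈ V, w y • (y - v) := by
    simp only [smul_sub, Finset.sum_sub_distrib, ← Finset.sum_smul, hw1, one_smul]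
  rw [this]
  refine Cn_sum _ _ fun y hy => Cn_smul ?_ (hw y hy)
  by_cases h : y - v = 0
  · rw [h]; exact Cn_zero _
  · exact Cn_gen (mem_gens.2 ⟨h, y, hy, rfl⟩)

lemma coneHull_gen {A : Set (E 3)} {x : E 3} (hx : x ∈ A) {r : ℝ} (hr : 0 ≤ r) :
    r • x ∈ coneHull A :=
  ⟨1, fun _ => r, fun _ => x, fun _ => hr, fun _ => hx, by simp⟩

lemma coneHull_smul {A : Set (E 3)} {x : E 3} (hx : x ∈ coneHull A) {r : ℝ} (hr : 0 ≤ r) :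
    r • x ∈ coneHull A := by
  obtain ⟨n, c, p, hc, hp, rfl⟩ := hx
  exact ⟨n, fun i => r * c i, p, fun i => mul_nonneg hr (hc i), hp,
    by simp [Finset.smul_sum, mul_smul]⟩

lemma suppCone_eq {V : Finset (E 3)} {v : E 3} (P : Set (E 3))
    (hPV : P = convexHull ℝ (V : Set (E 3))) : suppCone P v = Cn (gens V v) := by
  apply Set.Subset.antisymm
  · rintro x ⟨n, c, p, hc, hp, rfl⟩
    refine Cn_sum _ _ fun i _ => Cn_smul ?_ (hc i)
    obtain ⟨y, hy, h⟩ := hp i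
    rw [← h]
    exact sub_mem_Cn (hPV ▸ hy)
  · rintro x ⟨c, hc, rfl⟩
    set G := gens V v with hG
    refine ⟨G.card, fun i => c (G.equivFin.symm i), fun i => G.equivFin.symm i, fun i => hc _,
      fun i => ?_, ?_⟩
    · obtain ⟨-, p, hp, h⟩ := mem_gens.1 (G.equivFin.symm i).2
      exact ⟨p, hPV ▸ subset_convexHull ℝ _ hp, h⟩
    · rw [← Finset.sum_coe_sort]
      exact (Equiv.sum_comp G.equivFin.symm (fun g : G => c g • (g : E 3))).symm

lemma gens_nondeg {V : Finset (E 3)} {v : E 3} {P : Set (E 3)}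
    (hPV : P = convexHull ℝ (V : Set (E 3))) (hdim : dimS P = 3) (d : E 3)
    (hd : ∀ g ∈ gens V v, ⟪d, g⟫ = 0) : d = 0 := by
  have h1 : ∀ p ∈ P, ⟪d, p - v⟫ = 0 := by
    intro p hp
    have hp' := sub_mem_Cn (v := v) (hPV ▸ hp)
    have h2 := Cn_inner_nonpos (a := d) (fun g hg => (hd g hg).le) hp'
    have h3 := Cn_inner_nonpos (a := -d) (fun g hg => by rw [inner_neg_left, hd g hg, neg_zero]) hp'
    rw [inner_neg_left] at h3
    linarith
  have h2 : (affineSpan ℝ P).direction ≤ (ℝ ∙ d)ᗮ := by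
    rw [direction_affineSpan, vectorSpan_def, Submodule.span_le]
    rintro _ ⟨p, hp, q, hq, rfl⟩
    rw [SetLike.mem_coe, Submodule.mem_orthogonal_singleton_iff_inner_right]
    have : p -ᵥ q = (p - v) - (q - v) := by simp
    simp only [this]
    rw [inner_sub_right, h1 p hp, h1 q hq, sub_zero]
  rw [dir_top hdim] at h2
  have := h2 (Submodule.mem_top : d ∈ ⊤)
  rw [Submodule.mem_orthogonal_singleton_iff_inner_right] at this
  exact inner_self_eq_zero.1 this

lemma facets_finite {V : Finset (E 3)} {v : E 3} {P : Set (E 3)} (hP : IsPolytope P)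
    (hPV : P = convexHull ℝ (V : Set (E 3))) (hdim : dimS P = 3) :
    (facetsCont P {v}).Finite := by
  have key : ∀ F ∈ facetsCont P {v}, ∀ F' ∈ facetsCont P {v},
      (V : Set (E 3)) ∩ F = (V : Set (E 3)) ∩ F' → F ⊆ F' := by
    rintro F ⟨hF, hvF⟩ F' ⟨hF', hvF'⟩ h p hp
    obtain ⟨-, -, h1, h2⟩ := facet_normal hP hdim hF (hvF rfl)
    obtain ⟨-, -, h1', h2'⟩ := facet_normal hP hdim hF' (hvF' rfl)
    set u := outerNormal P F
    set u' := outerNormal P F'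
    have hpP := hF.1.subset hp
    rw [h2']
    refine ⟨hpP, ?_⟩
    rw [h2] at hp
    have hpP' := hpP
    rw [hPV, Finset.mem_convexHull'] at hpP'
    obtain ⟨w, hw, hw1, hwp⟩ := hpP'
    have e : p - v = ∑ y ∈ V, w y • (y - v) := by
      rw [← hwp]
      simp only [smul_sub, Finset.sum_sub_distrib, ← Finset.sum_smul, hw1, one_smul]
    have hVP : ∀ y ∈ V, y ∈ P := fun y hy => hPV ▸ subset_convexHull ℝ _ hy
    have h0 := hp.2
    rw [e, inner_sum] at h0
    simp only [real_inner_smul_right] at h0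
    rw [Finset.sum_eq_zero_iff_of_nonpos (fun y hy =>
      mul_nonpos_of_nonneg_of_nonpos (hw y hy) (h1 y (hVP y hy)))] at h0
    rw [e, inner_sum]
    refine Finset.sum_eq_zero fun y hy => ?_
    rw [real_inner_smul_right]
    rcases mul_eq_zero.1 (h0 y hy) with h3 | h3
    · rw [h3, zero_mul]
    · have : y ∈ (V : Set (E 3)) ∩ F := ⟨hy, by rw [h2]; exact ⟨hVP y hy, h3⟩⟩
      rw [h] at this
      have := this.2
      rw [h2'] at this
      rw [this.2, mul_zero]
  refine Set.Finite.of_finite_image (f := fun F => (V : Set (E 3)) ∩ F) ?_ ?_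
  · refine (V.finite_toSet.finite_subsets).subset ?_
    rintro _ ⟨F, -, rfl⟩
    exact Set.inter_subset_left
  · intro F hF F' hF' h
    exact (key F hF F' hF' h).antisymm (key F' hF' F hF h.symm)

lemma extreme_dual (G : Finset (E 3)) (hnd : ∀ d : E 3, (∀ g ∈ G, ⟪d, g⟫ = 0) → d = 0)
    (s A : E 3) (hA : ∀ g ∈ G, ⟪A, g⟫ < 0) (hAs : 0 < ⟪A, s⟫) :
    ∃ a : E 3, (∀ g ∈ G, ⟪a, g⟫ ≤ 0) ∧ (∃ g ∈ G, ⟪a, g⟫ < 0) ∧ 0 < ⟪a, s⟫ ∧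
      2 ≤ Module.finrank ℝ (Submodule.span ℝ {g : E 3 | g ∈ G ∧ ⟪a, g⟫ = 0}) := by
  classical
  have hA0 : A ≠ 0 := by rintro rfl; simp at hAs
  have hGne : G.Nonempty := by
    by_contra h
    rw [Finset.not_nonempty_iff_eq_empty] at h
    exact hA0 (hnd A (by simp [h]))
  set c : E 3 := ∑ g ∈ G, g with hc
  set K : Set (E 3) := {a | (∀ g ∈ G, ⟪a, g⟫ ≤ 0) ∧ ⟪a, c⟫ = -1} with hK
  have hcs : ∀ a : E 3, ⟪a, c⟫ = ∑ g ∈ G, ⟪a, g⟫ := fun a => by rw [hc, inner_sum]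
  -- compactness
  have hKcl : IsClosed K := by
    have e : K = (⋂ g ∈ G, {a : E 3 | ⟪a, g⟫ ≤ 0}) ∩ {a : E 3 | ⟪a, c⟫ = -1} := by
      ext a; simp [hK]
    rw [e]
    refine IsClosed.inter (isClosed_biInter fun g _ => isClosed_le (by fun_prop) (by fun_prop))
      (isClosed_eq (by fun_prop) (by fun_prop))
  let f : E 3 →ₗ[ℝ] (G → ℝ) := LinearMap.pi fun g => innerₗ (E 3) (g : E 3)
  have hf : ∀ a (g : G), f a g = ⟪a, (g : E 3)⟫ := fun a g => by
    simp [f, real_inner_comm]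
  have hfinj : LinearMap.ker f = ⊥ := by
    rw [LinearMap.ker_eq_bot']
    intro a ha
    refine hnd a fun g hg => ?_
    have := congrFun ha ⟨g, hg⟩
    rw [hf] at this
    simpa using this
  have hKc : IsCompact K := by
    have h1 : IsCompact (f ⁻¹' (Set.pi Set.univ fun _ : G => Set.Icc (-1 : ℝ) 0)) :=
      (LinearMap.isClosedEmbedding_of_injective hfinj).isCompact_preimage
        (isCompact_univ_pi fun _ => isCompact_Icc)
    refine h1.of_isClosed_subset hKcl ?_
    rintro a ⟨ha1, ha2⟩ g -
    rw [hf]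
    refine ⟨?_, ha1 g g.2⟩
    rw [hcs] at ha2
    have := Finset.single_le_sum (s := G) (f := fun g => -⟪a, g⟫)
      (fun g hg => by simpa using ha1 g hg) g.2
    rw [Finset.sum_neg_distrib, ha2] at this
    linarith
  -- nonempty
  have hAc : ⟪A, c⟫ < 0 := by rw [hcs]; exact Finset.sum_neg hA hGne
  set A' : E 3 := (-⟪A, c⟫)⁻¹ • A with hA'
  have hpos : 0 < (-⟪A, c⟫)⁻¹ := inv_pos.2 (by linarith)
  have hA'K : A' ∈ K := by
    refine ⟨fun g hg => ?_, ?_⟩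
    · rw [hA', real_inner_smul_left]
      exact mul_nonpos_of_nonneg_of_nonpos hpos.le (hA g hg).le
    · rw [hA', real_inner_smul_left, inv_neg, neg_mul, inv_mul_cancel₀ hAc.ne]
  have hA's : 0 < ⟪A', s⟫ := by
    rw [hA', real_inner_smul_left]; exact mul_pos hpos hAs
  let l : StrongDual ℝ (E 3) := innerSL ℝ s
  have hl : ∀ a, l a = ⟪a, s⟫ := fun a => by simp [l, real_inner_comm]
  have hexp : IsExposed ℝ K (l.toExposed K) := ContinuousLinearMap.toExposed.isExposed
  have hne : (l.toExposed K).Nonempty := by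
    obtain ⟨m, hm, hmax⟩ := hKc.exists_isMaxOn ⟨A', hA'K⟩ l.continuous.continuousOn
    exact ⟨m, hm, fun y hy => hmax hy⟩
  obtain ⟨a, ha⟩ := (hexp.isCompact hKc).extremePoints_nonempty hne
  have haK : a ∈ K.extremePoints ℝ := hexp.isExtreme.extremePoints_subset_extremePoints ha
  have has : 0 < ⟪a, s⟫ := by
    have := ha.1.2 A' hA'K
    rw [hl, hl] at this
    linarith
  obtain ⟨⟨ha1, ha2⟩, hext⟩ := haK
  refine ⟨a, ha1, ?_, has, ?_⟩
  · by_contra hcon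
    push Not at hcon
    rw [hcs, Finset.sum_eq_zero fun g hg => le_antisymm (ha1 g hg) (hcon g hg)] at ha2
    norm_num at ha2
  · by_contra hlt
    push Not at hlt
    set Z := Submodule.span ℝ {g : E 3 | g ∈ G ∧ ⟪a, g⟫ = 0} with hZ
    have hdim : Module.finrank ℝ (Z ⊔ (ℝ ∙ c) : Submodule ℝ (E 3)) ≤ 2 := by
      have h1 := Submodule.finrank_add_le_finrank_add_finrank Z (ℝ ∙ c)
      have h2 : Module.finrank ℝ (ℝ ∙ c) ≤ 1 := by
        simpa using finrank_span_le_card (R := ℝ) ({c} : Set (E 3))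
      omega
    have hbot : (Z ⊔ (ℝ ∙ c) : Submodule ℝ (E 3))ᗮ ≠ ⊥ := by
      intro h
      have h3 := Submodule.finrank_add_finrank_orthogonal (Z ⊔ (ℝ ∙ c) : Submodule ℝ (E 3))
      rw [h, finrank_bot, finrank_euclideanSpace_fin] at h3
      omega
    obtain ⟨d, hd, hd0⟩ := Submodule.exists_mem_ne_zero_of_ne_bot hbot
    rw [Submodule.mem_orthogonal'] at hd
    have hdc : ⟪d, c⟫ = 0 := hd c (Submodule.mem_sup_right (Submodule.mem_span_singleton_self c))
    have hdg : ∀ g ∈ G, ⟪a, g⟫ = 0 → ⟪d, g⟫ = 0 := fun g hg h =>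
      hd g (Submodule.mem_sup_left (Submodule.subset_span ⟨hg, h⟩))
    obtain ⟨ε, hε, hsm⟩ := exists_small (G.filter fun g => ⟪a, g⟫ ≠ 0) (fun g => -⟪a, g⟫)
      (fun g => |⟪d, g⟫|) (by
        intro g hg
        rw [Finset.mem_filter] at hg
        have := lt_of_le_of_ne (ha1 g hg.1) hg.2
        linarith)
    have hmem : ∀ σ : ℝ, |σ| = ε → a + σ • d ∈ K := by
      intro σ hσ
      refine ⟨fun g hg => ?_, ?_⟩
      · rw [inner_add_left, real_inner_smul_left]
        by_cases h : ⟪a, g⟫ = 0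
        · rw [h, hdg g hg h]; simp
        · have h1 := hsm g (Finset.mem_filter.2 ⟨hg, h⟩)
          have h2 : σ * ⟪d, g⟫ ≤ ε * |⟪d, g⟫| := by
            rw [← hσ, ← abs_mul]; exact le_abs_self _
          linarith
      · rw [inner_add_left, real_inner_smul_left, hdc, ha2]; simp
    have := hext (hmem ε (abs_of_pos hε)) (hmem (-ε) (by rw [abs_neg, abs_of_pos hε]))
      ⟨1/2, 1/2, by norm_num, by norm_num, by norm_num, by module⟩
    rw [add_eq_left, smul_eq_zero] at this
    rcases this with h | h
    · exact hε.ne' h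
    · exact hd0 h

lemma vecSpan_le {P F : Set (E 3)} {u v : E 3} (hF : F = {p | p ∈ P ∧ ⟪u, p - v⟫ = 0}) :
    (affineSpan ℝ F).direction ≤ (ℝ ∙ u)ᗮ := by
  rw [direction_affineSpan, vectorSpan_def, Submodule.span_le]
  rintro _ ⟨p, hp, q, hq, rfl⟩
  rw [hF] at hp hq
  rw [SetLike.mem_coe, Submodule.mem_orthogonal_singleton_iff_inner_right]
  have : p -ᵥ q = (p - v) - (q - v) := by simp
  simp only [this]
  rw [inner_sub_right, hp.2, hq.2, sub_zero]

lemma hrep {V : Finset (E 3)} {v : E 3} {P : Set (E 3)} (hP : IsPolytope P)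
    (hPV : P = convexHull ℝ (V : Set (E 3))) (hdim : dimS P = 3) (hv : IsVertexOf P v)
    (s : E 3) (hs : s ∉ Cn (gens V v)) :
    ∃ F ∈ facetsCont P {v}, 0 < ⟪outerNormal P F, s⟫ := by
  obtain ⟨hvP, t, ht⟩ := vertex_vec hv
  have hVP : ∀ y ∈ V, y ∈ P := fun y hy => hPV ▸ subset_convexHull ℝ _ hy
  have htG : ∀ g ∈ gens V v, 0 < ⟪t, g⟫ := by
    intro g hg
    obtain ⟨h0, p, hp, rfl⟩ := mem_gens.1 hg
    exact ht p (hVP p hp) (sub_ne_zero.1 h0)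
  obtain ⟨A, hA, hAs⟩ := sep _ t htG s hs
  obtain ⟨a, ha1, ⟨g0, hg0, hag0⟩, has, hdimZ⟩ :=
    extreme_dual (gens V v) (gens_nondeg hPV hdim) s A hA hAs
  have haP : ∀ p ∈ P, ⟪a, p - v⟫ ≤ 0 := fun p hp => Cn_inner_nonpos ha1 (sub_mem_Cn (hPV ▸ hp))
  set F : Set (E 3) := {p | p ∈ P ∧ ⟪a, p - v⟫ = 0} with hFdef
  have hvF : v ∈ F := ⟨hvP, by simp⟩
  have ha0 : a ≠ 0 := by rintro rfl; simp at has
  have hFe : IsExposed ℝ P F := by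
    intro _
    refine ⟨innerSL ℝ a, ?_⟩
    ext p
    simp only [hFdef, Set.mem_ofPred_eq, innerSL_apply_apply]
    refine and_congr_right fun hp => ⟨fun h y hy => ?_, fun h => le_antisymm (haP p hp) ?_⟩
    · have := haP y hy
      rw [inner_sub_right] at h this
      linarith
    · rw [inner_sub_right]; linarith [h v hvP]
  have hD : ∀ u : E 3, u ≠ 0 → Module.finrank ℝ (ℝ ∙ u)ᗮ = 2 := by
    intro u hu
    have h3 := Submodule.finrank_add_finrank_orthogonal (ℝ ∙ u)
    rw [finrank_span_singleton hu, finrank_euclideanSpace_fin] at h3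
    omega
  have hle := vecSpan_le hFdef
  have hZle : Submodule.span ℝ {g : E 3 | g ∈ gens V v ∧ ⟪a, g⟫ = 0} ≤
      (affineSpan ℝ F).direction := by
    rw [Submodule.span_le]
    rintro g ⟨hg, hag⟩
    obtain ⟨h0, p, hp, rfl⟩ := mem_gens.1 hg
    rw [direction_affineSpan]
    exact vsub_mem_vectorSpan ℝ (show p ∈ F from ⟨hVP p hp, hag⟩) hvF
  have hdimF : Module.finrank ℝ (affineSpan ℝ F).direction = 2 := by
    refine le_antisymm ?_ (hdimZ.trans (Submodule.finrank_mono hZle))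
    rw [← hD a ha0]
    exact Submodule.finrank_mono hle
  have hFf : IsFacetOf P F := ⟨hFe, by rw [hdim, dimS, hdimF]⟩
  refine ⟨F, ⟨hFf, by simpa using hvF⟩, ?_⟩
  obtain ⟨hu1, -, hu2, hu3⟩ := facet_normal hP hdim hFf hvF
  set u := outerNormal P F
  have hu0 : u ≠ 0 := by intro h; rw [h] at hu1; simp at hu1
  have hle' := vecSpan_le hu3
  have e1 := Submodule.eq_of_le_of_finrank_eq hle (by rw [hdimF, hD a ha0])
  have e2 := Submodule.eq_of_le_of_finrank_eq hle' (by rw [hdimF, hD u hu0])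
  have e3 : (ℝ ∙ u) = (ℝ ∙ a) := by
    rw [← Submodule.orthogonal_orthogonal (ℝ ∙ u), ← e2, e1, Submodule.orthogonal_orthogonal]
  have hua : u ∈ (ℝ ∙ a) := e3 ▸ Submodule.mem_span_singleton_self u
  obtain ⟨r, hr⟩ := Submodule.mem_span_singleton.1 hua
  have hr0 : r ≠ 0 := by rintro rfl; rw [zero_smul] at hr; exact hu0 hr.symm
  obtain ⟨-, p, hp, hpg⟩ := mem_gens.1 hg0
  have h5 := hu2 p (hVP p hp)
  rw [hpg, ← hr, real_inner_smul_left] at h5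
  have hrpos : 0 < r := by
    rcases lt_or_gt_of_ne hr0 with h | h
    · have := mul_pos_of_neg_of_neg h hag0
      linarith
    · exact h
  rw [← hr, real_inner_smul_left]
  exact mul_pos hrpos has

lemma uface_neg {V : Finset (E 3)} {v : E 3} {P : Set (E 3)} (hP : IsPolytope P)
    (hPV : P = convexHull ℝ (V : Set (E 3))) (hdim : dimS P = 3) (hv : IsVertexOf P v) :
    ∀ g ∈ gens V v, ⟪uface P {v}, g⟫ < 0 := by
  intro g hg
  have hfin := facets_finite (v := v) hP hPV hdim
  obtain ⟨hvP, t, ht⟩ := vertex_vec hv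
  have hVP : ∀ y ∈ V, y ∈ P := fun y hy => hPV ▸ subset_convexHull ℝ _ hy
  have htG : ∀ g ∈ gens V v, 0 < ⟪t, g⟫ := by
    intro g hg
    obtain ⟨h0, p, hp, rfl⟩ := mem_gens.1 hg
    exact ht p (hVP p hp) (sub_ne_zero.1 h0)
  have hng : -g ∉ Cn (gens V v) := by
    intro h
    have h1 := Cn_inner_pos htG h (neg_ne_zero.2 (mem_gens.1 hg).1)
    rw [inner_neg_right] at h1
    linarith [htG g hg]
  have hsum : ⟪∑ᶠ F ∈ facetsCont P {v}, outerNormal P F, g⟫ < 0 := by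
    rw [finsum_mem_eq_finite_toFinset_sum _ hfin, sum_inner]
    obtain ⟨F, hF, hFg⟩ := hrep hP hPV hdim hv _ hng
    obtain ⟨-, p, hp, rfl⟩ := mem_gens.1 hg
    rw [inner_neg_right] at hFg
    refine Finset.sum_neg' (fun F' hF' => ?_) ⟨F, by simpa using hF, by linarith⟩
    have hF'' : F' ∈ facetsCont P {v} := by simpa using hF'
    exact (facet_normal hP hdim hF''.1 (hF''.2 rfl)).2.2.1 p (hVP p hp)
  rw [uface, real_inner_smul_left]
  refine mul_neg_of_pos_of_neg (inv_pos.2 (norm_pos_iff.2 ?_)) hsum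
  intro h
  rw [h] at hsum
  simp at hsum

lemma srho_nonneg {P : Set (E 3)} {v : E 3} {ρ : ℝ} {x : E 3} (hx : x ∈ Srho P v ρ) :
    0 ≤ ⟪-uface P {v}, x⟫ ∧ (⟪-uface P {v}, x⟫ = 0 → x = 0) := by
  obtain ⟨n, c, p, hc, hp, rfl⟩ := hx
  have h1 : ⟪-uface P {v}, ∑ i, c i • p i⟫ = ∑ i, c i := by
    rw [inner_sum]
    refine Finset.sum_congr rfl fun i _ => ?_
    have h2 : ⟪p i, uface P {v}⟫ = -1 := (hp i).2
    rw [real_inner_smul_right, inner_neg_left, real_inner_comm, h2]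
    ring
  rw [h1]
  refine ⟨Finset.sum_nonneg fun i _ => hc i, fun h => ?_⟩
  rw [Finset.sum_eq_zero_iff_of_nonneg fun i _ => hc i] at h
  exact Finset.sum_eq_zero fun i hi => by rw [h i hi, zero_smul]

lemma srho_int_pos {P : Set (E 3)} {v : E 3} {ρ : ℝ} (hu : uface P {v} ≠ 0) {x : E 3}
    (hx : x ∈ interior (Srho P v ρ)) : 0 < ⟪-uface P {v}, x⟫ := by
  obtain ⟨h1, h2⟩ := srho_nonneg (interior_subset hx)
  rcases h1.eq_or_lt with h | h
  · exfalso
    obtain rfl := h2 h.symm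
    have hc : Filter.Tendsto (fun r : ℝ => r • uface P {v}) (nhdsWithin (0:ℝ) (Set.Ioi 0))
        (nhds (0 : E 3)) := by
      have : Continuous fun r : ℝ => r • uface P {v} := by fun_prop
      have := this.tendsto 0
      rw [zero_smul] at this
      exact this.mono_left nhdsWithin_le_nhds
    obtain ⟨r, hr1, hr2⟩ := ((hc.eventually (isOpen_interior.mem_nhds hx)).and
      self_mem_nhdsWithin).exists
    have hr3 := (srho_nonneg (interior_subset hr1)).1
    rw [inner_neg_left, real_inner_smul_right] at hr3
    have := mul_pos (show 0 < r from hr2) (real_inner_self_pos.2 hu)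
    linarith
  · exact h

lemma srho_int_smul {P : Set (E 3)} {v : E 3} {ρ : ℝ} {x : E 3}
    (hx : x ∈ interior (Srho P v ρ)) {r : ℝ} (hr : 0 < r) : r • x ∈ interior (Srho P v ρ) := by
  have h1 : r • x ∈ interior (r • Srho P v ρ) := by
    rw [interior_smul₀ hr.ne']
    exact Set.smul_mem_smul_set hx
  refine interior_mono ?_ h1
  rintro _ ⟨y, hy, rfl⟩
  exact coneHull_smul hy hr.le

lemma supp_sub_srho {P : Set (E 3)} {v : E 3} {ρ : ℝ} (hρ : 0 < ρ) {x : E 3}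
    (hx : x ∈ suppCone P v) (hpos : 0 < ⟪-uface P {v}, x⟫) : x ∈ interior (Srho P v ρ) := by
  rw [mem_interior_iff_mem_nhds]
  set t := -uface P {v} with ht
  have hv : ∀ y : E 3, 0 < ⟪t, y⟫ → (⟪t, y⟫)⁻¹ • y ∈ Hv P v := by
    intro y hy
    change ⟪(⟪t, y⟫)⁻¹ • y, uface P {v}⟫ = -1
    have : uface P {v} = -t := by simp [ht]
    rw [this, inner_neg_right, real_inner_smul_left, real_inner_comm t y, inv_mul_cancel₀ hy.ne']
  have hcont : ContinuousAt (fun y : E 3 => (⟪t, y⟫)⁻¹ • y) x := by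
    refine ContinuousAt.smul (ContinuousAt.inv₀ (by fun_prop) hpos.ne') continuousAt_id
  have hc2 : ContinuousAt (fun y : E 3 => ⟪t, y⟫) x := by fun_prop
  filter_upwards [hcont.eventually (Metric.closedBall_mem_nhds _ hρ),
    hc2.eventually (lt_mem_nhds hpos)] with y hy1 hy2
  have : y = ⟪t, y⟫ • ((⟪t, y⟫)⁻¹ • y) := by rw [smul_smul, mul_inv_cancel₀ hy2.ne', one_smul]
  rw [this]
  unfold Srho
  refine coneHull_gen ?_ hy2.le
  refine ⟨?_, hv y hy2⟩
  refine Set.mem_add.2 ⟨(⟪t, x⟫)⁻¹ • x, ⟨coneHull_smul hx (inv_nonneg.2 hpos.le), hv x hpos⟩,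
    (⟪t, y⟫)⁻¹ • y - (⟪t, x⟫)⁻¹ • x, ?_, by abel⟩
  rw [mem_closedBall_zero_iff, ← dist_eq_norm]
  exact hy1

/-- For a 3-polytope P, a vertex v of P and ρ > 0 there is a polynomial b
with properties (i)–(v) of Proposition on the cones b_{v,l}. -/
theorem exists_vertex_cone_polynomial (P : Set (E 3))
    (hP : IsPolytope P) (hdim : dimS P = 3)
    (v : E 3) (hv : IsVertexOf P v) (ρ : ℝ) (hρ : 0 < ρ) :
    ∃ b : MvPolynomial (Fin 3) ℝ,
      -- (i) b has even degree and x ↦ b(x + v) is homogeneous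
      (Even b.totalDegree ∧
        ∃ (n : ℕ) (q : MvPolynomial (Fin 3) ℝ), q.IsHomogeneous n ∧
          ∀ x : E 3, evalPoly q x = evalPoly b (x + v)) ∧
      -- (ii) b is symmetric about v
      (∀ x : E 3, evalPoly b (v + x) = evalPoly b (v - x)) ∧
      -- (iii) B := {x : ⟨x−v,u_v(P)⟩ ≤ 0, b(x) ≥ 0} is a convex cone with apex v
      -- containing P
      (Convex ℝ {x : E 3 | ⟪x - v, uface P {v}⟫ ≤ 0 ∧ 0 ≤ evalPoly b x} ∧
        (∀ x ∈ {x : E 3 | ⟪x - v, uface P {v}⟫ ≤ 0 ∧ 0 ≤ evalPoly b x},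
          ∀ α : ℝ, 0 ≤ α →
            v + α • (x - v) ∈ {x : E 3 | ⟪x - v, uface P {v}⟫ ≤ 0 ∧ 0 ≤ evalPoly b x}) ∧
        P ⊆ {x : E 3 | ⟪x - v, uface P {v}⟫ ≤ 0 ∧ 0 ≤ evalPoly b x}) ∧
      -- (iv) (v + S(P,v)) ∪ (v − S(P,v)) ⊆ {b ≥ 0} ⊆ {v} ∪ (v + int S_ρ) ∪ (v − int S_ρ)
      ((((fun s => v + s) '' suppCone P v) ∪ ((fun s => v - s) '' suppCone P v) ⊆
          {x : E 3 | 0 ≤ evalPoly b x}) ∧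
        {x : E 3 | 0 ≤ evalPoly b x} ⊆
          {v} ∪ ((fun s => v + s) '' interior (Srho P v ρ)) ∪
            ((fun s => v - s) '' interior (Srho P v ρ))) ∧
      -- (v) behaviour along edges through v
      (∀ I : Set (E 3), IsFaceOf P I → dimS I = 1 → v ∈ I →
        ∀ x ∈ (fun s => v + s) '' Srho P v ρ, visFacets P x = facetsCont P I →
          evalPoly b x ≤ 0 ∧
            (evalPoly b x = 0 ↔ x ∈ (fun s => v + s) '' suppCone I v)) := by
  classical
  obtain ⟨V, hVne, hPV⟩ := id hP
  have hfin := facets_finite (v := v) hP hPV hdim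
  obtain ⟨hvP, -⟩ := vertex_vec hv
  have hVP : ∀ y ∈ V, y ∈ P := fun y hy => hPV ▸ subset_convexHull ℝ _ hy
  have hS : suppCone P v = Cn (gens V v) := suppCone_eq P hPV
  set G := gens V v with hG
  set t : E 3 := -uface P {v} with htdef
  have htu : ∀ y : E 3, ⟪y, uface P {v}⟫ = -⟪t, y⟫ := fun y => by
    rw [htdef, inner_neg_left, neg_neg, real_inner_comm]
  have ht : ∀ g ∈ G, 0 < ⟪t, g⟫ := fun g hg => by
    rw [htdef, inner_neg_left]; linarith [uface_neg hP hPV hdim hv g hg]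
  have hpt : ∃ p ∈ P, p ≠ v := by
    by_contra hcon
    push Not at hcon
    have hPs : P = {v} := Set.eq_singleton_iff_unique_mem.2 ⟨hvP, hcon⟩
    rw [hPs, dimS, direction_affineSpan, vectorSpan_singleton, finrank_bot] at hdim
    omega
  have hPC : ∀ p ∈ P, p - v ∈ Cn G := fun p hp => sub_mem_Cn (hPV ▸ hp)
  have hPt : ∀ p ∈ P, p ≠ v → 0 < ⟪t, p - v⟫ := fun p hp hne =>
    Cn_inner_pos ht (hPC p hp) (sub_ne_zero.2 hne)
  have hu0 : uface P {v} ≠ 0 := by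
    obtain ⟨p, hp, hne⟩ := hpt
    intro h
    have := hPt p hp hne
    rw [htdef, h] at this
    simp at this
  obtain ⟨W, hWG, hWC, ι, hι, a, c, k, hk, hc, hW0, hsub, hnd⟩ :=
    core G t ht (interior (Srho P v ρ)) isOpen_interior (fun x hx => srho_int_pos hu0 hx)
      (fun x hx r hr => srho_int_smul hx hr)
      (fun x hx h0 => supp_sub_srho hρ (hS ▸ hx) (Cn_inner_pos ht hx h0))
  obtain ⟨b, hb1, hb2, hb3⟩ := poly_exists a c t v k
  set φ : E 3 → ℝ := fun s => ⟪t, s⟫ ^ (2 * k) - ∑ i, c i * ⟪a i, s⟫ ^ (2 * k) with hφ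
  have hbφ : ∀ x, evalPoly b x = φ (x - v) := hb3
  have hφs : ∀ (r : ℝ) (s : E 3), φ (r • s) = r ^ (2 * k) * φ s := by
    intro r s
    simp only [hφ, real_inner_smul_right, mul_pow, mul_sub, Finset.mul_sum]
    congr 1
    exact Finset.sum_congr rfl fun i _ => by ring
  have hφn : ∀ s : E 3, φ (-s) = φ s := by
    intro s
    have := hφs (-1) s
    rw [neg_one_smul, (even_two_mul k).neg_one_pow, one_mul] at this
    exact this
  have hφ0 : φ 0 = 0 := by
    have := hφs 0 0
    rwa [zero_smul, zero_pow (by omega), zero_mul] at this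
  have hφsn : ∀ (r : ℝ) (s : E 3), 0 ≤ φ s → 0 ≤ φ (r • s) := fun r s h => by
    rw [hφs]; exact mul_nonneg ((even_two_mul k).pow_nonneg _) h
  have hadd : ∀ x y : E 3, 0 ≤ ⟪t, x⟫ → 0 ≤ ⟪t, y⟫ → 0 ≤ φ x → 0 ≤ φ y →
      0 ≤ φ (x + y) ∧ (⟪t, y⟫ • x ≠ ⟪t, x⟫ • y → 0 < φ (x + y)) := by
    intro x y h1 h2 h3 h4
    obtain ⟨h5, h6⟩ := strict_lemma a c hc t k hk hnd x y h1 h2 (sub_nonneg.1 h3) (sub_nonneg.1 h4)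
    exact ⟨sub_nonneg.2 h5, fun h => sub_pos.2 (h6 h)⟩
  have htn : ∀ x ∈ Cn G, 0 ≤ ⟪t, x⟫ := by
    intro x hx
    by_cases h0 : x = 0
    · simp [h0]
    · exact (Cn_inner_pos ht hx h0).le
  have hφC : ∀ x ∈ Cn G, 0 ≤ φ x := by
    intro x hx
    rw [← hWC] at hx
    obtain ⟨d, hd, rfl⟩ := hx
    have : ∀ T : Finset (E 3), T ⊆ W →
        0 ≤ ⟪t, ∑ g ∈ T, d g • g⟫ ∧ 0 ≤ φ (∑ g ∈ T, d g • g) := by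
      intro T
      induction T using Finset.induction_on with
      | empty => intro _; simp [hφ0]
      | insert w T hw ih =>
        intro hT
        obtain ⟨h1, h2⟩ := ih fun g hg => hT (by simp [hg])
        have hwW : w ∈ W := hT (by simp)
        rw [Finset.sum_insert hw]
        have h3 : 0 ≤ ⟪t, d w • w⟫ := by
          rw [real_inner_smul_right]; exact mul_nonneg (hd w) (ht w (hWG hwW)).le
        have h4 : 0 ≤ φ (d w • w) := hφsn _ _ (sub_nonneg.2 (hW0 w hwW).le)
        exact ⟨by rw [inner_add_right]; exact add_nonneg h3 h1, (hadd _ _ h3 h1 h4 h2).1⟩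
    exact (this W subset_rfl).2
  refine ⟨b, ⟨hb1, hb2⟩, ?_, ⟨?_, ?_, ?_⟩, ⟨?_, ?_⟩, ?_⟩
  · intro x
    rw [hbφ, hbφ, add_sub_cancel_left, sub_sub_cancel_left, hφn]
  · rintro x ⟨hx1, hx2⟩ y ⟨hy1, hy2⟩ α β hα hβ hαβ
    rw [htu] at hx1 hy1
    rw [hbφ] at hx2 hy2
    have e : α • x + β • y - v = α • (x - v) + β • (y - v) := by
      have : v = (α + β) • v := by rw [hαβ, one_smul]
      conv_lhs => rw [this]
      module
    have h1 : 0 ≤ ⟪t, α • (x - v)⟫ := by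
      rw [real_inner_smul_right]; exact mul_nonneg hα (by linarith)
    have h2 : 0 ≤ ⟪t, β • (y - v)⟫ := by
      rw [real_inner_smul_right]; exact mul_nonneg hβ (by linarith)
    constructor
    · rw [htu, e, inner_add_right]; linarith
    · rw [hbφ, e]
      exact (hadd _ _ h1 h2 (hφsn _ _ hx2) (hφsn _ _ hy2)).1
  · rintro x ⟨hx1, hx2⟩ α hα
    rw [htu] at hx1
    rw [hbφ] at hx2
    constructor
    · rw [htu, add_sub_cancel_left, real_inner_smul_right]
      have := mul_nonneg hα (show 0 ≤ ⟪t, x - v⟫ by linarith)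
      linarith
    · rw [hbφ, add_sub_cancel_left]
      exact hφsn _ _ hx2
  · intro p hp
    refine ⟨?_, ?_⟩
    · rw [htu]; linarith [htn _ (hPC p hp)]
    · rw [hbφ]; exact hφC _ (hPC p hp)
  · rintro _ (⟨s, hs, rfl⟩ | ⟨s, hs, rfl⟩)
    · change 0 ≤ evalPoly b (v + s)
      rw [hbφ, add_sub_cancel_left]
      exact hφC s (hS ▸ hs)
    · change 0 ≤ evalPoly b (v - s)
      rw [hbφ, sub_sub_cancel_left, hφn]
      exact hφC s (hS ▸ hs)
  · intro x hx
    change 0 ≤ evalPoly b x at hx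
    rw [hbφ] at hx
    rcases hsub (x - v) (sub_nonneg.1 hx) with h | h | h
    · exact Or.inl (Or.inl (sub_eq_zero.1 h))
    · exact Or.inl (Or.inr ⟨x - v, h, by simp⟩)
    · exact Or.inr ⟨-(x - v), h, by simp⟩
  · rintro I hI hI1 hvI _ ⟨s, hs, rfl⟩ hvis
    simp only [hbφ, add_sub_cancel_left]
    have hIP : I ⊆ P := hI.subset
    obtain ⟨p, hpI, hpv⟩ : ∃ p ∈ I, p ≠ v := by
      by_contra hcon
      push Not at hcon
      have hIs : I = {v} := Set.eq_singleton_iff_unique_mem.2 ⟨hvI, hcon⟩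
      rw [hIs, dimS, direction_affineSpan, vectorSpan_singleton, finrank_bot] at hI1
      omega
    set w := p - v with hw
    have hw0 : w ≠ 0 := sub_ne_zero.2 hpv
    have htw : 0 < ⟪t, w⟫ := hPt p (hIP hpI) hpv
    have hpar : ∀ q ∈ I, ∃ r : ℝ, 0 ≤ r ∧ q - v = r • w := by
      intro q hq
      have hmem : ∀ q ∈ I, q - v ∈ (affineSpan ℝ I).direction := fun q hq => by
        rw [direction_affineSpan]; exact vsub_mem_vectorSpan ℝ hq hvI
      obtain ⟨r, hr⟩ := (finrank_eq_one_iff_of_nonzero' (⟨w, hmem p hpI⟩ :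
        (affineSpan ℝ I).direction) (fun h => hw0 (congrArg Subtype.val h))).1 hI1
          ⟨q - v, hmem q hq⟩
      have hr' : r • w = q - v := congrArg Subtype.val hr
      refine ⟨r, ?_, hr'.symm⟩
      have h1 := htn _ (hPC q (hIP hq))
      rw [← hr', real_inner_smul_right] at h1
      exact nonneg_of_mul_nonneg_left h1 htw
    -- b vanishes on the edge
    have hφw : φ w = 0 := by
      obtain ⟨l, hl1, hl2⟩ := exposed_vec hI hvI
      have hwW : w ∈ Cn W := hWC ▸ hPC p (hIP hpI)
      obtain ⟨d, hd, hwd⟩ := hwW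
      have hgen : ∀ g ∈ W, ∃ q ∈ P, q - v = g := fun g hg => by
        obtain ⟨-, q, hq, h⟩ := mem_gens.1 (hWG hg)
        exact ⟨q, hVP q hq, h⟩
      have h0 : ⟪l, w⟫ = 0 := by
        have := hpI
        rw [hl2] at this
        exact this.2
      rw [hwd, inner_sum] at h0
      simp only [real_inner_smul_right] at h0
      rw [Finset.sum_eq_zero_iff_of_nonpos (fun g hg => by
        obtain ⟨q, hq, rfl⟩ := hgen g hg
        exact mul_nonpos_of_nonneg_of_nonpos (hd _) (hl1 q hq))] at h0
      obtain ⟨g, hg, hdg⟩ : ∃ g ∈ W, d g • g ≠ 0 := by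
        by_contra hcon
        push Not at hcon
        exact hw0 (hwd.trans (Finset.sum_eq_zero hcon))
      have hlg : ⟪l, g⟫ = 0 := by
        rcases mul_eq_zero.1 (h0 g hg) with h | h
        · exact absurd (by rw [h, zero_smul]) hdg
        · exact h
      obtain ⟨q, hq, hqg⟩ := hgen g hg
      have hqI : q ∈ I := by
        rw [hl2]; exact ⟨hq, by rw [hqg]; exact hlg⟩
      obtain ⟨r, hr, hrw⟩ := hpar q hqI
      have hr0 : r ≠ 0 := by
        rintro rfl
        rw [zero_smul, hqg] at hrw
        rw [hrw, smul_zero] at hdg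
        exact hdg rfl
      have h1 : φ g = 0 := sub_eq_zero.2 (hW0 g hg).symm
      rw [← hqg, hrw, hφs] at h1
      exact (mul_eq_zero.1 h1).resolve_left (pow_ne_zero _ hr0)
    have hA : s ∈ suppCone I v → φ s = 0 := by
      rintro ⟨n, d, y, hd, hy, rfl⟩
      have : ∀ i, ∃ r : ℝ, y i = r • w := fun i => by
        obtain ⟨q, hq, h⟩ := hy i
        obtain ⟨r, -, hr⟩ := hpar q hq
        exact ⟨r, h.symm.trans hr⟩
      choose r hr using this
      have e : ∑ i, d i • y i = (∑ i, d i * r i) • w := by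
        rw [Finset.sum_smul]
        exact Finset.sum_congr rfl fun i _ => by rw [hr i, smul_smul]
      rw [e, hφs, hφw, mul_zero]
    have hB : 0 ≤ φ s → s ∈ suppCone I v := by
      intro hφs0
      have hts : 0 ≤ ⟪t, s⟫ := (srho_nonneg hs).1
      have hdiam : 0 < Metric.diam P := by
        obtain ⟨p, hp, hne⟩ := hpt
        exact (dist_pos.2 hne).trans_le
          (Metric.dist_le_diam_of_mem (polytope_compact hP).isBounded hp hvP)
      obtain ⟨ε, hε, hsm⟩ := exists_small (hfin.toFinset.filter fun F => ¬ I ⊆ F)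
        (fun F => -⟪outerNormal P F, w⟫) (fun F => -⟪outerNormal P F, s⟫) (by
          intro F hF
          rw [Finset.mem_filter, Set.Finite.mem_toFinset] at hF
          obtain ⟨⟨hF1, hF2⟩, hIF⟩ := hF
          obtain ⟨-, -, h1, h2⟩ := facet_normal hP hdim hF1 (hF2 rfl)
          rcases (h1 p (hIP hpI)).eq_or_lt with h | h
          · exfalso
            apply hIF
            intro q hq
            rw [h2]
            refine ⟨hIP hq, ?_⟩
            obtain ⟨r, -, hr⟩ := hpar q hq
            rw [hr, real_inner_smul_right, hw, h, mul_zero]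
          · simpa using h)
      have hz : w - ε • s ∈ Cn G := by
        by_contra hcon
        obtain ⟨F, hF, hpos⟩ := hrep hP hPV hdim hv _ hcon
        rw [inner_sub_right, real_inner_smul_right] at hpos
        by_cases hIF : I ⊆ F
        · obtain ⟨-, h0, -, h2⟩ := facet_normal hP hdim hF.1 (hF.2 rfl)
          have hFv : F ∈ visFacets P (v + s) := by
            rw [hvis]; exact ⟨hF.1, hIF⟩
          have hq : qF P F (v + s) ≤ 0 := hFv.2
          rw [qF, h0, inner_add_right, div_le_iff₀ hdiam] at hq
          have hpF := hIF hpI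
          rw [h2] at hpF
          have h3 : ⟪outerNormal P F, w⟫ = 0 := hpF.2
          have h4 := mul_nonneg hε.le (show 0 ≤ ⟪outerNormal P F, s⟫ by linarith)
          linarith
        · have := hsm F (Finset.mem_filter.2 ⟨by simpa using hF, hIF⟩)
          linarith
      have htes : 0 ≤ ⟪t, ε • s⟫ := by
        rw [real_inner_smul_right]; exact mul_nonneg hε.le hts
      obtain ⟨-, h2⟩ := hadd (w - ε • s) (ε • s) (htn _ hz) htes (hφC _ hz) (hφsn _ _ hφs0)
      rw [sub_add_cancel, hφw] at h2
      have h3 : ⟪t, ε • s⟫ • (w - ε • s) = ⟪t, w - ε • s⟫ • (ε • s) := by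
        by_contra hne
        exact lt_irrefl _ (h2 hne)
      rw [inner_sub_right, real_inner_smul_right, smul_sub, sub_smul, sub_left_inj] at h3
      have h4 : s = (⟪t, s⟫ / ⟪t, w⟫) • w := by
        have h5 : ε • (⟪t, s⟫ • w) = ε • (⟪t, w⟫ • s) := by
          rw [smul_smul, h3, smul_comm]
        have h6 := smul_right_injective (E 3) hε.ne' h5
        rw [div_eq_inv_mul, mul_smul, h6, smul_smul, inv_mul_cancel₀ htw.ne', one_smul]
      rw [h4]
      unfold suppCone
      refine coneHull_gen ?_ (div_nonneg hts htw.le)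
      exact ⟨p, hpI, rfl⟩
    have hmem : v + s ∈ (fun s => v + s) '' suppCone I v ↔ s ∈ suppCone I v := by
      simp
    rw [hmem]
    refine ⟨?_, fun h => hB h.ge, hA⟩
    by_contra hcon
    push Not at hcon
    have := hA (hB hcon.le)
    linarith
end
end

section
/- Let d ≥ 2 and assume that for every m ∈ ℕ, every n ∈ ℕ, and every n-dimensional polytope Q in ℝ^m there exist polynomials p₀,…,p_{n−1} ∈ ℝ[x₁,…,x_m] satisfying Q = {x ∈ aff Q : p₀(x) ≥ 0, …, p_{n−1}(x) ≥ 0} and p₀(x) > 0 for all x ∈ Q \ vert(Q). Then for every d-dimensional polyhedron P in ℝ^d there exist polynomials f₀,…,f_{d−1} ∈ ℝ[x₁,…,x_d] with P = {x ∈ ℝ^d : f₀(x) ≥ 0, …, f_{d−1}(x) ≥ 0}. -/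
open scoped RealInnerProductSpace Pointwise
open Metric Set

noncomputable section

lemma triple_swap (χ : Polynomial (Polynomial (Polynomial ℝ))) (ε s T : ℝ) :
    (Polynomial.Bivariate.swap χ).eval₂ (Polynomial.evalEvalRingHom ε T) s =
      χ.eval₂ (Polynomial.evalEvalRingHom ε s) T := by
  have : ((Polynomial.eval₂RingHom (Polynomial.evalEvalRingHom ε T) s).comp
      (Polynomial.Bivariate.swap (R := Polynomial ℝ)).toRingEquiv.toRingHom) =
      Polynomial.eval₂RingHom (Polynomial.evalEvalRingHom ε s) T := by
    apply Polynomial.ringHom_ext'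
    · apply Polynomial.ringHom_ext'
      · ext <;> simp [Polynomial.Bivariate.swap_C]
      · simp [Polynomial.Bivariate.swap_C]
    · simp [Polynomial.Bivariate.swap_Y]
  have h := congrArg (fun f => f χ) this
  simpa using h

lemma fin_quot {R σ : Type} [CommRing R] [Fintype σ] (e : ℕ) (q : σ → MvPolynomial σ R)
    (hq : ∀ i, (q i).totalDegree < e) :
    Module.Finite R (MvPolynomial σ R ⧸
      Ideal.span (Set.range fun i => (MvPolynomial.X i ^ e - q i : MvPolynomial σ R))) := by
  classical
  set I := Ideal.span (Set.range fun i => (MvPolynomial.X i ^ e - q i : MvPolynomial σ R)) with hI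
  set D := Fintype.card σ * e
  set S : Set (σ →₀ ℕ) := {a | a.degree ≤ D}
  have hS : S.Finite := by
    have : S ⊆ (Set.Iic (Finsupp.equivFunOnFinite.symm (fun _ : σ => D))) := by
      intro a ha i
      exact (Finsupp.le_degree i a).trans ha
    exact (Set.finite_Iic _).subset this
  set π := (Ideal.Quotient.mkₐ R I)
  set W : Submodule R (MvPolynomial σ R ⧸ I) :=
    Submodule.span R ((fun a => π (MvPolynomial.monomial a 1)) '' S)
  have key : ∀ n, ∀ p : MvPolynomial σ R, p.totalDegree ≤ n → π p ∈ W := by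
    intro n
    induction n using Nat.strong_induction_on with
    | _ n ih =>
    have mono : ∀ a : σ →₀ ℕ, a.degree ≤ n → π (MvPolynomial.monomial a 1) ∈ W := by
      intro a ha
      by_cases haD : a.degree ≤ D
      · exact Submodule.subset_span ⟨a, haD, rfl⟩
      · have : ∃ i, e ≤ a i := by
          by_contra! hcon
          apply haD
          rw [Finsupp.degree_eq_sum]
          calc ∑ i, a i ≤ ∑ i : σ, e := Finset.sum_le_sum fun i _ => (hcon i).le
            _ = D := by simp [D]
        obtain ⟨i, hi⟩ := this
        set b := a - Finsupp.single i e
        have hab : a = b + Finsupp.single i e := by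
          rw [tsub_add_cancel_of_le]
          simpa using hi
        have hdeg : a.degree = b.degree + e := by rw [hab]; simp
        have h1 : π (MvPolynomial.monomial a 1) = π (MvPolynomial.monomial b 1 * q i) := by
          apply (Ideal.Quotient.eq).2
          have : (MvPolynomial.monomial a (1:R)) = MvPolynomial.monomial b 1 * MvPolynomial.X i ^ e := by
            rw [MvPolynomial.X_pow_eq_monomial, MvPolynomial.monomial_mul, hab]; simp
          rw [this, ← mul_sub]
          exact I.mul_mem_left _ (Ideal.subset_span ⟨i, rfl⟩)
        rw [h1]
        have hlt : (MvPolynomial.monomial b (1:R) * q i).totalDegree < n := by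
          refine (MvPolynomial.totalDegree_mul _ _).trans_lt ?_
          have := MvPolynomial.totalDegree_monomial_le b (1:R)
          have h3 : (b.sum fun _ => id) = b.degree := rfl
          have h4 := hq i
          have h5 : (MvPolynomial.monomial b (1:R)).totalDegree ≤ b.degree := this
          have h6 : ((MvPolynomial.monomial b (1:R)).totalDegree + (q i).totalDegree) < b.degree + e := by omega
          exact h6.trans_le (hdeg ▸ ha)
        exact ih _ hlt _ le_rfl
    intro p hp
    rw [p.as_sum, map_sum]
    refine Submodule.sum_mem _ fun a ha => ?_
    have : MvPolynomial.monomial a (p.coeff a) = p.coeff a • MvPolynomial.monomial a (1:R) := by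
      simp [MvPolynomial.smul_monomial]
    rw [this, map_smul]
    refine W.smul_mem _ (mono a ?_)
    exact (MvPolynomial.le_totalDegree ha).trans hp
  refine ⟨⟨(hS.image (fun a => π (MvPolynomial.monomial a 1))).toFinset, ?_⟩⟩
  rw [Set.Finite.coe_toFinset]
  rw [eq_top_iff]
  rintro x -
  obtain ⟨p, rfl⟩ := Ideal.Quotient.mk_surjective x
  exact key _ p le_rfl

lemma eval_deriv_line {σ : Type} [DecidableEq σ] (p : MvPolynomial σ ℝ) (y : σ → ℝ) (i : σ) :
    HasDerivAt (fun t : ℝ => MvPolynomial.eval (y + t • Pi.single i 1) p)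
      (MvPolynomial.eval y (MvPolynomial.pderiv i p)) 0 := by
  induction p using MvPolynomial.induction_on with
  | C a => simpa using hasDerivAt_const (0:ℝ) a
  | add p q hp hq => 
    simp only [map_add]
    exact HasDerivAt.fun_add hp hq
  | mul_X p j hp =>
    have hX : HasDerivAt (fun t : ℝ => (y + t • (Pi.single i 1 : σ → ℝ)) j)
        ((Pi.single i 1 : σ → ℝ) j) 0 := by
      simpa using ((hasDerivAt_id (0:ℝ)).mul_const ((Pi.single i 1 : σ → ℝ) j)).const_add (y j)
    have := HasDerivAt.fun_mul hp hX
    simp only [map_mul, MvPolynomial.eval_X, Derivation.leibniz, MvPolynomial.pderiv_X]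
    refine this.congr_deriv ?_
    by_cases h : j = i
    · subst h; simp; ring
    · simp [h]; ring

lemma tendsto_bound (B : Polynomial (Polynomial ℝ)) (hB : B ≠ 0) (M : ℝ) :
    ∃ c > 0, ∃ N : ℕ, ∃ δ > 0, ∀ ε, 0 < ε → ε ≤ δ → ∀ T, 0 < T → T ≤ M →
      B.evalEval ε T = 0 → c * ε ^ N ≤ T := by
  obtain ⟨B', hB', hnd⟩ := B.exists_eq_pow_rootMultiplicity_mul_and_not_dvd hB 0
  simp only [map_zero, sub_zero] at hB' hnd
  set b := B'.coeff 0
  have hb : b ≠ 0 := fun h => hnd (Polynomial.X_dvd_iff.2 h)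
  obtain ⟨b', hb', hnd'⟩ := b.exists_eq_pow_rootMultiplicity_mul_and_not_dvd hb 0
  simp only [map_zero, sub_zero] at hb' hnd'
  set N := Polynomial.rootMultiplicity 0 b
  have hb0 : b'.eval 0 ≠ 0 := fun h => hnd' (Polynomial.X_dvd_iff.2 (by
    rwa [Polynomial.coeff_zero_eq_eval_zero]))
  have hcont : Continuous fun z : ℝ × ℝ => B'.divX.evalEval z.1 z.2 := by
    have : (fun z : ℝ × ℝ => B'.divX.evalEval z.1 z.2) = fun z =>
        ∑ j ∈ Finset.range (B'.divX.natDegree + 1), (B'.divX.coeff j).eval z.1 * z.2 ^ j := by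
      ext z
      rw [← Polynomial.eval₂_evalRingHom, Polynomial.eval₂_eq_sum_range]
      rfl
    rw [this]
    refine continuous_finsetSum _ fun j _ => ?_
    exact ((B'.divX.coeff j).continuous.comp continuous_fst).mul (continuous_snd.pow j)
  obtain ⟨K, hK⟩ := ((isCompact_Icc (a := (0:ℝ)) (b := 1)).prod
    (isCompact_Icc (a := (0:ℝ)) (b := M))).exists_bound_of_continuousOn hcont.continuousOn
  have hev : ∀ᶠ ε in nhds (0:ℝ), |b'.eval 0| / 2 < |b'.eval ε| := by
    have := (b'.continuous.abs).tendsto 0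
    exact this.eventually (lt_mem_nhds (by have := abs_pos.2 hb0; linarith))
  obtain ⟨δ, hδ, hball⟩ := Metric.eventually_nhds_iff.1 hev
  refine ⟨|b'.eval 0| / 2 / (|K| + 1), by have := abs_pos.2 hb0; positivity, N, min 1 (δ/2), by positivity, ?_⟩
  intro ε h0 h1 T hT hTM hz
  have h2 : B'.evalEval ε T = 0 := by
    rw [hB', Polynomial.evalEval_mul, Polynomial.evalEval_pow, Polynomial.evalEval_X] at hz
    exact (mul_eq_zero.1 hz).resolve_left (pow_ne_zero _ hT.ne')
  have h3 : B'.divX.evalEval ε T * T + b.eval ε = 0 := by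
    rw [← h2]
    conv_rhs => rw [← B'.divX_mul_X_add]
    simp [Polynomial.evalEval, b]
  have h4 := hK (ε, T) ⟨⟨h0.le, h1.trans (min_le_left _ _)⟩, ⟨hT.le, hTM⟩⟩
  have h5 : |b.eval ε| ≤ (|K| + 1) * T := by
    have : b.eval ε = - (B'.divX.evalEval ε T * T) := by linarith
    rw [this, abs_neg, abs_mul, abs_of_pos hT]
    gcongr
    rw [Real.norm_eq_abs] at h4
    linarith [le_abs_self K]
  have h6 := @hball ε (by
    rw [Real.dist_eq, sub_zero, abs_of_pos h0]
    have := min_le_right 1 (δ/2); linarith)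
  have h7 : |b.eval ε| = ε ^ N * |b'.eval ε| := by
    rw [hb']; simp [abs_mul, abs_of_pos h0]
  rw [div_mul_eq_mul_div, div_le_iff₀ (by positivity)]
  calc |b'.eval 0| / 2 * ε ^ N ≤ |b'.eval ε| * ε ^ N := by gcongr
    _ = |b.eval ε| := by rw [h7]; ring
    _ ≤ _ := by linarith

lemma int_rel {R σ : Type} [CommRing R] [Fintype σ] (I : Ideal (MvPolynomial σ R))
    (hfin : Module.Finite R (MvPolynomial σ R ⧸ I)) (a : MvPolynomial σ R) :
    ∃ χ : Polynomial R, χ.Monic ∧ ∀ (S : Type) [CommRing S] (θ : MvPolynomial σ R →+* S),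
      I ≤ RingHom.ker θ → χ.eval₂ (θ.comp MvPolynomial.C) (θ a) = 0 := by
  have hint : IsIntegral R (Ideal.Quotient.mk I a) :=
    (Algebra.IsIntegral.of_finite _ _).isIntegral _
  obtain ⟨χ, hχ, hχ0⟩ := hint
  refine ⟨χ, hχ, fun S _ θ hθ => ?_⟩
  have hmem : χ.eval₂ MvPolynomial.C a ∈ I := by
    rw [← Ideal.Quotient.eq_zero_iff_mem, Polynomial.hom_eval₂]
    exact hχ0
  have := hθ hmem
  rw [RingHom.mem_ker, Polynomial.hom_eval₂] at this
  exact this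

lemma ideal_rel {σ : Type} [Fintype σ] (F : MvPolynomial σ (Polynomial ℝ)) :
    ∃ M : ℕ, ∃ χ : Polynomial (Polynomial (Polynomial ℝ)), χ.Monic ∧
      ∀ (ε s : ℝ) (y : σ → ℝ),
        (∀ i, (2 * (M + 1 : ℝ)) * y i ^ (2 * M + 1) + s * MvPolynomial.eval y
          (MvPolynomial.pderiv i (MvPolynomial.map (Polynomial.evalRingHom ε) F)) = 0) →
        χ.eval₂ (Polynomial.evalEvalRingHom ε s)
          (MvPolynomial.eval y (MvPolynomial.map (Polynomial.evalRingHom ε) F)) = 0 := by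
  classical
  set F' : MvPolynomial σ (Polynomial (Polynomial ℝ)) := MvPolynomial.map Polynomial.C F with hF'
  set M := ∑ i, (MvPolynomial.pderiv i F').totalDegree with hM
  set κ : Polynomial (Polynomial ℝ) :=
    -(Polynomial.X * Polynomial.C (Polynomial.C (1 / (2 * (M + 1 : ℝ))))) with hκ
  set q : σ → MvPolynomial σ (Polynomial (Polynomial ℝ)) := fun i =>
    MvPolynomial.C κ * MvPolynomial.pderiv i F' with hq
  have hqd : ∀ i, (q i).totalDegree < 2 * M + 1 := by
    intro i
    have h1 := MvPolynomial.totalDegree_mul (MvPolynomial.C κ) (MvPolynomial.pderiv i F')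
    have h2 : (MvPolynomial.pderiv i F').totalDegree ≤ M :=
      Finset.single_le_sum (f := fun i => (MvPolynomial.pderiv i F').totalDegree)
        (fun _ _ => Nat.zero_le _) (Finset.mem_univ i)
    rw [MvPolynomial.totalDegree_C] at h1
    simp only [hq]
    omega
  have hfin := fin_quot (2 * M + 1) q hqd
  set I := Ideal.span (Set.range fun i =>
    (MvPolynomial.X i ^ (2 * M + 1) - q i : MvPolynomial σ (Polynomial (Polynomial ℝ)))) with hI
  obtain ⟨χ, hχ, hχ0⟩ := int_rel I hfin F'
  refine ⟨M, χ, hχ, ?_⟩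
  intro ε s y hy
  set θ := MvPolynomial.eval₂Hom (Polynomial.evalEvalRingHom ε s) y with hθ
  have hcomp : (Polynomial.evalEvalRingHom ε s).comp Polynomial.C = Polynomial.evalRingHom ε := by
    ext <;> simp
  have hθF : ∀ G : MvPolynomial σ (Polynomial ℝ), θ (MvPolynomial.map Polynomial.C G) =
      MvPolynomial.eval y (MvPolynomial.map (Polynomial.evalRingHom ε) G) := by
    intro G
    rw [hθ, MvPolynomial.coe_eval₂Hom, MvPolynomial.eval₂_map, hcomp, MvPolynomial.eval_map]
  have hker : I ≤ RingHom.ker θ := by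
    rw [hI, Ideal.span_le]
    rintro _ ⟨i, rfl⟩
    have h1 : θ (MvPolynomial.pderiv i F') = MvPolynomial.eval y
          (MvPolynomial.pderiv i (MvPolynomial.map (Polynomial.evalRingHom ε) F)) := by
      rw [hF', MvPolynomial.pderiv_map, hθF, MvPolynomial.pderiv_map]
    have h2 : θ (MvPolynomial.C κ) = - (s * (1 / (2 * (M + 1 : ℝ)))) := by
      simp [hθ, hκ]
    have h3 : θ (MvPolynomial.X i) = y i := by simp [hθ]
    simp only [SetLike.mem_coe, RingHom.mem_ker, map_sub, map_pow, hq, map_mul, h1, h2, h3]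
    have := hy i
    have hpos : (0:ℝ) < 2 * (M + 1 : ℝ) := by positivity
    field_simp
    linarith
  have h4 := hχ0 ℝ θ hker
  rw [hθF] at h4
  have h5 : θ.comp MvPolynomial.C = Polynomial.evalEvalRingHom ε s := by
    apply RingHom.ext
    intro z
    simp [hθ]
  rw [h5] at h4
  exact h4

lemma exists_crit {σ : Type} [Fintype σ] (f : MvPolynomial σ ℝ) (hf : ∀ y, 0 < MvPolynomial.eval y f)
    (M : ℕ) (s : ℝ) (hs : 0 < s) :
    ∃ y : σ → ℝ, (∀ i, (2 * (M + 1 : ℝ)) * y i ^ (2 * M + 1) + s * MvPolynomial.eval y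
          (MvPolynomial.pderiv i f) = 0) ∧
      ∀ z, MvPolynomial.eval y f * s ≤ MvPolynomial.eval z f * s + ∑ i, z i ^ (2 * (M + 1)) := by
  classical
  set K : MvPolynomial σ ℝ := MvPolynomial.C s * f + ∑ i, MvPolynomial.X i ^ (2 * (M + 1)) with hK
  have hKe : ∀ z, MvPolynomial.eval z K = s * MvPolynomial.eval z f + ∑ i, z i ^ (2 * (M + 1)) := by
    intro z; simp [hK]
  have hnn : ∀ (z : σ → ℝ) i, 0 ≤ z i ^ (2 * (M + 1)) := fun z i => by
    rw [pow_mul]; positivity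
  have hmin : ∃ y, ∀ z, MvPolynomial.eval y K ≤ MvPolynomial.eval z K := by
    refine (MvPolynomial.continuous_eval K).exists_forall_le' 0 ?_
    set r := max 1 (MvPolynomial.eval 0 K)
    filter_upwards [(isCompact_closedBall (0 : σ → ℝ) r).compl_mem_cocompact] with z hz
    have hz' : r < ‖z‖ := by simpa using hz
    have h1r : 1 ≤ r := le_max_left _ _
    have : ∃ i, r < ‖z i‖ := by
      by_contra! hc
      exact absurd ((pi_norm_le_iff_of_nonneg (by linarith)).2 hc) (not_le.2 hz')
    obtain ⟨i, hi⟩ := this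
    have h2 : MvPolynomial.eval 0 K ≤ r := le_max_right _ _
    have h3 : z i ^ (2 * (M + 1)) ≤ ∑ i, z i ^ (2 * (M + 1)) :=
      Finset.single_le_sum (f := fun i => z i ^ (2 * (M + 1))) (fun i _ => hnn z i) (Finset.mem_univ i)
    have h4 : |z i| ≤ z i ^ (2 * (M + 1)) := by
      have : z i ^ (2 * (M + 1)) = |z i| ^ (2 * (M + 1)) := by
        rw [pow_mul, pow_mul, sq_abs]
      rw [this]
      rw [Real.norm_eq_abs] at hi
      exact le_self_pow₀ (by linarith) (by omega)
    rw [hKe z]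
    rw [Real.norm_eq_abs] at hi
    have := mul_pos hs (hf z)
    linarith
  obtain ⟨y, hy⟩ := hmin
  refine ⟨y, ?_, ?_⟩
  · intro i
    have hd := eval_deriv_line K y i
    have hloc : IsLocalMin (fun t : ℝ => MvPolynomial.eval (y + t • Pi.single i 1) K) 0 :=
      Filter.Eventually.of_forall fun t => by simpa using hy _
    have h0 := hloc.hasDerivAt_eq_zero hd
    rw [hK] at h0
    simp only [map_add, map_sum, Derivation.leibniz, Derivation.leibniz_pow, MvPolynomial.pderiv_X,
      MvPolynomial.pderiv_C] at h0
    rw [Finset.sum_eq_single i] at h0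
    · simp at h0
      have he : 2 * (M + 1) - 1 = 2 * M + 1 := by omega
      rw [he] at h0
      rw [← h0]
      ring
    · intro j _ hj
      simp [hj]
    · simp
  · intro z
    have h1 := hy z
    rw [hKe, hKe] at h1
    have : 0 ≤ ∑ i, y i ^ (2 * (M + 1)) := Finset.sum_nonneg fun i _ => hnn y i
    linarith

lemma alg_min {σ : Type} [Fintype σ] (F : MvPolynomial σ (Polynomial ℝ))
    (hpos : ∀ ε > 0, ∀ y, 0 < MvPolynomial.eval y (MvPolynomial.map (Polynomial.evalRingHom ε) F))
    (hmin : ∀ ε > 0, ∃ y0, ∀ y,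
      MvPolynomial.eval y0 (MvPolynomial.map (Polynomial.evalRingHom ε) F) ≤
      MvPolynomial.eval y (MvPolynomial.map (Polynomial.evalRingHom ε) F)) :
    ∃ c > 0, ∃ N : ℕ, ∃ δ > 0, ∀ ε, 0 < ε → ε ≤ δ → ∀ y,
      c * ε ^ N ≤ MvPolynomial.eval y (MvPolynomial.map (Polynomial.evalRingHom ε) F) := by
  obtain ⟨M, χ, hχ, hrel⟩ := ideal_rel F
  set χs := Polynomial.Bivariate.swap χ with hχs
  have hχs0 : χs ≠ 0 := by
    rw [hχs]
    exact (map_ne_zero_iff _ (Polynomial.Bivariate.swap (R := Polynomial ℝ)).injective).2 hχ.ne_zero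
  set D := χs.natDegree
  set B := χs.leadingCoeff with hBdef
  have hB : B ≠ 0 := Polynomial.leadingCoeff_ne_zero.2 hχs0
  obtain ⟨M0, hM0⟩ : ∃ M0 : ℝ, ∀ ε, 0 < ε → ε ≤ 1 →
      MvPolynomial.eval 0 (MvPolynomial.map (Polynomial.evalRingHom ε) F) ≤ M0 := by
    obtain ⟨K, hK⟩ := (isCompact_Icc (a := (0:ℝ)) (b := 1)).exists_bound_of_continuousOn
      (MvPolynomial.constantCoeff F).continuous.continuousOn
    refine ⟨K, fun ε h0 h1 => ?_⟩
    have := hK ε ⟨h0.le, h1⟩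
    rw [MvPolynomial.eval_zero, MvPolynomial.constantCoeff_map]
    exact (le_abs_self _).trans this
  obtain ⟨c, hc, N, δ, hδ, hbd⟩ := tendsto_bound B hB M0
  refine ⟨c, hc, N, min δ 1, by positivity, ?_⟩
  intro ε h0 h1 y
  obtain ⟨y0, hy0⟩ := hmin ε h0
  refine le_trans ?_ (hy0 y)
  set f := MvPolynomial.map (Polynomial.evalRingHom ε) F with hf
  set m := MvPolynomial.eval y0 f
  refine hbd ε h0 (h1.trans (min_le_left _ _)) m (hpos ε h0 y0)
    ((hy0 0).trans (hM0 ε h0 (h1.trans (min_le_right _ _)))) ?_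
  choose yk hcrit hle using fun k : ℕ => exists_crit f (hpos ε h0) M (k + 1) (by positivity)
  set T : ℕ → ℝ := fun k => MvPolynomial.eval (yk k) f with hT
  have hη : Filter.Tendsto (fun k : ℕ => (1:ℝ) / (k + 1)) Filter.atTop (nhds 0) :=
    tendsto_one_div_add_atTop_nhds_zero_nat
  have hTm : Filter.Tendsto T Filter.atTop (nhds m) := by
    set c0 := ∑ i, y0 i ^ (2 * (M + 1))
    have hup : Filter.Tendsto (fun k : ℕ => m + c0 * (1 / (k + 1))) Filter.atTop (nhds m) := by
      simpa using (hη.const_mul c0).const_add m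
    refine tendsto_of_tendsto_of_tendsto_of_le_of_le tendsto_const_nhds hup
      (fun k => hy0 _) (fun k => ?_)
    have := hle k y0
    have hk : (0:ℝ) < k + 1 := by positivity
    change T k ≤ _
    have h5 : T k * (k+1) ≤ m * (k+1) + c0 := this
    rw [mul_one_div]
    have h6 : m + c0 / (k+1) = (m * (k+1) + c0) / (k+1) := by field_simp
    rw [h6, le_div_iff₀ hk]
    exact h5
  have hzero : ∀ k : ℕ, ∑ j ∈ Finset.range (D + 1),
      (χs.coeff j).evalEval ε (T k) * ((1:ℝ) / (k + 1)) ^ (D - j) = 0 := by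
    intro k
    have h2 := hrel ε (k+1) (yk k) (hcrit k)
    rw [← triple_swap, Polynomial.eval₂_eq_sum_range] at h2
    have hk : (0:ℝ) < k + 1 := by positivity
    have h3 : ∀ j ∈ Finset.range (D + 1),
      (χs.coeff j).evalEval ε (T k) * ((1:ℝ) / (k + 1)) ^ (D - j) =
      (1 / (k+1)) ^ D * ((χs.coeff j).evalEval ε (T k) * ((k:ℝ) + 1) ^ j) := by
      intro j hj
      have hj' : j ≤ D := by simpa [Nat.lt_succ_iff] using hj
      obtain ⟨l, hl⟩ := Nat.exists_eq_add_of_le hj'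
      rw [hl, Nat.add_sub_cancel_left]
      have : ((1:ℝ) / (k + 1)) ^ (j + l) * ((k:ℝ)+1)^j = (1 / (k + 1)) ^ l := by
        rw [pow_add, mul_right_comm, ← mul_pow, one_div_mul_cancel hk.ne', one_pow, one_mul]
      rw [← this]; ring
    rw [Finset.sum_congr rfl h3, ← Finset.mul_sum]
    exact mul_eq_zero_of_right _ h2
  have hlim : Filter.Tendsto (fun k : ℕ => ∑ j ∈ Finset.range (D + 1),
      (χs.coeff j).evalEval ε (T k) * ((1:ℝ) / (k + 1)) ^ (D - j)) Filter.atTop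
      (nhds (∑ j ∈ Finset.range (D + 1), (χs.coeff j).evalEval ε m * (0:ℝ) ^ (D - j))) := by
    refine tendsto_finsetSum _ fun j _ => ?_
    refine Filter.Tendsto.mul ?_ (hη.pow _)
    have hcont : Continuous fun t => (χs.coeff j).evalEval ε t := by
      rw [← Polynomial.eval₂_evalRingHom]
      exact Polynomial.continuous_eval₂ _ _
    exact (hcont.tendsto m).comp hTm
  simp only [hzero] at hlim
  have h7 := tendsto_nhds_unique hlim tendsto_const_nhds
  rw [Finset.sum_range_succ, Finset.sum_eq_zero] at h7
  · have h8 : (χs.coeff D).evalEval ε m = 0 := by simpa using h7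
    exact h8
  · intro j hj
    have : D - j ≠ 0 := by have := Finset.mem_range.1 hj; omega
    simp [this]


lemma eval_bind {σ τ : Type} (y : τ → ℝ) (q : σ → MvPolynomial τ ℝ) (f : MvPolynomial σ ℝ) :
    MvPolynomial.eval y (MvPolynomial.bind₁ q f) =
      MvPolynomial.eval (fun i => MvPolynomial.eval y (q i)) f :=
  MvPolynomial.eval₂Hom_bind₁ _ _ _ _

lemma evalPoly_cont {m : ℕ} (p : MvPolynomial (Fin m) ℝ) : Continuous fun x : E m => evalPoly p x := by
  unfold evalPoly
  exact (MvPolynomial.continuous_eval p).comp (by fun_prop)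

lemma loj_alg {σ : Type} [Fintype σ] (A B : MvPolynomial σ ℝ)
    (hAB : ∀ y : σ → ℝ, ∑ i, y i ^ 2 = 1 → MvPolynomial.eval y A = 0 → MvPolynomial.eval y B = 0) :
    ∃ c > 0, ∃ N : ℕ, ∃ δ > 0, ∀ y : σ → ℝ, ∑ i, y i ^ 2 = 1 → 0 < MvPolynomial.eval y B →
      MvPolynomial.eval y B ≤ δ → c * MvPolynomial.eval y B ^ N ≤ MvPolynomial.eval y A ^ 2 := by
  classical
  set F : MvPolynomial σ (Polynomial ℝ) := MvPolynomial.map Polynomial.C A ^ 2 +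
    (MvPolynomial.map Polynomial.C B - MvPolynomial.C Polynomial.X) ^ 2 +
    (∑ i, MvPolynomial.X i ^ 2 - 1) ^ 2 with hF
  have hev : ∀ ε y, MvPolynomial.eval y (MvPolynomial.map (Polynomial.evalRingHom ε) F) =
      MvPolynomial.eval y A ^ 2 + (MvPolynomial.eval y B - ε) ^ 2 + (∑ i, y i ^ 2 - 1) ^ 2 := by
    intro ε y
    have hcomp : (Polynomial.evalRingHom ε).comp Polynomial.C = RingHom.id ℝ := by
      ext; simp
    simp only [hF, map_add, map_pow, map_sub, MvPolynomial.map_map, hcomp, MvPolynomial.map_id,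
      MvPolynomial.map_C, MvPolynomial.eval_C, map_sum, MvPolynomial.map_X, MvPolynomial.eval_X, map_one]
    simp
  obtain ⟨c, hc, N, δ, hδ, h⟩ := alg_min F (by
      intro ε hε y
      rw [hev]
      by_contra hcon
      have h1 := sq_nonneg (MvPolynomial.eval y A)
      have h2 := sq_nonneg (MvPolynomial.eval y B - ε)
      have h3 := sq_nonneg (∑ i, y i ^ 2 - 1)
      have e1 : MvPolynomial.eval y A ^ 2 = 0 := by linarith
      have e2 : (MvPolynomial.eval y B - ε) ^ 2 = 0 := by linarith
      have e3 : (∑ i, y i ^ 2 - 1) ^ 2 = 0 := by linarith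
      have e1' := pow_eq_zero_iff (two_ne_zero) |>.1 e1
      have e2' := pow_eq_zero_iff (two_ne_zero) |>.1 e2
      have e3' := pow_eq_zero_iff (two_ne_zero) |>.1 e3
      have := hAB y (by linarith) e1'
      linarith) (by
      intro ε hε
      refine (MvPolynomial.continuous_eval _).exists_forall_le' 0 ?_
      set k := MvPolynomial.eval 0 (MvPolynomial.map (Polynomial.evalRingHom ε) F)
      filter_upwards [(isCompact_closedBall (0 : σ → ℝ) (2 + |k|)).compl_mem_cocompact] with z hz
      have hz' : 2 + |k| < ‖z‖ := by simpa using hz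
      have hk := abs_nonneg k
      have : ∃ i, 2 + |k| < ‖z i‖ := by
        by_contra! hc
        exact absurd ((pi_norm_le_iff_of_nonneg (by linarith)).2 hc) (not_le.2 hz')
      obtain ⟨i, hi⟩ := this
      have h3 : z i ^ 2 ≤ ∑ i, z i ^ 2 :=
        Finset.single_le_sum (f := fun i => z i ^ 2) (fun i _ => sq_nonneg _) (Finset.mem_univ i)
      rw [hev]
      rw [Real.norm_eq_abs] at hi
      have h4 : (2 + |k|) ^ 2 ≤ z i ^ 2 := by rw [← sq_abs (z i)]; gcongr
      have h5 : 1 + |k| ≤ ∑ i, z i ^ 2 - 1 := by nlinarith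
      have h6 : (1 + |k|) ^ 2 ≤ (∑ i, z i ^ 2 - 1) ^ 2 := by gcongr
      have := le_abs_self k
      nlinarith [sq_nonneg (MvPolynomial.eval z A), sq_nonneg (MvPolynomial.eval z B - ε)])
  refine ⟨c, hc, N, δ, hδ, fun y hy h0 h1 => ?_⟩
  have := h _ h0 h1 y
  rw [hev, hy] at this
  simpa using this

lemma loj {m : ℕ} (V : Finset (E m)) (p g : MvPolynomial (Fin m) ℝ)
    (hg : ∀ x, 0 ≤ evalPoly g x)
    (hp : ∀ x ∈ convexHull ℝ (V : Set (E m)), 0 ≤ evalPoly p x)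
    (h0 : ∀ x ∈ convexHull ℝ (V : Set (E m)), evalPoly p x = 0 → evalPoly g x = 0) (K : ℕ) :
    ∃ c > 0, ∃ N ≥ K, ∀ x ∈ convexHull ℝ (V : Set (E m)), c * evalPoly g x ^ N ≤ evalPoly p x := by
  classical
  set Q := convexHull ℝ (V : Set (E m)) with hQ
  set xp : Fin m → MvPolynomial V ℝ := fun j => ∑ v : V, MvPolynomial.C (v.1 j) * MvPolynomial.X v ^ 2
  have hev : ∀ (f : MvPolynomial (Fin m) ℝ) (y : V → ℝ),
      MvPolynomial.eval y (MvPolynomial.bind₁ xp f) = evalPoly f (∑ v : V, y v ^ 2 • v.1) := by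
    intro f y
    unfold evalPoly
    rw [eval_bind]
    congr 2
    ext j
    simp [xp, mul_comm]
  have hmem : ∀ y : V → ℝ, ∑ v, y v ^ 2 = 1 → (∑ v : V, y v ^ 2 • v.1) ∈ Q := by
    intro y hy
    refine (convex_convexHull ℝ _).sum_mem (fun i _ => sq_nonneg _) hy fun v _ => ?_
    exact subset_convexHull ℝ _ v.2
  have hsurj : ∀ x ∈ Q, ∃ y : V → ℝ, ∑ v, y v ^ 2 = 1 ∧ ∑ v : V, y v ^ 2 • v.1 = x := by
    intro x hx
    rw [hQ, Finset.mem_convexHull'] at hx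
    obtain ⟨w, hw0, hw1, hwx⟩ := hx
    refine ⟨fun v => √(w v.1), ?_, ?_⟩
    · rw [← hw1, ← Finset.sum_coe_sort V]
      exact Finset.sum_congr rfl fun v _ => Real.sq_sqrt (hw0 _ v.2)
    · rw [← hwx, ← Finset.sum_coe_sort V]
      exact Finset.sum_congr rfl fun v _ => by rw [Real.sq_sqrt (hw0 _ v.2)]
  obtain ⟨c, hc, N, δ, hδ, h⟩ := loj_alg (MvPolynomial.bind₁ xp p) (MvPolynomial.bind₁ xp g) (by
    intro y hy hA
    rw [hev] at hA ⊢
    exact h0 _ (hmem y hy) hA)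
  have hcomp : IsCompact Q := V.finite_toSet.isCompact_convexHull (𝕜 := ℝ)
  obtain ⟨G, hG⟩ := hcomp.exists_bound_of_continuousOn (evalPoly_cont g).continuousOn
  set δ' := min δ 1 with hδ'
  have hδ'0 : 0 < δ' := by positivity
  have hcomp2 : IsCompact (Q ∩ {x | δ' ≤ evalPoly g x}) :=
    hcomp.inter_right (isClosed_le continuous_const (evalPoly_cont g))
  obtain ⟨a, ha, hap⟩ : ∃ a > 0, ∀ x ∈ Q ∩ {x | δ' ≤ evalPoly g x}, a ≤ evalPoly p x := by
    rcases (Q ∩ {x | δ' ≤ evalPoly g x}).eq_empty_or_nonempty with he | hne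
    · exact ⟨1, one_pos, by simp [he]⟩
    · obtain ⟨x0, hx0, hmin⟩ := hcomp2.exists_isMinOn hne (evalPoly_cont p).continuousOn
      refine ⟨evalPoly p x0, ?_, fun x hx => hmin hx⟩
      refine lt_of_le_of_ne (hp _ hx0.1) fun hz => ?_
      have h1 := h0 _ hx0.1 hz.symm
      have h2 : δ' ≤ evalPoly g x0 := hx0.2
      linarith
  set N' := N + K + 1 with hN'
  refine ⟨min (√c) (a / (|G| + 1) ^ N'), by positivity, N', by omega, ?_⟩
  intro x hx
  have hgx := hg x
  by_cases hcase : δ' ≤ evalPoly g x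
  · have h1 := hap x ⟨hx, hcase⟩
    have h2 : evalPoly g x ≤ |G| + 1 := by
      have := (le_abs_self _).trans (hG x hx)
      linarith [le_abs_self G]
    calc _ ≤ a / (|G| + 1) ^ N' * (|G| + 1) ^ N' := by
            gcongr
            exact min_le_right _ _
      _ = a := by field_simp
      _ ≤ _ := h1
  · push Not at hcase
    rcases hgx.eq_or_lt with hz | hpos
    · rw [← hz]
      simpa [hN'] using hp x hx
    · obtain ⟨y, hy1, hyx⟩ := hsurj x hx
      have h1 := h y hy1 (by rw [hev, hyx]; exact hpos)
        (by rw [hev, hyx]; exact hcase.le.trans (min_le_left _ _))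
      rw [hev, hev, hyx] at h1
      have hle1 : evalPoly g x ≤ 1 := hcase.le.trans (min_le_right _ _)
      have h2 : (√c * evalPoly g x ^ N') ^ 2 ≤ evalPoly p x ^ 2 := by
        refine le_trans ?_ h1
        rw [mul_pow, Real.sq_sqrt hc.le, ← pow_mul]
        exact mul_le_mul_of_nonneg_left (pow_le_pow_of_le_one hgx hle1 (by omega)) hc.le
      have h3 : √c * evalPoly g x ^ N' ≤ evalPoly p x :=
        (pow_le_pow_iff_left₀ (by positivity) (hp x hx) two_ne_zero).1 h2
      refine le_trans ?_ h3
      gcongr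
      exact min_le_left _ _


lemma poly_slice {k : ℕ} (Λ : Submodule ℝ (E k)) (Q : Set (E k))
    (hQ : Q = {u : E k | u ∈ Λ ∧ (∀ i, 0 ≤ u i) ∧ ∑ i, u i = 1}) (hne : Q.Nonempty) :
    IsPolytope Q := by
  classical
  have hconv : Convex ℝ Q := by
    rw [hQ]
    rintro u ⟨hu1, hu2, hu3⟩ w ⟨hw1, hw2, hw3⟩ s t hs ht hst
    refine ⟨Λ.add_mem (Λ.smul_mem _ hu1) (Λ.smul_mem _ hw1), fun i => ?_, ?_⟩
    · have := hu2 i; have := hw2 i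
      simp only [PiLp.add_apply, PiLp.smul_apply, smul_eq_mul]
      positivity
    · simp only [PiLp.add_apply, PiLp.smul_apply, smul_eq_mul, Finset.sum_add_distrib,
        ← Finset.mul_sum, hu3, hw3]
      linarith
  have hclosed : IsClosed Q := by
    rw [hQ]
    have e : {u : E k | u ∈ Λ ∧ (∀ i, 0 ≤ u i) ∧ ∑ i, u i = 1} =
        (Λ : Set (E k)) ∩ ((⋂ i, {u : E k | 0 ≤ u i}) ∩ {u : E k | ∑ i, u i = 1}) := by
      ext u; simp
    rw [e]
    refine (Submodule.closed_of_finiteDimensional Λ).inter (IsClosed.inter ?_ ?_)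
    · exact isClosed_iInter fun i => isClosed_le continuous_const (by fun_prop)
    · exact isClosed_eq (by fun_prop) continuous_const
  have hbd : Bornology.IsBounded Q := by
    rw [isBounded_iff_forall_norm_le]
    refine ⟨1, fun u hu => ?_⟩
    rw [hQ] at hu
    obtain ⟨-, h2, h3⟩ := hu
    rw [EuclideanSpace.norm_eq, Real.sqrt_le_one]
    calc ∑ i, ‖u i‖ ^ 2 ≤ ∑ i, u i := by
          refine Finset.sum_le_sum fun i _ => ?_
          have h4 : u i ≤ 1 := by
            rw [← h3]; exact Finset.single_le_sum (f := fun i => u i) (fun i _ => h2 i) (Finset.mem_univ i)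
          rw [Real.norm_eq_abs, sq_abs]
          nlinarith [h2 i]
      _ = 1 := h3
  have hcomp : IsCompact Q := Metric.isCompact_of_isClosed_isBounded hclosed hbd
  have hfin : (Q.extremePoints ℝ).Finite := by
    refine Set.Finite.of_finite_image (f := fun u : E k => {i | u i = 0}) (Set.toFinite _) ?_
    intro u hu w hw huw
    have huQ : u ∈ Q := hu.1
    have hwQ : w ∈ Q := hw.1
    have huQ' := huQ
    have hwQ' := hwQ
    rw [hQ] at huQ' hwQ'
    obtain ⟨hu1, hu2, hu3⟩ := huQ'
    obtain ⟨hw1, hw2, hw3⟩ := hwQ'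
    have hz : ∀ i, u i = 0 ↔ w i = 0 := fun i => by
      have := congrArg (fun s => i ∈ s) huw
      simpa using this
    obtain ⟨t, ht, htb⟩ : ∃ t > 0, ∀ i, t * w i ≤ u i := by
      have : ∀ i : Fin k, ∃ t > 0, ∀ t' ≤ t, t' * w i ≤ u i := by
        intro i
        rcases (hw2 i).eq_or_lt with h | h
        · refine ⟨1, one_pos, fun t' _ => ?_⟩
          rw [← h, mul_zero]; exact hu2 i
        · have hu : 0 < u i := lt_of_le_of_ne (hu2 i) fun h' => h.ne' ((hz i).1 h'.symm)
          refine ⟨u i / w i, by positivity, fun t' ht' => ?_⟩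
          calc t' * w i ≤ u i / w i * w i := by gcongr
            _ = u i := by field_simp
      choose τ hτ hτ' using this
      obtain ⟨t, ht, htb⟩ : ∃ t > 0, ∀ i, t ≤ τ i := by
        rcases isEmpty_or_nonempty (Fin k) with he | he
        · exact ⟨1, one_pos, fun i => he.elim i⟩
        · obtain ⟨i0, hi0⟩ := Finite.exists_min τ
          exact ⟨τ i0, hτ i0, hi0⟩
      exact ⟨t, ht, fun i => hτ' i t (htb i)⟩
    -- the point beyond u
    set z : E k := u + t • (u - w) with hzdef
    have hzQ : z ∈ Q := by
      rw [hQ]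
      refine ⟨Λ.add_mem hu1 (Λ.smul_mem _ (Λ.sub_mem hu1 hw1)), fun i => ?_, ?_⟩
      · simp only [hzdef, PiLp.add_apply, PiLp.smul_apply, PiLp.sub_apply, smul_eq_mul]
        have := htb i
        have := mul_nonneg ht.le (hu2 i)
        linarith
      · simp only [hzdef, PiLp.add_apply, PiLp.smul_apply, PiLp.sub_apply, smul_eq_mul,
          Finset.sum_add_distrib, ← Finset.mul_sum, Finset.sum_sub_distrib, hu3, hw3]
        ring
    have hseg : u ∈ openSegment ℝ w z := by
      refine ⟨t / (1 + t), 1 / (1 + t), by positivity, by positivity, by field_simp; ring, ?_⟩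
      have h1t : (1 + t) ≠ 0 := by positivity
      rw [hzdef]
      ext i
      simp only [PiLp.add_apply, PiLp.smul_apply, PiLp.sub_apply, smul_eq_mul]
      field_simp
      ring
    exact (mem_extremePoints_iff_left.1 hu |>.2 w hwQ z hzQ hseg).symm
  refine ⟨hfin.toFinset, ?_, ?_⟩
  · rw [Set.Finite.toFinset_nonempty]
    exact hcomp.extremePoints_nonempty hne
  · rw [Set.Finite.coe_toFinset, ← (hfin.isClosed_convexHull ℝ).closure_eq,
      closure_convexHull_extremePoints hcomp hconv]

lemma clear_den {k d : ℕ} (p : MvPolynomial (Fin k) ℝ) (Φ : Fin k → MvPolynomial (Fin d) ℝ)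
    (ℓ : MvPolynomial (Fin d) ℝ) (D : ℕ) (hD : p.totalDegree < D) :
    ∃ f : MvPolynomial (Fin d) ℝ, ∀ x : Fin d → ℝ,
      (MvPolynomial.eval x ℓ = 0 → MvPolynomial.eval x f = 0) ∧
      (MvPolynomial.eval x ℓ ≠ 0 → MvPolynomial.eval x f = MvPolynomial.eval x ℓ ^ D *
        MvPolynomial.eval (fun j => (MvPolynomial.eval x ℓ)⁻¹ * MvPolynomial.eval x (Φ j)) p) := by
  refine ⟨∑ a ∈ p.support, MvPolynomial.C (p.coeff a) * (ℓ ^ (D - a.degree) * ∏ j, Φ j ^ a j),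
    fun x => ⟨fun h => ?_, fun h => ?_⟩⟩
  · simp only [map_sum, map_mul, map_pow, h, MvPolynomial.eval_C, map_prod]
    refine Finset.sum_eq_zero fun a ha => ?_
    have : a.degree ≤ p.totalDegree := MvPolynomial.le_totalDegree ha
    rw [zero_pow (by omega)]
    ring
  · simp only [map_sum, map_mul, map_pow, MvPolynomial.eval_C, map_prod]
    rw [MvPolynomial.eval_eq' _ p, Finset.mul_sum]
    refine Finset.sum_congr rfl fun a ha => ?_
    have h1 : a.degree ≤ p.totalDegree := MvPolynomial.le_totalDegree ha
    simp only [mul_pow, Finset.prod_mul_distrib, Finset.prod_pow_eq_pow_sum]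
    rw [← Finsupp.degree_eq_sum]
    obtain ⟨r, hr⟩ := Nat.exists_eq_add_of_le (h1.trans hD.le)
    rw [hr, Nat.add_sub_cancel_left]
    have : MvPolynomial.eval x ℓ ^ (a.degree + r) * (MvPolynomial.eval x ℓ)⁻¹ ^ a.degree =
        MvPolynomial.eval x ℓ ^ r := by
      rw [pow_add, mul_right_comm, ← mul_pow, mul_inv_cancel₀ h, one_pow, one_mul]
    rw [← this]; ring

lemma mem_aff_of_span {k : ℕ} (Q : Set (E k)) (σ : E k →ₗ[ℝ] ℝ) (hσ : ∀ q ∈ Q, σ q = 1)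
    (hne : Q.Nonempty) (u : E k) (hu : u ∈ Submodule.span ℝ Q) (h1 : σ u = 1) :
    u ∈ affineSpan ℝ Q := by
  obtain ⟨q0, hq0⟩ := hne
  have hq0' := subset_affineSpan ℝ Q hq0
  have key : ∀ w ∈ Submodule.span ℝ Q, w - σ w • q0 ∈ (affineSpan ℝ Q).direction := by
    intro w hw
    induction hw using Submodule.span_induction with
    | mem x hx =>
      rw [hσ x hx, one_smul]
      exact AffineSubspace.vsub_mem_direction (subset_affineSpan ℝ Q hx) hq0'
    | zero => simp
    | add x y _ _ hx hy =>
      have := Submodule.add_mem _ hx hy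
      convert this using 1
      rw [map_add]; module
    | smul c x _ hx =>
      have := Submodule.smul_mem _ c hx
      convert this using 1
      rw [map_smul, smul_eq_mul]; module
  have := AffineSubspace.vadd_mem_of_mem_direction (key u hu) hq0'
  rw [h1, one_smul] at this
  simpa using this


lemma core_s15 {d k : ℕ} (hd : 2 ≤ d)
    (H : ∀ (m n : ℕ) (Q : Set (E m)), IsPolytope Q → dimS Q = n →
      ∃ p : Fin n → MvPolynomial (Fin m) ℝ,
        Q = {x ∈ (affineSpan ℝ Q : Set (E m)) | ∀ i, 0 ≤ evalPoly (p i) x} ∧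
        ∀ hn : 0 < n, ∀ x ∈ Q, ¬ IsVertexOf Q x → 0 < evalPoly (p ⟨0, hn⟩) x)
    (P : Set (E d)) (hne : P.Nonempty) (hdim : dimS P = d)
    (a : Fin k → E d) (b : Fin k → ℝ) (l : Fin k) (hal : a l = 0) (hbl : b l = 1)
    (hP : P = {x : E d | ∀ i, ⟪a i, x⟫ ≤ b i}) :
    ∃ f : Fin d → MvPolynomial (Fin d) ℝ,
        P = {x : E d | ∀ i, 0 ≤ evalPoly (f i) x} := by
  classical
  -- the homogenized slack map
  let Ψ : (E d × ℝ) →ₗ[ℝ] E k :=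
    { toFun := fun z => WithLp.toLp 2 fun j => z.2 * b j - ⟪a j, z.1⟫
      map_add' := by
        intro z w; ext j
        simp only [Prod.snd_add, Prod.fst_add, inner_add_right, PiLp.add_apply]; ring
      map_smul' := by
        intro c z; ext j
        simp only [Prod.smul_snd, Prod.smul_fst, inner_smul_right, PiLp.smul_apply, smul_eq_mul,
          RingHom.id_apply]; ring }
  have hΨ : ∀ x t j, Ψ (x, t) j = t * b j - ⟪a j, x⟫ := fun x t j => rfl
  let σ : E k →ₗ[ℝ] ℝ :=
    { toFun := fun u => ∑ j, u j
      map_add' := by intro u w; simp [Finset.sum_add_distrib]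
      map_smul' := by intro c u; simp [Finset.mul_sum] }
  have hσ : ∀ u, σ u = ∑ j, u j := fun u => rfl
  let Φ : Fin k → MvPolynomial (Fin d) ℝ := fun j =>
    MvPolynomial.C (b j) - ∑ i, MvPolynomial.C (a j i) * MvPolynomial.X i
  let ℓ : MvPolynomial (Fin d) ℝ := ∑ j, Φ j
  have hΦ : ∀ (x : E d) j, evalPoly (Φ j) x = Ψ (x, 1) j := by
    intro x j
    rw [hΨ, one_mul]
    simp only [Φ, evalPoly, map_sub, map_sum, map_mul, MvPolynomial.eval_C, MvPolynomial.eval_X,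
      PiLp.inner_apply]
    congr 1
    refine Finset.sum_congr rfl fun i _ => ?_
    simp [mul_comm]
  have hℓ : ∀ x : E d, evalPoly ℓ x = σ (Ψ (x, 1)) := by
    intro x
    rw [hσ]
    simp only [← hΦ]
    simp [ℓ, evalPoly]
  have hΨl : ∀ x : E d, Ψ (x, 1) l = 1 := by
    intro x; rw [hΨ, hal, hbl]; simp
  have hPm : ∀ x : E d, x ∈ P ↔ ∀ j, 0 ≤ Ψ (x, 1) j := by
    intro x
    rw [hP]
    simp [hΨ]
  obtain ⟨Q, hQ⟩ : ∃ Q : Set (E k),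
    Q = {u : E k | u ∈ LinearMap.range Ψ ∧ (∀ i, 0 ≤ u i) ∧ ∑ i, u i = 1} := ⟨_, rfl⟩
  have hℓP : ∀ x ∈ P, 1 ≤ evalPoly ℓ x := by
    intro x hx
    rw [hℓ, hσ]
    refine (hΨl x).ge.trans ?_
    exact Finset.single_le_sum (f := fun j => Ψ (x, 1) j) (fun j _ => (hPm x).1 hx j)
      (Finset.mem_univ l)
  let u : E d → E k := fun x => (evalPoly ℓ x)⁻¹ • Ψ (x, 1)
  have huQ : ∀ x ∈ P, u x ∈ Q := by
    intro x hx
    have h1 := hℓP x hx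
    rw [hQ]
    refine ⟨Submodule.smul_mem _ _ ⟨_, rfl⟩, fun i => ?_, ?_⟩
    · have := (hPm x).1 hx i
      simp only [u, PiLp.smul_apply, smul_eq_mul]
      positivity
    · rw [← hσ]
      simp only [u, map_smul, ← hℓ, smul_eq_mul]
      exact inv_mul_cancel₀ (by linarith)
  have hQP : ∀ x, evalPoly ℓ x ≠ 0 → u x ∈ Q → x ∈ P := by
    intro x h0 hx
    rw [hQ] at hx
    obtain ⟨-, h2, -⟩ := hx
    have h3 : ∀ j, 0 ≤ (evalPoly ℓ x)⁻¹ * Ψ (x, 1) j := h2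
    have h4 := h3 l
    rw [hΨl, mul_one] at h4
    have h5 : 0 < (evalPoly ℓ x)⁻¹ := lt_of_le_of_ne h4 (inv_ne_zero h0).symm
    exact (hPm x).2 fun j => nonneg_of_mul_nonneg_right (h3 j) h5
  have hQne : Q.Nonempty := hne.imp' u huQ
  have hQσ : ∀ q ∈ Q, σ q = 1 := by
    intro q hq; rw [hQ] at hq; exact hq.2.2
  have haffP : affineSpan ℝ P = ⊤ := by
    rw [← AffineSubspace.direction_eq_top_iff_of_nonempty ((affineSpan_nonempty ℝ).2 hne)]
    apply Submodule.eq_top_of_finrank_eq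
    rw [finrank_euclideanSpace_fin]
    exact hdim
  have hspan : ∀ x : E d, Ψ (x, 1) ∈ Submodule.span ℝ Q := by
    intro x
    have hx : x ∈ affineSpan ℝ P := by rw [haffP]; trivial
    refine affineSpan_induction hx ?_ ?_
    · intro y hy
      have h1 := hℓP y hy
      have : Ψ (y, 1) = evalPoly ℓ y • u y := by
        simp only [u, smul_smul]
        rw [mul_inv_cancel₀ (by linarith), one_smul]
      rw [this]
      exact Submodule.smul_mem _ _ (Submodule.subset_span (huQ y hy))
    · intro c y z w hy hz hw
      have : Ψ (c • (y -ᵥ z) +ᵥ w, 1) = c • (Ψ (y, 1) - Ψ (z, 1)) + Ψ (w, 1) := by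
        rw [← map_sub, ← map_smul, ← map_add]
        congr 1
        ext <;> simp
      rw [this]
      exact Submodule.add_mem _ (Submodule.smul_mem _ _ (Submodule.sub_mem _ hy hz)) hw
  have haff : ∀ x : E d, evalPoly ℓ x ≠ 0 → u x ∈ affineSpan ℝ Q := by
    intro x hx
    refine mem_aff_of_span Q σ hQσ hQne _ (Submodule.smul_mem _ _ (hspan x)) ?_
    rw [map_smul, ← hℓ, smul_eq_mul, inv_mul_cancel₀ hx]
  have hdimQ : dimS Q ≤ d := by
    have hle : (affineSpan ℝ Q).direction ≤ (LinearMap.ker (σ ∘ₗ Ψ)).map Ψ := by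
      rw [direction_affineSpan, vectorSpan_def, Submodule.span_le]
      rintro _ ⟨q, hq, r, hr, rfl⟩
      have hq1 := hQσ q hq
      have hr1 := hQσ r hr
      rw [hQ] at hq hr
      obtain ⟨⟨y, rfl⟩, -⟩ := hq
      obtain ⟨⟨z, rfl⟩, -⟩ := hr
      refine ⟨y - z, ?_, by simp⟩
      simp [hq1, hr1]
    have h1 := Submodule.finrank_mono hle
    have h2 := Submodule.finrank_map_le Ψ (LinearMap.ker (σ ∘ₗ Ψ))
    have h3 := LinearMap.finrank_range_add_finrank_ker (σ ∘ₗ Ψ)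
    have h4 : 0 < Module.finrank ℝ (LinearMap.range (σ ∘ₗ Ψ)) := by
      rw [Module.finrank_pos_iff]
      obtain ⟨x, hx⟩ := hne
      refine ⟨⟨0, ⟨σ (Ψ (x, 1)), ⟨(x, 1), rfl⟩⟩, fun h => ?_⟩⟩
      have h5 := hℓP x hx
      have h6 := congrArg Subtype.val h
      simp only [ZeroMemClass.coe_zero] at h6
      rw [hℓ, ← h6] at h5
      linarith
    have h5 : Module.finrank ℝ (E d × ℝ) = d + 1 := by
      rw [Module.finrank_prod, finrank_euclideanSpace_fin, Module.finrank_self]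
    unfold dimS
    omega
  have hpoly : IsPolytope Q := poly_slice _ Q hQ hQne
  obtain ⟨p, hp1, hp2⟩ := H k (dimS Q) Q hpoly rfl
  have hpQ : ∀ q ∈ Q, ∀ i, 0 ≤ evalPoly (p i) q := by
    intro q hq i
    rw [hp1] at hq
    exact hq.2 i
  have hux : ∀ x : E d, ∀ r : MvPolynomial (Fin k) ℝ,
      MvPolynomial.eval (fun j => (MvPolynomial.eval (fun i => x i) ℓ)⁻¹ *
        MvPolynomial.eval (fun i => x i) (Φ j)) r = evalPoly r (u x) := by
    intro x r
    have : (fun j => (MvPolynomial.eval (fun i => x i) ℓ)⁻¹ *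
        MvPolynomial.eval (fun i => x i) (Φ j)) = fun j => u x j := by
      funext j
      have := hΦ x j
      simp only [evalPoly] at this
      simp only [u, PiLp.smul_apply, smul_eq_mul, evalPoly, this]
    rw [this]; rfl
  -- cleared polynomials
  have hclear : ∀ i, ∃ f : MvPolynomial (Fin d) ℝ, ∃ D : ℕ, Even D ∧ ∀ x : E d,
      evalPoly ℓ x ≠ 0 → evalPoly f x = evalPoly ℓ x ^ D * evalPoly (p i) (u x) := by
    intro i
    obtain ⟨f, hf⟩ := clear_den (p i) Φ ℓ (2 * ((p i).totalDegree + 1)) (by omega)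
    refine ⟨f, _, even_two_mul ((p i).totalDegree + 1), fun x hx => ?_⟩
    have := (hf fun i => x i).2 hx
    rw [hux] at this
    exact this
  choose F D hDe hF using hclear
  have hFnn : ∀ i x, evalPoly ℓ x ≠ 0 → (0 ≤ evalPoly (F i) x ↔ 0 ≤ evalPoly (p i) (u x)) := by
    intro i x hx
    rw [hF i x hx]
    have : 0 < evalPoly ℓ x ^ D i := (hDe i).pow_pos hx
    exact mul_nonneg_iff_of_pos_left this
  have hback : ∀ x, evalPoly ℓ x ≠ 0 → (∀ i, 0 ≤ evalPoly (p i) (u x)) → x ∈ P := by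
    intro x hx h
    apply hQP x hx
    rw [hp1]
    exact ⟨haff x hx, h⟩
  rcases hdimQ.lt_or_eq with hlt | heq
  · refine ⟨fun i => if h : (i : ℕ) < dimS Q then F ⟨i, h⟩ else ℓ - 1, ?_⟩
    ext x
    constructor
    · intro hx i
      have h1 := hℓP x hx
      by_cases h : (i : ℕ) < dimS Q
      · simp only [h, dite_true]
        exact (hFnn _ x (by linarith)).2 (hpQ _ (huQ x hx) _)
      · simp only [h, dite_false]
        simp only [evalPoly, map_sub, map_one] at h1 ⊢
        linarith
    · intro hx
      have h1 := hx ⟨dimS Q, hlt⟩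
      simp only [lt_irrefl, dite_false] at h1
      have h2 : evalPoly ℓ x ≠ 0 := by
        intro h
        simp only [evalPoly, map_sub, map_one] at h1 h
        linarith
      refine hback x h2 fun i => ?_
      have h3 := hx ⟨i, i.2.trans hlt⟩
      simp only [i.2, dite_true] at h3
      exact (hFnn i x h2).1 h3
  · have hn : 0 < dimS Q := by omega
    obtain ⟨V, hVne, hV⟩ := hpoly
    have hVc : 0 < V.card := hVne.card_pos
    let g : MvPolynomial (Fin k) ℝ :=
      ∏ v ∈ V, ∑ j, (MvPolynomial.X j - MvPolynomial.C (v j)) ^ 2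
    have hg : ∀ y : E k, evalPoly g y = ∏ v ∈ V, ∑ j, (y j - v j) ^ 2 := by
      intro y; simp [g, evalPoly]
    have hg0 : ∀ y : E k, 0 ≤ evalPoly g y := by
      intro y; rw [hg]; positivity
    obtain ⟨c, hc, N, hN, hcN⟩ := loj V (p ⟨0, hn⟩) g hg0
      (fun y hy => hpQ y (hV ▸ hy) _)
      (by
        intro y hy h0
        rw [← hV] at hy
        have hv : IsVertexOf Q y := by
          by_contra hcon
          exact (hp2 hn y hy hcon).ne' h0
        have hext : y ∈ Q.extremePoints ℝ := isExtreme_singleton.1 (IsExposed.isExtreme hv)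
        rw [hV] at hext
        have hyV : y ∈ V := extremePoints_convexHull_subset hext
        rw [hg]
        exact Finset.prod_eq_zero hyV (by simp))
      ((p ⟨0, hn⟩).totalDegree + 1)
    obtain ⟨f, hf⟩ := clear_den (p ⟨0, hn⟩) Φ ℓ (2 * V.card * N) (by
      have : N ≤ 2 * V.card * N := Nat.le_mul_of_pos_left _ (by omega)
      omega)
    let G : MvPolynomial (Fin d) ℝ :=
      ∏ v ∈ V, ∑ j, (Φ j - ℓ * MvPolynomial.C (v j)) ^ 2
    have hG : ∀ x : E d, evalPoly G x =
        ∏ v ∈ V, ∑ j, (Ψ (x, 1) j - evalPoly ℓ x * v j) ^ 2 := by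
      intro x
      simp only [← hΦ]
      simp [G, evalPoly]
    have hGg : ∀ x : E d, evalPoly ℓ x ≠ 0 →
        evalPoly G x ^ N = evalPoly ℓ x ^ (2 * V.card * N) * evalPoly g (u x) ^ N := by
      intro x hx
      rw [pow_mul, ← mul_pow]
      congr 1
      rw [hG, hg, pow_mul, ← Finset.prod_const, ← Finset.prod_mul_distrib]
      refine Finset.prod_congr rfl fun v _ => ?_
      rw [Finset.mul_sum]
      refine Finset.sum_congr rfl fun j _ => ?_
      simp only [u, PiLp.smul_apply, smul_eq_mul]
      field_simp
    let f0 : MvPolynomial (Fin d) ℝ := f - MvPolynomial.C c * G ^ N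
    have hf0 : ∀ x, evalPoly f0 x = evalPoly f x - c * evalPoly G x ^ N := by
      intro x; simp [f0, evalPoly]
    have hf0n : ∀ x, evalPoly ℓ x ≠ 0 → evalPoly f0 x = evalPoly ℓ x ^ (2 * V.card * N) *
        (evalPoly (p ⟨0, hn⟩) (u x) - c * evalPoly g (u x) ^ N) := by
      intro x hx
      have := (hf fun i => x i).2 hx
      rw [hux] at this
      rw [hf0, hGg x hx]
      change evalPoly f x = evalPoly ℓ x ^ (2 * V.card * N) * _ at this
      rw [this]; ring
    have hf0z : ∀ x, evalPoly ℓ x = 0 → evalPoly f0 x < 0 := by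
      intro x hx
      have : evalPoly f x = 0 := (hf fun i => x i).1 hx
      rw [hf0, this, hG, hx]
      have h1 : 0 < ∏ v ∈ V, ∑ j, (Ψ (x, 1) j - 0 * v j) ^ 2 := by
        refine Finset.prod_pos fun v _ => ?_
        refine Finset.sum_pos' (fun j _ => sq_nonneg _) ⟨l, Finset.mem_univ l, ?_⟩
        rw [hΨl]; norm_num
      have : 0 < c * (∏ v ∈ V, ∑ j, (Ψ (x, 1) j - 0 * v j) ^ 2) ^ N := by positivity
      linarith
    have hpow : ∀ x, evalPoly ℓ x ≠ 0 → 0 < evalPoly ℓ x ^ (2 * V.card * N) := by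
      intro x hx
      rw [mul_assoc]
      exact (even_two_mul _).pow_pos hx
    refine ⟨fun i => if (i : ℕ) = 0 then f0 else F ⟨i, by rw [heq]; exact i.2⟩, ?_⟩
    ext x
    constructor
    · intro hx i
      have h1 := hℓP x hx
      have h2 : evalPoly ℓ x ≠ 0 := by linarith
      by_cases h : (i : ℕ) = 0
      · simp only [h, if_true]
        rw [hf0n x h2]
        have := hcN (u x) (hV ▸ huQ x hx)
        exact mul_nonneg (hpow x h2).le (by linarith)
      · simp only [h, if_false]
        exact (hFnn _ x h2).2 (hpQ _ (huQ x hx) _)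
    · intro hx
      have h1 := hx ⟨0, by omega⟩
      simp only [if_true] at h1
      have h2 : evalPoly ℓ x ≠ 0 := fun h => absurd h1 (not_le.2 (hf0z x h))
      refine hback x h2 fun i => ?_
      by_cases h : (i : ℕ) = 0
      · rw [hf0n x h2] at h1
        have h3 := nonneg_of_mul_nonneg_right h1 (hpow x h2)
        have h4 := mul_nonneg hc.le (pow_nonneg (hg0 (u x)) N)
        have h5 : i = ⟨0, hn⟩ := Fin.ext h
        rw [h5]
        linarith
      · have h3 := hx ⟨i, by rw [← heq]; exact i.2⟩
        simp only [h, if_false] at h3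
        exact (hFnn i x h2).1 h3


/-- If every n-dimensional polytope Q in ℝ^m can be described within
aff Q by n polynomial inequalities p₀,…,p_{n−1} with p₀ > 0 on Q \ vert Q, then every
d-dimensional polyhedron in ℝ^d (d ≥ 2) can be described by d polynomial inequalities. -/
theorem bounded_to_unbounded (d : ℕ) (hd : 2 ≤ d)
    (H : ∀ (m n : ℕ) (Q : Set (E m)), IsPolytope Q → dimS Q = n →
      ∃ p : Fin n → MvPolynomial (Fin m) ℝ,
        Q = {x ∈ (affineSpan ℝ Q : Set (E m)) | ∀ i, 0 ≤ evalPoly (p i) x} ∧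
        ∀ hn : 0 < n, ∀ x ∈ Q, ¬ IsVertexOf Q x → 0 < evalPoly (p ⟨0, hn⟩) x) :
    ∀ P : Set (E d), IsPolyhedron P → dimS P = d →
      ∃ f : Fin d → MvPolynomial (Fin d) ℝ,
        P = {x : E d | ∀ i, 0 ≤ evalPoly (f i) x} := by
  rintro P ⟨hne, m, a, b, hP⟩ hdim
  refine core_s15 (k := m + 1) hd H P hne hdim (Fin.snoc a 0 : Fin (m + 1) → E d)
    (Fin.snoc b 1 : Fin (m + 1) → ℝ) (Fin.last m) (by simp) (by simp) ?_
  rw [hP]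
  ext x
  simp [Fin.forall_fin_succ']
end
end

section
/- Let P be a d-dimensional polytope in ℝ^d, let v be a vertex of P, and let ρ > 0. Then P \ {v} ⊆ int(v + S_ρ(P,v)). -/
open scoped RealInnerProductSpace Pointwise
open Metric Set

noncomputable section

lemma aux_bdd {d : ℕ} {P : Set (E d)} (hP : IsPolytope P) (u : E d) :
    BddAbove ((fun x => ⟪u, x⟫) '' P) := by
  obtain ⟨V, -, rfl⟩ := hP
  have hc : IsCompact (convexHull ℝ (V : Set (E d))) := V.finite_toSet.isCompact_convexHull ℝ
  exact (hc.image (by fun_prop)).bddAbove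

lemma aux_dir {d : ℕ} {P : Set (E d)} (hdim : dimS P = d) :
    (affineSpan ℝ P).direction = ⊤ := by
  apply Submodule.eq_top_of_finrank_eq
  rw [finrank_euclideanSpace_fin]; exact hdim

lemma aux_spec {d : ℕ} {P : Set (E d)} (hP : IsPolytope P) (hdim : dimS P = d)
    {v : E d} {F : Set (E d)} (hF : F ∈ facetsCont P {v}) :
    v ∈ P ∧ (∀ x ∈ P, ⟪outerNormal P F, x⟫ ≤ ⟪outerNormal P F, v⟫) ∧
      ∀ x, x ∈ F ↔ x ∈ P ∧ ⟪outerNormal P F, x⟫ = ⟪outerNormal P F, v⟫ := by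
  obtain ⟨⟨hexp, hd⟩, hvF⟩ := hF
  have hvF : v ∈ F := hvF rfl
  obtain ⟨l, hl⟩ := hexp ⟨v, hvF⟩
  have hvP : v ∈ P := by rw [hl] at hvF; exact hvF.1
  have hvmax : ∀ y ∈ P, l y ≤ l v := by rw [hl] at hvF; exact hvF.2
  set a : E d := (InnerProductSpace.toDual ℝ (E d)).symm l with ha
  have hla : ∀ x, l x = ⟪a, x⟫ := fun x => by simp [ha]
  have ha0 : a ≠ 0 := by
    intro h0
    have : F = P := by
      rw [hl]; ext x; simp [hla, h0]
    rw [this] at hd; omega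
  have hn : 0 < ‖a‖ := norm_pos_iff.2 ha0
  have hex : ∃ u : E d, u ∈ (affineSpan ℝ P).direction ∧ ‖u‖ = 1 ∧ exposedSet P u = F := by
    refine ⟨‖a‖⁻¹ • a, by rw [aux_dir hdim]; trivial, ?_, ?_⟩
    · rw [norm_smul, norm_inv, norm_norm]; field_simp
    · have hs : suppF P (‖a‖⁻¹ • a) = ⟪‖a‖⁻¹ • a, v⟫ := by
        apply le_antisymm
        · apply csSup_le (Set.Nonempty.image _ ⟨v, hvP⟩)
          rintro _ ⟨x, hx, rfl⟩
          simp only [real_inner_smul_left]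
          have := hvmax x hx
          rw [hla, hla] at this
          gcongr
        · exact le_csSup (aux_bdd hP _) ⟨v, hvP, rfl⟩
      ext x
      rw [hl]
      simp only [exposedSet, hs, mem_ofPred_eq, real_inner_smul_left, hla]
      have hi : ‖a‖⁻¹ ≠ 0 := by positivity
      constructor
      · rintro ⟨h1, h2⟩
        refine ⟨h1, fun y hy => ?_⟩
        have h3 := mul_left_cancel₀ hi h2
        have := hvmax y hy
        rw [hla, hla] at this
        rw [h3]; exact this
      · rintro ⟨h1, h2⟩
        refine ⟨h1, ?_⟩
        have := hvmax x h1
        rw [hla, hla] at this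
        rw [le_antisymm this (h2 v hvP)]
  obtain ⟨-, -, h3⟩ := Classical.epsilon_spec hex
  change exposedSet P (outerNormal P F) = F at h3
  have hs : ⟪outerNormal P F, v⟫ = suppF P (outerNormal P F) := by
    rw [← h3] at hvF; rw [h3] at hvF
    have : v ∈ exposedSet P (outerNormal P F) := by rw [h3]; exact hvF
    exact this.2
  refine ⟨hvP, fun x hx => ?_, fun x => ?_⟩
  · rw [hs]; exact le_csSup (aux_bdd hP _) ⟨x, hx, rfl⟩
  · rw [hs]
    constructor
    · intro hx; rw [← h3] at hx; rw [h3] at hx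
      have : x ∈ exposedSet P (outerNormal P F) := by rw [h3]; exact hx
      exact this
    · intro hx
      rw [← h3]; exact hx

lemma aux_finite {d : ℕ} {P : Set (E d)} (hP : IsPolytope P) (hdim : dimS P = d)
    (v : E d) : (facetsCont P {v}).Finite := by
  have hP' := hP
  obtain ⟨V, -, hV⟩ := hP'
  have key : ∀ F ∈ facetsCont P {v}, ∀ G ∈ facetsCont P {v},
      F ∩ (V : Set (E d)) ⊆ G → F ⊆ G := by
    intro F hF G hG hFG x hx
    obtain ⟨-, hF1, hF2⟩ := aux_spec hP hdim hF
    obtain ⟨-, hG1, hG2⟩ := aux_spec hP hdim hG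
    obtain ⟨hxP, hxe⟩ := (hF2 x).1 hx
    rw [hG2]
    refine ⟨hxP, ?_⟩
    have hx' := hxP
    rw [hV, Finset.mem_convexHull'] at hx'
    obtain ⟨w, hw0, hw1, hwx⟩ := hx'
    have hVP : ∀ y ∈ V, y ∈ P := fun y hy => by rw [hV]; exact subset_convexHull ℝ _ hy
    have hsum : ∀ n : E d, ∑ y ∈ V, w y * (⟪n, v⟫ - ⟪n, y⟫) = ⟪n, v⟫ - ⟪n, x⟫ := by
      intro n
      rw [← hwx, inner_sum]
      simp only [mul_sub, Finset.sum_sub_distrib, ← Finset.sum_mul, hw1, real_inner_smul_right,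
        one_mul]
    have h0 := hsum (outerNormal P F)
    rw [hxe, sub_self, Finset.sum_eq_zero_iff_of_nonneg] at h0
    · have h1 := hsum (outerNormal P G)
      rw [Finset.sum_eq_zero] at h1
      · linarith
      · intro y hy
        rcases mul_eq_zero.1 (h0 y hy) with h | h
        · simp [h]
        · have : y ∈ F := (hF2 y).2 ⟨hVP y hy, by linarith⟩
          have := (hG2 y).1 (hFG ⟨this, hy⟩)
          rw [this.2]; simp
    · intro y hy
      exact mul_nonneg (hw0 y hy) (by linarith [hF1 y (hVP y hy)])
  apply Set.Finite.of_finite_image (f := fun F => F ∩ (V : Set (E d)))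
  · apply V.finite_toSet.powerset.subset
    rintro _ ⟨F, -, rfl⟩
    exact inter_subset_right
  · intro F hF G hG h
    simp only at h
    exact Subset.antisymm (key F hF G hG (h ▸ inter_subset_left))
      (key G hG F hF (h ▸ inter_subset_left))

/-- span of tight directions -/
def tightSpan {d : ℕ} (V : Finset (E d)) (v u : E d) : Submodule ℝ (E d) :=
  Submodule.span ℝ {z | ∃ y ∈ V, ⟪u, y - v⟫ = 0 ∧ z = y - v}

lemma tightSpan_orth {d : ℕ} (V : Finset (E d)) (v u : E d) {z : E d}
    (hz : z ∈ tightSpan V v u) : ⟪u, z⟫ = 0 := by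
  induction hz using Submodule.span_induction with
  | mem x h => obtain ⟨y, -, h, rfl⟩ := h; exact h
  | zero => simp
  | add x y _ _ h1 h2 => rw [inner_add_right, h1, h2, add_zero]
  | smul a x _ h => rw [real_inner_smul_right, h, mul_zero]

lemma aux_hull {d : ℕ} (V : Finset (E d)) (v u : E d) (h : ∀ y ∈ V, ⟪u, y - v⟫ ≤ 0) :
    ∀ y ∈ convexHull ℝ (V : Set (E d)), ⟪u, y - v⟫ ≤ 0 := by
  intro y hy
  rw [Finset.mem_convexHull'] at hy
  obtain ⟨w, hw0, hw1, rfl⟩ := hy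
  have : ⟪u, ∑ y ∈ V, w y • y - v⟫ = ∑ y ∈ V, w y * ⟪u, y - v⟫ := by
    simp only [inner_sub_right, inner_sum, mul_sub, Finset.sum_sub_distrib, ← Finset.sum_mul, hw1,
      real_inner_smul_right, one_mul]
  rw [this]
  exact Finset.sum_nonpos fun y hy => mul_nonpos_of_nonneg_of_nonpos (hw0 y hy) (h y hy)

lemma aux_step {d : ℕ} (V : Finset (E d)) (hdim : dimS (convexHull ℝ (V : Set (E d))) = d)
    (v x u : E d) (hvP : v ∈ convexHull ℝ (V : Set (E d)))
    (hu : ∀ y ∈ V, ⟪u, y - v⟫ ≤ 0) (hx : ⟪u, x - v⟫ < 0)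
    (hlt : tightSpan V v u ⊔ Submodule.span ℝ {x - v} ≠ ⊤) :
    ∃ u' : E d, (∀ y ∈ V, ⟪u', y - v⟫ ≤ 0) ∧ ⟪u', x - v⟫ < 0 ∧
      tightSpan V v u < tightSpan V v u' := by
  -- direction
  obtain ⟨w, hw, hw0⟩ := Submodule.exists_mem_ne_zero_of_ne_bot
    (mt (Submodule.orthogonal_eq_bot_iff).1 hlt)
  rw [Submodule.mem_orthogonal'] at hw
  have hwx : ⟪w, x - v⟫ = 0 :=
    hw _ (Submodule.mem_sup_right (Submodule.mem_span_singleton_self _))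
  have hwL : ∀ z ∈ tightSpan V v u, ⟪w, z⟫ = 0 := fun z hz => hw _ (Submodule.mem_sup_left hz)
  clear hw
  -- sign
  have hne : ∃ y ∈ V, ⟪w, y - v⟫ ≠ 0 := by
    by_contra! hcon
    have h1 := aux_hull V v w (fun y hy => (hcon y hy).le)
    have h2 := aux_hull V v (-w) (fun y hy => by rw [inner_neg_left, hcon y hy, neg_zero])
    have h3 : (affineSpan ℝ (convexHull ℝ (V : Set (E d)))).direction ≤ (Submodule.span ℝ {w})ᗮ := by
      rw [direction_affineSpan, vectorSpan_eq_span_vsub_set_right ℝ hvP, Submodule.span_le]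
      rintro _ ⟨y, hy, rfl⟩
      rw [SetLike.mem_coe, Submodule.mem_orthogonal_singleton_iff_inner_right]
      have := h1 y hy
      have := h2 y hy
      rw [inner_neg_left] at this
      simp only [vsub_eq_sub]
      linarith
    rw [aux_dir hdim] at h3
    have := h3 (Submodule.mem_top (x := w))
    rw [Submodule.mem_orthogonal_singleton_iff_inner_right] at this
    exact hw0 (inner_self_eq_zero.1 this)
  obtain ⟨w, hwx, hwL, y0, hy0, hpos⟩ : ∃ w : E d, ⟪w, x - v⟫ = 0 ∧
      (∀ z ∈ tightSpan V v u, ⟪w, z⟫ = 0) ∧ ∃ y ∈ V, 0 < ⟪w, y - v⟫ := by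
    obtain ⟨y, hy, h⟩ := hne
    rcases lt_or_gt_of_ne h with h | h
    · refine ⟨-w, by rw [inner_neg_left, hwx, neg_zero],
        fun z hz => by rw [inner_neg_left, hwL z hz, neg_zero], y, hy, ?_⟩
      rw [inner_neg_left]; linarith
    · exact ⟨w, hwx, hwL, y, hy, h⟩
  obtain ⟨y1, hy1, hmin⟩ := Finset.exists_min_image (V.filter fun y => 0 < ⟪w, y - v⟫)
    (fun y => -⟪u, y - v⟫ / ⟪w, y - v⟫) ⟨y0, by simp [hy0, hpos]⟩
  rw [Finset.mem_filter] at hy1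
  obtain ⟨hy1, hy1p⟩ := hy1
  set t := -⟪u, y1 - v⟫ / ⟪w, y1 - v⟫ with ht
  have ht0 : 0 ≤ t := div_nonneg (by linarith [hu y1 hy1]) hy1p.le
  have hin : ∀ z, ⟪u + t • w, z⟫ = ⟪u, z⟫ + t * ⟪w, z⟫ := fun z => by
    rw [inner_add_left, real_inner_smul_left]
  refine ⟨u + t • w, fun y hy => ?_, by rw [hin, hwx]; linarith, ?_⟩
  · rw [hin]
    by_cases hp : 0 < ⟪w, y - v⟫
    · have := hmin y (by simp [hy, hp])
      rw [le_div_iff₀ hp] at this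
      linarith
    · nlinarith [hu y hy]
  · have hy1t : ⟪u + t • w, y1 - v⟫ = 0 := by
      rw [hin, ht]; field_simp; ring
    apply lt_of_le_of_ne
    · apply Submodule.span_mono
      rintro _ ⟨y, hy, h, rfl⟩
      refine ⟨y, hy, ?_, rfl⟩
      rw [hin, h, hwL _ (Submodule.subset_span ⟨y, hy, h, rfl⟩)]; simp
    · intro heq
      have : y1 - v ∈ tightSpan V v u := by
        rw [heq]; exact Submodule.subset_span ⟨y1, hy1, hy1t, rfl⟩
      rw [hwL _ this] at hy1p
      exact lt_irrefl _ hy1p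

lemma aux_exists {d : ℕ} (V : Finset (E d)) (hdim : dimS (convexHull ℝ (V : Set (E d))) = d)
    (v x : E d) (hvP : v ∈ convexHull ℝ (V : Set (E d))) (n : ℕ) :
    ∀ u : E d, (∀ y ∈ V, ⟪u, y - v⟫ ≤ 0) → ⟪u, x - v⟫ < 0 →
      d - Module.finrank ℝ (tightSpan V v u) ≤ n →
    ∃ u : E d, (∀ y ∈ V, ⟪u, y - v⟫ ≤ 0) ∧ ⟪u, x - v⟫ < 0 ∧
      tightSpan V v u ⊔ Submodule.span ℝ {x - v} = ⊤ := by
  induction n with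
  | zero =>
    intro u h1 h2 h3
    refine ⟨u, h1, h2, ?_⟩
    have : tightSpan V v u = ⊤ := by
      apply Submodule.eq_top_of_finrank_eq
      apply le_antisymm (Submodule.finrank_le _)
      rw [finrank_euclideanSpace_fin]; omega
    rw [this, top_sup_eq]
  | succ n ih =>
    intro u h1 h2 h3
    by_cases h : tightSpan V v u ⊔ Submodule.span ℝ {x - v} = ⊤
    · exact ⟨u, h1, h2, h⟩
    · obtain ⟨u', h1', h2', hlt⟩ := aux_step V hdim v x u hvP h1 h2 h
      have := Submodule.finrank_lt_finrank_of_lt hlt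
      exact ih u' h1' h2' (by omega)

lemma aux_facet {d : ℕ} {P : Set (E d)} (hP : IsPolytope P) (hdim : dimS P = d)
    {v : E d} (hv : IsVertexOf P v) {x : E d} (hxP : x ∈ P) (hxv : x ≠ v) :
    ∃ F ∈ facetsCont P {v}, x ∉ F := by
  obtain ⟨V, -, rfl⟩ := hP
  set P := convexHull ℝ (V : Set (E d)) with hPdef
  obtain ⟨l, hl⟩ := hv ⟨v, rfl⟩
  have hvm : v ∈ {x ∈ P | ∀ y ∈ P, l y ≤ l x} := by rw [← hl]; rfl
  obtain ⟨hvP, hvmax⟩ := hvm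
  set a : E d := (InnerProductSpace.toDual ℝ (E d)).symm l with ha
  have hla : ∀ x, l x = ⟪a, x⟫ := fun x => by simp [ha]
  have hVP : ∀ y ∈ V, y ∈ P := fun y hy => subset_convexHull ℝ _ hy
  have hxlt : l x < l v := by
    refine lt_of_le_of_ne (hvmax x hxP) fun h => hxv ?_
    have : x ∈ ({v} : Set (E d)) := by
      rw [hl]; exact ⟨hxP, fun y hy => h ▸ hvmax y hy⟩
    exact this
  obtain ⟨u, hu, hux, htop⟩ := aux_exists V hdim v x hvP _ a
    (fun y hy => by rw [inner_sub_right, ← hla, ← hla]; linarith [hvmax y (hVP y hy)])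
    (by rw [inner_sub_right, ← hla, ← hla]; linarith) le_rfl
  have huP := aux_hull V v u hu
  set F : Set (E d) := {y ∈ P | ⟪u, y - v⟫ = 0} with hFdef
  have hvF : v ∈ F := ⟨hvP, by simp⟩
  refine ⟨F, ⟨⟨fun _ => ⟨InnerProductSpace.toDual ℝ (E d) u, ?_⟩, ?_⟩, by simpa using hvF⟩,
    fun h => hux.ne h.2⟩
  · ext y
    simp only [hFdef, mem_ofPred_eq, InnerProductSpace.toDual_apply_apply]
    constructor
    · rintro ⟨h1, h2⟩
      refine ⟨h1, fun z hz => ?_⟩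
      have := huP z hz
      rw [inner_sub_right] at this h2
      linarith
    · rintro ⟨h1, h2⟩
      refine ⟨h1, le_antisymm (huP y h1) ?_⟩
      rw [inner_sub_right]; linarith [h2 v hvP]
  · rw [hdim]
    have hD : (affineSpan ℝ F).direction = Submodule.span ℝ ((· -ᵥ v) '' F) := by
      rw [direction_affineSpan, vectorSpan_eq_span_vsub_set_right ℝ hvF]
    have h1 : tightSpan V v u ≤ (affineSpan ℝ F).direction := by
      rw [hD]
      apply Submodule.span_mono
      rintro _ ⟨y, hy, h, rfl⟩
      exact ⟨y, ⟨hVP y hy, h⟩, rfl⟩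
    have h2 : (affineSpan ℝ F).direction < ⊤ := by
      rw [lt_top_iff_ne_top]
      intro h
      have h3 : (affineSpan ℝ F).direction ≤ (Submodule.span ℝ {u})ᗮ := by
        rw [hD, Submodule.span_le]
        rintro _ ⟨y, hy, rfl⟩
        rw [SetLike.mem_coe, Submodule.mem_orthogonal_singleton_iff_inner_right]
        exact hy.2
      rw [h] at h3
      have := h3 (Submodule.mem_top (x := x - v))
      rw [Submodule.mem_orthogonal_singleton_iff_inner_right] at this
      exact hux.ne this
    have h3 := Submodule.finrank_lt h2.ne
    have h4 := Submodule.finrank_mono h1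
    have h5 := Submodule.finrank_add_le_finrank_add_finrank (tightSpan V v u)
      (Submodule.span ℝ {x - v})
    rw [htop, finrank_top, finrank_euclideanSpace_fin] at h5
    have h6 := finrank_span_le_card (R := ℝ) ({x - v} : Set (E d))
    simp only [Set.toFinset_singleton, Finset.card_singleton] at h6
    rw [finrank_euclideanSpace_fin] at h3
    unfold dimS
    omega

lemma aux_neg {d : ℕ} {P : Set (E d)} (hP : IsPolytope P) (hdim : dimS P = d)
    {v : E d} (hv : IsVertexOf P v) {x : E d} (hxP : x ∈ P) (hxv : x ≠ v) :
    ⟪x - v, uface P {v}⟫ < 0 := by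
  have hfin := aux_finite hP hdim v
  obtain ⟨F, hF, hxF⟩ := aux_facet hP hdim hv hxP hxv
  have hs : ⟪x - v, ∑ᶠ F ∈ facetsCont P {v}, outerNormal P F⟫ < 0 := by
    rw [finsum_mem_eq_finite_toFinset_sum _ hfin, inner_sum]
    apply Finset.sum_neg'
    · intro G hG
      rw [hfin.mem_toFinset] at hG
      have := (aux_spec hP hdim hG).2.1 x hxP
      rw [real_inner_comm, inner_sub_right]; linarith
    · refine ⟨F, hfin.mem_toFinset.2 hF, ?_⟩
      obtain ⟨-, h1, h2⟩ := aux_spec hP hdim hF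
      rw [real_inner_comm, inner_sub_right, sub_neg]
      exact lt_of_le_of_ne (h1 x hxP) fun h => hxF ((h2 x).2 ⟨hxP, h⟩)
  unfold uface
  rw [real_inner_smul_right]
  apply mul_neg_of_pos_of_neg _ hs
  rw [inv_pos, norm_pos_iff]
  intro h
  rw [h, inner_zero_right] at hs
  exact lt_irrefl _ hs

/-- P \ {v} ⊆ int(v + S_ρ(P,v)) for every vertex v of a d-polytope P
and every ρ > 0. -/
theorem polytope_subset_interior_outer_cone {d : ℕ} (P : Set (E d))
    (hP : IsPolytope P) (hdim : dimS P = d)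
    (v : E d) (hv : IsVertexOf P v) (ρ : ℝ) (hρ : 0 < ρ) :
    P \ {v} ⊆ interior ((fun s => v + s) '' Srho P v ρ) := by
  rintro x ⟨hxP, hxv⟩
  have hneg := aux_neg hP hdim hv hxP hxv
  set u := uface P {v} with hu
  set f : E d → E d := fun y => (-⟪y - v, u⟫)⁻¹ • (y - v) with hf
  have hfH : ∀ y, ⟪y - v, u⟫ < 0 → f y ∈ Hv P v := by
    intro y hy
    change ⟪f y, u⟫ = -1
    rw [hf, real_inner_smul_left]
    have := hy.ne
    field_simp
  have hcont : ContinuousAt f x := by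
    have h1 : -⟪x - v, u⟫ ≠ 0 := neg_ne_zero.2 hneg.ne
    have h2 : ContinuousAt (fun y : E d => -⟪y - v, u⟫) x := by fun_prop
    have h3 : ContinuousAt (fun y : E d => y - v) x := by fun_prop
    exact (h2.inv₀ h1).smul h3
  rw [mem_interior_iff_mem_nhds]
  have hc2 : ContinuousAt (fun y : E d => ⟪y - v, u⟫) x := by fun_prop
  filter_upwards [hc2.eventually (gt_mem_nhds hneg), hcont (Metric.closedBall_mem_nhds (f x) hρ)]
    with y hy hyb
  refine ⟨y - v, ⟨1, fun _ => -⟪y - v, u⟫, fun _ => f y, fun _ => by linarith,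
    fun _ => ⟨⟨f x, ⟨⟨1, fun _ => (-⟪x - v, u⟫)⁻¹, fun _ => x - v, fun _ => ?_,
      fun _ => ⟨x, hxP, rfl⟩, by simp [hf]⟩, hfH x hneg⟩, f y - f x, ?_, by simp⟩, hfH y hy⟩, ?_⟩,
      by simp⟩
  · exact inv_nonneg.2 (by linarith)
  · rw [mem_closedBall_zero_iff, ← dist_eq_norm]; exact hyb
  · have : -⟪y - v, u⟫ ≠ 0 := by
      have := hy.ne
      exact neg_ne_zero.2 this
    simp only [hf, Finset.univ_unique, Finset.sum_const, Finset.card_singleton, one_smul]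
    rw [smul_inv_smul₀ this]
end
end
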